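/- arXiv:1406.6785 — 3 statements merged into one kernel-verified Lean document; each statement's English description precedes it below -/
import Mathlib

section
/- Let β ≥ 2 and let T_β : [0,1) → [0,1) be the Manneville–Pomeau map defined by T_β(x) = x + 2^{β−1}x^β for x < 1/2 and T_β(x) = 2x − 1 for x ≥ 1/2. Let α ≥ 1 and r_j = j^{−α}. Then for Lebesgue-almost every x, the Hausdorff dimension of E(x,r) equals 1/(α(β−1)). -/
open MeasureTheory Filter Set

/-- `E(x,r)`: the set of `y ∈ [0,1]` such that `|Tⁿ x − y| < r n` for infinitely many `n`. -/
def hitSet (T : ℝ → ℝ) (x : ℝ) (r : ℕ → ℝ) : Set ℝ :=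
  {y ∈ Set.Icc (0 : ℝ) 1 | ∃ᶠ n in Filter.atTop, |T^[n] x - y| < r n}

/-- The Manneville–Pomeau map with parameter `β`, as a map on `[0,1)`. -/
noncomputable def MannevillePomeau (β : ℝ) : ℝ → ℝ :=
  fun x => if x < 1 / 2 then x + 2 ^ (β - 1) * x ^ β else 2 * x - 1


namespace MP

noncomputable def ff (β x : ℝ) : ℝ := x + 2 ^ (β - 1) * x ^ β
noncomputable def fd (β x : ℝ) : ℝ := 1 + 2 ^ (β - 1) * (β * x ^ (β - 1))

lemma two_rpow_pos (β : ℝ) : (0:ℝ) < 2 ^ (β - 1) := by positivity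

lemma fd_ge {β x : ℝ} (hβ : 2 ≤ β) (hx : 0 ≤ x) : 1 ≤ fd β x := by
  unfold fd
  have h1 := two_rpow_pos β
  have h2 : 0 ≤ x ^ (β - 1) := Real.rpow_nonneg hx _
  have : 0 ≤ 2 ^ (β - 1) * (β * x ^ (β - 1)) := by positivity
  linarith

lemma rpow_tangent {β x x' : ℝ} (hβ : 2 ≤ β) (hx : 0 ≤ x) (hx' : 0 ≤ x') :
    β * x ^ (β - 1) * (x' - x) ≤ x' ^ β - x ^ β := by
  rcases hx.eq_or_lt with h | h
  · subst h
    rw [Real.zero_rpow (by linarith), Real.zero_rpow (by linarith)]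
    have := Real.rpow_nonneg hx' β
    linarith
  · have hb := one_add_mul_self_le_rpow_one_add (s := x' / x - 1) (p := β)
      (by have : 0 ≤ x' / x := by positivity
          linarith) (by linarith)
    have e1 : 1 + (x' / x - 1) = x' / x := by ring
    rw [e1, Real.div_rpow hx' hx] at hb
    have hp : 0 < x ^ β := Real.rpow_pos_of_pos h _
    rw [le_div_iff₀ hp] at hb
    have e2 : x ^ β = x ^ (β - 1) * x := by
      rw [← Real.rpow_add_one h.ne', sub_add_cancel]
    have e3 : (1 + β * (x' / x - 1)) * x ^ β = x ^ β + β * x ^ (β - 1) * (x' - x) := by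
      rw [e2]; field_simp
    linarith

lemma ff_tangent {β x x' : ℝ} (hβ : 2 ≤ β) (hx : 0 ≤ x) (hx' : 0 ≤ x') :
    fd β x * (x' - x) ≤ ff β x' - ff β x := by
  have h := rpow_tangent hβ hx hx'
  have h1 := mul_le_mul_of_nonneg_left h (two_rpow_pos β).le
  unfold fd ff
  nlinarith

lemma ff_sub_ge {β x x' : ℝ} (hβ : 2 ≤ β) (hx : 0 ≤ x) (hx' : x ≤ x') :
    x' - x ≤ ff β x' - ff β x := by
  have h := ff_tangent hβ hx (hx.trans hx')
  have := fd_ge hβ hx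
  nlinarith

lemma ff_zero {β : ℝ} (hβ : 2 ≤ β) : ff β 0 = 0 := by
  unfold ff; rw [Real.zero_rpow (by linarith)]; simp

lemma ff_half (β : ℝ) : ff β (1/2) = 1 := by
  unfold ff
  rw [one_div, Real.inv_rpow (by norm_num), Real.rpow_sub_one (by norm_num)]
  have : (0:ℝ) < 2 ^ β := by positivity
  field_simp; norm_num

lemma ff_cont {β : ℝ} (hβ : 2 ≤ β) : Continuous (ff β) := by
  unfold ff
  exact continuous_id.add (continuous_const.mul (Real.continuous_rpow_const (by linarith)))

lemma ff_surj {β : ℝ} (hβ : 2 ≤ β) (y : ℝ) (hy : y ∈ Icc (0:ℝ) 1) :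
    ∃ x ∈ Icc (0:ℝ) (1/2), ff β x = y := by
  have := intermediate_value_Icc (show (0:ℝ) ≤ 1/2 by norm_num) (ff_cont hβ).continuousOn
  rw [ff_zero hβ, ff_half] at this
  exact this hy

open Classical in
noncomputable def g (β y : ℝ) : ℝ :=
  if h : ∃ x ∈ Icc (0:ℝ) (1/2), ff β x = y then h.choose else 0

lemma g_spec {β y : ℝ} (hβ : 2 ≤ β) (hy : y ∈ Icc (0:ℝ) 1) :
    g β y ∈ Icc (0:ℝ) (1/2) ∧ ff β (g β y) = y := by
  have h := ff_surj hβ y hy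
  unfold g
  rw [dif_pos h]
  exact h.choose_spec

lemma ff_lt {β x x' : ℝ} (hβ : 2 ≤ β) (hx : 0 ≤ x) (h : x < x') : ff β x < ff β x' := by
  have := ff_sub_ge hβ hx h.le
  linarith

lemma ff_nonneg {β x : ℝ} (hβ : 2 ≤ β) (hx : 0 ≤ x) : 0 ≤ ff β x := by
  have := ff_sub_ge hβ le_rfl hx
  rw [ff_zero hβ] at this; linarith

lemma ff_inj {β x x' : ℝ} (hβ : 2 ≤ β) (hx : 0 ≤ x) (hx' : 0 ≤ x') (h : ff β x = ff β x') :
    x = x' := by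
  rcases lt_trichotomy x x' with h1 | h1 | h1
  · have := ff_lt hβ hx h1; linarith
  · exact h1
  · have := ff_lt hβ hx' h1; linarith

lemma g_ff {β x : ℝ} (hβ : 2 ≤ β) (hx : x ∈ Icc (0:ℝ) (1/2)) : g β (ff β x) = x := by
  have h1 : ff β x ∈ Icc (0:ℝ) 1 := by
    refine ⟨ff_nonneg hβ hx.1, ?_⟩
    have := ff_sub_ge hβ hx.1 hx.2
    rw [ff_half] at this; linarith [hx.2]
  have := g_spec hβ h1
  exact ff_inj hβ this.1.1 hx.1 this.2

lemma g_one {β : ℝ} (hβ : 2 ≤ β) : g β 1 = 1/2 := by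
  have := g_ff hβ (x := 1/2) (by constructor <;> norm_num)
  rwa [ff_half] at this

lemma g_mono {β y z : ℝ} (hβ : 2 ≤ β) (hy : 0 ≤ y) (hyz : y ≤ z) (hz : z ≤ 1) :
    g β y ≤ g β z := by
  have h1 := g_spec hβ (y := y) ⟨hy, hyz.trans hz⟩
  have h2 := g_spec hβ (y := z) ⟨hy.trans hyz, hz⟩
  by_contra h
  push Not at h
  have := ff_lt hβ h2.1.1 h
  linarith

lemma g_pos {β y : ℝ} (hβ : 2 ≤ β) (hy : 0 < y) (hz : y ≤ 1) : 0 < g β y := by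
  have h1 := g_spec hβ (y := y) ⟨hy.le, hz⟩
  rcases h1.1.1.eq_or_lt with h | h
  · rw [← h, ff_zero hβ] at h1; linarith [h1.2]
  · exact h

/-- iterates of `g` with a supergradient -/
structure Kg (β : ℝ) (φ e : ℝ → ℝ) : Prop where
  mem : ∀ y, 0 < y → y ≤ 1 → 0 < φ y ∧ φ y ≤ 1
  pos : ∀ y, 0 < y → y ≤ 1 → 0 < e y ∧ e y ≤ 1
  grad : ∀ y z, 0 < y → y ≤ z → z ≤ 1 → e z * (z - y) ≤ φ z - φ y ∧ φ z - φ y ≤ e y * (z - y)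
  dist : ∀ y z, 0 < y → y ≤ z → z ≤ 1 → e y * y ^ β ≤ e z * z ^ β
  star : ∀ y z, 0 < y → y ≤ z → z ≤ 1 → φ z * y ≤ φ y * z

lemma Kg_id {β : ℝ} (hβ : 2 ≤ β) : Kg β id (fun _ => 1) where
  mem y h1 h2 := ⟨h1, h2⟩
  pos y h1 h2 := by norm_num
  grad y z _ _ _ := by simp
  dist y z h1 h2 _ := by
    simp only [one_mul]; exact Real.rpow_le_rpow h1.le h2 (by linarith)
  star y z _ _ _ := by simp [mul_comm]

/-- distortion inequality for `ff` -/
lemma ff_dist {β x x' : ℝ} (hβ : 2 ≤ β) (hx : 0 < x) (h : x ≤ x') :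
    (ff β x) ^ β / (x ^ β * fd β x) ≤ (ff β x') ^ β / (x' ^ β * fd β x') := by
  have hx' := hx.trans_le h
  have key : ∀ t : ℝ, 0 < t → ff β t ^ β / (t ^ β * fd β t) =
      (1 + 2^(β-1) * t^(β-1)) ^ β / (1 + β * (2^(β-1) * t^(β-1))) := by
    intro t ht
    have e : ff β t = t * (1 + 2^(β-1) * t^(β-1)) := by
      unfold ff
      have : t ^ β = t ^ (β - 1) * t := by
        rw [← Real.rpow_add_one ht.ne']; congr 1; ring
      rw [this]; ring
    have hv : 0 ≤ 1 + 2^(β-1) * t^(β-1) := by positivity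
    rw [e, Real.mul_rpow ht.le hv, mul_div_mul_left _ _ (by positivity)]
    unfold fd; congr 1; ring
  rw [key x hx, key x' hx']
  set v := 2^(β-1) * x^(β-1) with hv
  set w := 2^(β-1) * x'^(β-1) with hw
  have hv0 : 0 ≤ v := by positivity
  have hvw : v ≤ w := by
    apply mul_le_mul_of_nonneg_left _ (by positivity)
    exact Real.rpow_le_rpow hx.le h (by linarith)
  have hb := one_add_mul_self_le_rpow_one_add (s := (w - v) / (1 + v)) (p := β)
      (by have : 0 ≤ (w - v) / (1 + v) := div_nonneg (by linarith) (by linarith)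
          linarith) (by linarith)
  have e1 : 1 + (w - v) / (1 + v) = (1 + w) / (1 + v) := by field_simp; ring
  rw [e1, Real.div_rpow (by linarith) (by linarith)] at hb
  have hp : 0 < (1 + v) ^ β := Real.rpow_pos_of_pos (by linarith) _
  have hbv : 0 < 1 + β * v := by positivity
  have hbw : 0 < 1 + β * w := by have : 0 ≤ w := hv0.trans hvw
                                 positivity
  have h3 : (1 + β * w) / (1 + β * v) ≤ 1 + β * ((w - v) / (1 + v)) := by
    have : 1 + β * ((w - v) / (1 + v)) = (1 + v + β * (w - v)) / (1 + v) := by field_simp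
    rw [this, div_le_div_iff₀ hbv (by linarith)]
    have : 0 ≤ (β - 1) * β * v * (w - v) := by
      have : 0 ≤ w - v := by linarith
      have : 0 ≤ β - 1 := by linarith
      positivity
    nlinarith
  have h4 := h3.trans hb
  rw [div_le_div_iff₀ hbv hp] at h4
  rw [div_le_div_iff₀ hbv hbw]
  linarith

lemma Kg_comp {β : ℝ} (hβ : 2 ≤ β) {φ e : ℝ → ℝ} (H : Kg β φ e) :
    Kg β (φ ∘ g β) (fun y => e (g β y) / fd β (g β y)) := by
  have gm : ∀ y, 0 < y → y ≤ 1 → 0 < g β y ∧ g β y ≤ 1 ∧ ff β (g β y) = y ∧ 1 ≤ fd β (g β y) := by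
    intro y h1 h2
    have := g_spec hβ (y := y) ⟨h1.le, h2⟩
    refine ⟨g_pos hβ h1 h2, by linarith [this.1.2], this.2, fd_ge hβ this.1.1⟩
  constructor
  · intro y h1 h2
    exact H.mem _ (gm y h1 h2).1 (gm y h1 h2).2.1
  · intro y h1 h2
    obtain ⟨a, b, c, d⟩ := gm y h1 h2
    obtain ⟨p, q⟩ := H.pos _ a b
    refine ⟨by positivity, ?_⟩
    rw [div_le_one (by linarith)]; linarith
  · intro y z h1 h2 h3
    obtain ⟨a, b, c, d⟩ := gm y h1 (h2.trans h3)
    obtain ⟨a', b', c', d'⟩ := gm z (h1.trans_le h2) h3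
    have hm := g_mono hβ h1.le h2 h3
    obtain ⟨p, q⟩ := H.grad _ _ a hm b'
    have t1 := ff_tangent hβ a.le a'.le
    have t2 := ff_tangent hβ a'.le a.le
    rw [c, c'] at t1 t2
    have ep := (H.pos _ a b).1
    have ep' := (H.pos _ a' b').1
    simp only [Function.comp]
    constructor
    · refine le_trans ?_ p
      rw [div_mul_eq_mul_div, div_le_iff₀ (by linarith), mul_assoc]
      exact mul_le_mul_of_nonneg_left (by linarith) ep'.le
    · refine le_trans q ?_
      rw [div_mul_eq_mul_div, le_div_iff₀ (by linarith), mul_assoc]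
      exact mul_le_mul_of_nonneg_left (by linarith) ep.le
  · intro y z h1 h2 h3
    obtain ⟨a, b, c, d⟩ := gm y h1 (h2.trans h3)
    obtain ⟨a', b', c', d'⟩ := gm z (h1.trans_le h2) h3
    have hm := g_mono hβ h1.le h2 h3
    have k1 := H.dist _ _ a hm b'
    have k2 := ff_dist hβ a hm
    rw [c, c'] at k2
    have ep := (H.pos _ a b).1
    have ep' := (H.pos _ a' b').1
    have hz := h1.trans_le h2
    have : ∀ e f u w : ℝ, 0 < f → 0 < w → e / f * u = (e * w) * (u / (w * f)) := by
      intro e f u w hf hw; field_simp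
    rw [this _ _ _ (g β y ^ β) (by linarith) (by positivity),
      this _ _ _ (g β z ^ β) (by linarith) (by positivity)]
    exact mul_le_mul k1 k2 (by positivity) (by positivity)
  · intro y z h1 h2 h3
    obtain ⟨a, b, c, d⟩ := gm y h1 (h2.trans h3)
    obtain ⟨a', b', c', d'⟩ := gm z (h1.trans_le h2) h3
    have hm := g_mono hβ h1.le h2 h3
    have k1 := H.star _ _ a hm b'
    simp only [Function.comp]
    -- g z * y ≤ g y * z
    have k2 : g β z * y ≤ g β y * z := by
      set p := g β y
      set q := g β z
      rw [← c, ← c']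
      have e : ∀ t : ℝ, 0 < t → ff β t = t * (1 + 2^(β-1) * t^(β-1)) := by
        intro t ht
        unfold ff
        have : t ^ β = t ^ (β - 1) * t := by
          rw [← Real.rpow_add_one ht.ne']; congr 1; ring
        rw [this]; ring
      rw [e p a, e q a']
      have : p ^ (β - 1) ≤ q ^ (β - 1) := Real.rpow_le_rpow a.le hm (by linarith)
      have h5 := mul_le_mul_of_nonneg_left this (two_rpow_pos β).le
      have : 0 < p * q := by positivity
      nlinarith
    have f1 := (H.mem _ a b).1
    have hz := h1.trans_le h2
    have f2 := (H.mem _ a' b').1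
    -- φ(gz) gy ≤ φ(gy) gz
    have h6 : φ (g β z) * g β y * (g β z * y) ≤ φ (g β y) * g β z * (g β y * z) :=
      mul_le_mul k1 k2 (by positivity) (by positivity)
    have h7 : 0 < g β y * g β z := by positivity
    have : (φ (g β z) * y) * (g β y * g β z) ≤ (φ (g β y) * z) * (g β y * g β z) := by linarith
    exact le_of_mul_le_mul_right this h7

lemma Kg_iter {β : ℝ} (hβ : 2 ≤ β) (m : ℕ) : ∃ e, Kg β ((g β)^[m]) e := by
  induction m with
  | zero => exact ⟨_, Kg_id hβ⟩
  | succ m ih =>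
    obtain ⟨e, he⟩ := ih
    exact ⟨_, by rw [Function.iterate_succ]; exact Kg_comp hβ he⟩

/-- inverse branches of the jump transformation -/
noncomputable def br (β : ℝ) (m : ℕ) (y : ℝ) : ℝ := (g β)^[m] ((1 + y) / 2)

/-- endpoints -/
noncomputable def aa (β : ℝ) (m : ℕ) : ℝ := (g β)^[m] 1

lemma br_one (β : ℝ) (m : ℕ) : br β m 1 = aa β m := by
  unfold br aa; norm_num

lemma br_zero {β : ℝ} (hβ : 2 ≤ β) (m : ℕ) : br β m 0 = aa β (m+1) := by
  unfold br aa
  rw [Function.iterate_succ_apply, g_one hβ]; norm_num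

structure K (β : ℝ) (h d : ℝ → ℝ) : Prop where
  pos : ∀ y, 0 ≤ y → y ≤ 1 → 0 < d y
  grad : ∀ y z, 0 ≤ y → y ≤ z → z ≤ 1 → d z * (z - y) ≤ h z - h y ∧ h z - h y ≤ d y * (z - y)
  dist : ∀ y z, 0 ≤ y → y ≤ z → z ≤ 1 → d y * (1 + y) ^ (2 * β) ≤ d z * (1 + z) ^ (2 * β)

lemma K_id {β : ℝ} (hβ : 2 ≤ β) : K β id (fun _ => 1) where
  pos y _ _ := one_pos
  grad y z _ _ _ := by simp
  dist y z h1 h2 _ := by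
    simp only [one_mul]; exact Real.rpow_le_rpow (by linarith) (by linarith) (by linarith)

lemma K.anti {β : ℝ} {h d : ℝ → ℝ} (H : K β h d) {y z : ℝ} (h0 : 0 ≤ y) (h1 : y ≤ z) (h2 : z ≤ 1) :
    d z ≤ d y := by
  rcases h1.eq_or_lt with h | h
  · rw [h]
  · have := H.grad y z h0 h1 h2
    have h3 := this.1.trans this.2
    exact le_of_mul_le_mul_right h3 (by linarith)

lemma K.mono {β : ℝ} {h d : ℝ → ℝ} (H : K β h d) {y z : ℝ} (h0 : 0 ≤ y) (h1 : y ≤ z) (h2 : z ≤ 1) :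
    h y ≤ h z := by
  have := (H.grad y z h0 h1 h2).1
  have h3 := H.pos z (h0.trans h1) h2
  have : 0 ≤ d z * (z - y) := mul_nonneg h3.le (by linarith)
  linarith

lemma br_props {β : ℝ} (hβ : 2 ≤ β) (m : ℕ) : ∃ e : ℝ → ℝ,
    (∀ y, 0 ≤ y → y ≤ 1 → 0 < e y ∧ e y ≤ 1/2 ∧ 0 < br β m y ∧ br β m y ≤ 1) ∧
    (∀ y z, 0 ≤ y → y ≤ z → z ≤ 1 → e z * (z - y) ≤ br β m z - br β m y ∧
      br β m z - br β m y ≤ e y * (z - y) ∧ e y * (1 + y) ^ β ≤ e z * (1 + z) ^ β ∧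
      (1 + br β m z) ^ 2 * (1 + y) ≤ (1 + z) * (1 + br β m y) ^ 2) := by
  obtain ⟨e, he⟩ := Kg_iter hβ m
  refine ⟨fun y => e ((1 + y) / 2) / 2, ?_, ?_⟩
  · intro y h1 h2
    have a := he.pos ((1+y)/2) (by linarith) (by linarith)
    have b := he.mem ((1+y)/2) (by linarith) (by linarith)
    exact ⟨by linarith, by linarith, b.1, b.2⟩
  · intro y z h1 h2 h3
    have G := he.grad ((1+y)/2) ((1+z)/2) (by linarith) (by linarith) (by linarith)
    have D := he.dist ((1+y)/2) ((1+z)/2) (by linarith) (by linarith) (by linarith)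
    have S := he.star ((1+y)/2) ((1+z)/2) (by linarith) (by linarith) (by linarith)
    have M1 := he.mem ((1+y)/2) (by linarith) (by linarith)
    have M2 := he.mem ((1+z)/2) (by linarith) (by linarith)
    have P2 := he.pos ((1+z)/2) (by linarith) (by linarith)
    simp only [br]
    refine ⟨by linarith [G.1], by linarith [G.2], ?_, ?_⟩
    · rw [Real.div_rpow (by linarith) (by norm_num), Real.div_rpow (by linarith) (by norm_num)] at D
      have : (0:ℝ) < 2 ^ β := by positivity
      rw [mul_div_assoc', mul_div_assoc', div_le_div_iff_of_pos_right this] at D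
      linarith
    · have hmono : (g β)^[m] ((1+y)/2) ≤ (g β)^[m] ((1+z)/2) := by
        have := mul_nonneg P2.1.le (show 0 ≤ (1+z)/2 - (1+y)/2 by linarith)
        linarith [G.1]
      set A := (g β)^[m] ((1+y)/2)
      set B := (g β)^[m] ((1+z)/2)
      have S' : B * (1 + y) ≤ A * (1 + z) := by linarith
      have k : 0 ≤ (B - A) * (1 - A * B) := by
        apply mul_nonneg (by linarith)
        nlinarith [M1.1, M1.2, M2.1, M2.2]
      have k2 : (1 + B)^2 * A ≤ B * (1 + A)^2 := by nlinarith
      have k3 : ((1 + B)^2 * A) * (B * (1 + y)) ≤ (B * (1 + A)^2) * (A * (1 + z)) :=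
        mul_le_mul k2 S' (mul_nonneg M2.1.le (by linarith)) (mul_nonneg M2.1.le (sq_nonneg _))
      have k4 : 0 < A * B := mul_pos M1.1 M2.1
      have : ((1 + B)^2 * (1 + y)) * (A * B) ≤ ((1 + z) * (1 + A)^2) * (A * B) := by linarith
      exact le_of_mul_le_mul_right this k4

lemma K.comp {β : ℝ} (hβ : 2 ≤ β) {h d : ℝ → ℝ} (H : K β h d) (m : ℕ) :
    ∃ d', K β (h ∘ br β m) d' ∧ d' 0 ≤ d 0 / 2 := by
  obtain ⟨e, he1, he2⟩ := br_props hβ m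
  have bm : ∀ {y z}, 0 ≤ y → y ≤ z → z ≤ 1 → br β m y ≤ br β m z := by
    intro y z h1 h2 h3
    have := (he2 y z h1 h2 h3).1
    have := mul_nonneg (he1 z (h1.trans h2) h3).1.le (show 0 ≤ z - y by linarith)
    linarith
  refine ⟨fun y => d (br β m y) * e y, ⟨?_, ?_, ?_⟩, ?_⟩
  · intro y h1 h2
    obtain ⟨a, b, c, f⟩ := he1 y h1 h2
    exact mul_pos (H.pos _ c.le f) a
  · intro y z h1 h2 h3
    obtain ⟨a, b, c, f⟩ := he1 y h1 (h2.trans h3)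
    obtain ⟨a', b', c', f'⟩ := he1 z (h1.trans h2) h3
    obtain ⟨p, q, r, s⟩ := he2 y z h1 h2 h3
    have G := H.grad _ _ c.le (bm h1 h2 h3) f'
    simp only [Function.comp]
    constructor
    · refine le_trans ?_ G.1
      rw [mul_assoc]; exact mul_le_mul_of_nonneg_left p (H.pos _ c'.le f').le
    · refine le_trans G.2 ?_
      rw [mul_assoc]; exact mul_le_mul_of_nonneg_left q (H.pos _ c.le f).le
  · intro y z h1 h2 h3
    obtain ⟨a, b, c, f⟩ := he1 y h1 (h2.trans h3)
    obtain ⟨a', b', c', f'⟩ := he1 z (h1.trans h2) h3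
    obtain ⟨p, q, r, s⟩ := he2 y z h1 h2 h3
    have D := H.dist _ _ c.le (bm h1 h2 h3) f'
    set A := br β m y
    set B := br β m z
    have hdA := H.pos _ c.le f
    have hdB := H.pos _ c'.le f'
    have sq : ∀ t : ℝ, 0 ≤ t → t ^ (2*β) = (t^2)^β := by
      intro t ht
      rw [Real.rpow_mul ht]; norm_num
    have hz := h1.trans h2
    have s' : (1 + y)^β / ((1 + A)^2)^β ≤ (1 + z)^β / ((1 + B)^2)^β := by
      rw [← Real.div_rpow (by linarith) (by positivity), ← Real.div_rpow (by linarith) (by positivity)]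
      apply Real.rpow_le_rpow (by positivity) _ (by linarith)
      rw [div_le_div_iff₀ (by positivity) (by positivity)]
      linarith
    have id1 : ∀ D E t U : ℝ, 0 ≤ t → 0 < U → D * E * (1 + t)^(2*β) =
        (D * U^(2*β)) * (E * (1+t)^β) * ((1+t)^β / (U^2)^β) := by
      intro D E t U ht hU
      rw [sq _ hU.le, sq (1+t) (by linarith)]
      rw [show ((1+t)^2) ^ β = (1+t)^β * (1+t)^β by
        rw [pow_two, Real.mul_rpow (by linarith) (by linarith)]]
      have : 0 < (U^2)^β := by positivity
      field_simp
    rw [id1 _ _ y (1 + A) h1 (by linarith), id1 _ _ z (1 + B) hz (by linarith)]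
    apply mul_le_mul (mul_le_mul D r (by positivity) (by positivity)) s' (by positivity) (by positivity)
  · obtain ⟨a, b, c, f⟩ := he1 0 le_rfl zero_le_one
    have := H.anti le_rfl c.le f
    have hp := H.pos _ c.le f
    have hp0 := H.pos 0 le_rfl zero_le_one
    calc d (br β m 0) * e 0 ≤ d 0 * (1/2) := mul_le_mul this b a.le hp0.le
      _ = d 0 / 2 := by ring

lemma br_mono {β : ℝ} (hβ : 2 ≤ β) (m : ℕ) {y z} (h1 : 0 ≤ y) (h2 : y ≤ z) (h3 : z ≤ 1) :
    br β m y ≤ br β m z := by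
  obtain ⟨d, hd, _⟩ := (K_id hβ).comp hβ m
  exact hd.mono h1 h2 h3

lemma br_strict {β : ℝ} (hβ : 2 ≤ β) (m : ℕ) {y z} (hy : y ≤ 1)
    (h : br β m y < br β m z) (hz : 0 ≤ z) : y < z := by
  by_contra hc
  push Not at hc
  have := br_mono hβ m hz hc hy
  linarith

lemma br_mem {β : ℝ} (hβ : 2 ≤ β) (m : ℕ) {y} (h1 : 0 ≤ y) (h2 : y ≤ 1) :
    0 < br β m y ∧ br β m y ≤ 1 := by
  obtain ⟨e, he, _⟩ := br_props hβ m
  exact (he y h1 h2).2.2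

lemma K.size {β : ℝ} {h d : ℝ → ℝ} (H : K β h d) :
    d 1 ≤ h 1 - h 0 ∧ h 1 - h 0 ≤ d 0 ∧ d 0 ≤ 4 ^ β * d 1 ∧ 0 < d 1 := by
  have := H.grad 0 1 le_rfl zero_le_one le_rfl
  have D := H.dist 0 1 le_rfl zero_le_one le_rfl
  refine ⟨by linarith, by linarith, ?_, H.pos 1 zero_le_one le_rfl⟩
  rw [add_zero, Real.one_rpow, show (1:ℝ)+1 = 2 by norm_num, Real.rpow_mul (by norm_num)] at D
  norm_num at D
  linarith

end MP


namespace MP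

lemma aa_zero (β : ℝ) : aa β 0 = 1 := rfl
lemma aa_succ (β : ℝ) (m : ℕ) : aa β (m+1) = g β (aa β m) := by
  unfold aa; rw [Function.iterate_succ_apply']

lemma aa_mem {β : ℝ} (hβ : 2 ≤ β) (m : ℕ) : 0 < aa β m ∧ aa β m ≤ 1 := by
  rw [← br_one]; exact br_mem hβ m zero_le_one le_rfl

lemma aa_step {β : ℝ} (hβ : 2 ≤ β) (m : ℕ) :
    aa β (m+1) ≤ 1/2 ∧ ff β (aa β (m+1)) = aa β m := by
  have h := aa_mem hβ m
  have := g_spec hβ (y := aa β m) ⟨h.1.le, h.2⟩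
  rw [aa_succ]
  exact ⟨this.1.2, this.2⟩

lemma aa_anti {β : ℝ} (hβ : 2 ≤ β) : Antitone (aa β) := by
  apply antitone_nat_of_succ_le
  intro m
  rw [← br_zero hβ, ← br_one]
  exact br_mono hβ m le_rfl zero_le_one le_rfl

lemma uu_step {β : ℝ} (hβ : 2 ≤ β) (m : ℕ) :
    (aa β m) ^ (-(β-1)) + 1 ≤ (aa β (m+1)) ^ (-(β-1)) ∧
    (aa β (m+1)) ^ (-(β-1)) ≤ (aa β m) ^ (-(β-1)) + (β-1) * 2^(β-1) := by
  obtain ⟨h1, h2⟩ := aa_step hβ m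
  have h3 := (aa_mem hβ (m+1)).1
  set x := aa β (m+1)
  set s := β - 1 with hs
  have hs1 : 1 ≤ s := by linarith
  set v := 2^s * x^s with hv
  have hv0 : 0 < v := by positivity
  have hv1 : v ≤ 1 := by
    rw [hv, ← Real.mul_rpow (by norm_num) h3.le]
    exact Real.rpow_le_one (by positivity) (by linarith) (by linarith)
  have e : aa β m = x * (1 + v) := by
    rw [← h2]
    unfold ff
    have : x ^ β = x ^ s * x := by
      rw [← Real.rpow_add_one h3.ne']; congr 1; simp [hs]
    rw [this, hv]; ring
  have eU : x ^ s * x ^ (-s) = 1 := by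
    rw [← Real.rpow_add h3]; simp
  have eW : (1+v) ^ s * (1+v) ^ (-s) = 1 := by
    rw [← Real.rpow_add (by linarith)]; simp
  rw [e, Real.mul_rpow h3.le (by linarith)]
  set U := x ^ (-s) with hU
  have hU0 : 0 < U := by positivity
  set W := (1+v)^(-s) with hW
  have hW0 : 0 < W := by positivity
  have vU : v * U = 2^s := by rw [hv, mul_assoc, eU, mul_one]
  constructor
  · have b1 := one_add_mul_self_le_rpow_one_add (s := v) (p := s) (by linarith) hs1
    -- U (1 - W) = U W ((1+v)^s - 1) ≥ U W s v = s 2^s W ≥ s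
    have b2 : (1+v)^s ≤ 2^s := Real.rpow_le_rpow (by linarith) (by linarith) (by linarith)
    have b3 : 1 ≤ 2^s * W := by
      rw [← eW]; exact mul_le_mul_of_nonneg_right b2 hW0.le
    have b4 : U * W * (1 + s * v) ≤ U * W * (1+v)^s :=
      mul_le_mul_of_nonneg_left b1 (by positivity)
    have b5 : U * W * (1+v)^s = U := by rw [mul_assoc, mul_comm W, eW, mul_one]
    have b6 : U * W * (1 + s * v) = U * W + s * (2^s * W) := by rw [← vU]; ring
    nlinarith
  · have b1 : 1 - s * v ≤ W := by
      rw [hW, Real.rpow_def_of_pos (by linarith)]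
      have l1 := Real.log_le_sub_one_of_pos (show 0 < 1 + v by linarith)
      have l2 := Real.add_one_le_exp (Real.log (1+v) * -s)
      nlinarith
    have := mul_le_mul_of_nonneg_left b1 hU0.le
    have e2 : U * (1 - s * v) = U - s * 2^s := by rw [← vU]; ring
    linarith

lemma uu_lower {β : ℝ} (hβ : 2 ≤ β) (m : ℕ) : (m:ℝ) + 1 ≤ (aa β m) ^ (-(β-1)) := by
  induction m with
  | zero => rw [aa_zero]; simp
  | succ m ih => have := (uu_step hβ m).1; push_cast; linarith

lemma uu_upper {β : ℝ} (hβ : 2 ≤ β) (m : ℕ) :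
    (aa β m) ^ (-(β-1)) ≤ 1 + (β-1) * 2^(β-1) * m := by
  induction m with
  | zero => rw [aa_zero]; simp
  | succ m ih => have := (uu_step hβ m).2; push_cast; linarith

lemma aa_small {β : ℝ} (hβ : 2 ≤ β) {ε : ℝ} (hε : 0 < ε) : ∃ m, aa β m < ε := by
  by_contra hc
  push Not at hc
  obtain ⟨m, hm⟩ := exists_nat_gt (ε ^ (-(β-1)))
  have h1 := uu_lower hβ m
  have h2 := Real.rpow_le_rpow_of_nonpos hε (hc m) (show -(β-1) ≤ 0 by linarith)
  linarith

noncomputable abbrev T (β : ℝ) := MannevillePomeau β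

noncomputable def tau (β x : ℝ) : ℕ := sInf {m : ℕ | 1/2 ≤ (T β)^[m] x}
noncomputable def GG (β x : ℝ) : ℝ := (T β)^[tau β x + 1] x
def Good (β : ℝ) : Set ℝ := {x | ∀ n, (T β)^[n] x ∈ Ioo (0:ℝ) 1}

lemma T_lt {β x : ℝ} (h : x < 1/2) : T β x = ff β x := by
  simp only [T, MannevillePomeau, if_pos h, ff]
lemma T_ge {β x : ℝ} (h : 1/2 ≤ x) : T β x = 2 * x - 1 := by
  simp only [T, MannevillePomeau, if_neg (not_lt.2 h)]

lemma T_lt_mem {β x : ℝ} (hβ : 2 ≤ β) (hx : 0 < x) (h : x < 1/2) : T β x ∈ Ioo (0:ℝ) 1 := by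
  rw [T_lt h]
  have h1 := ff_lt hβ le_rfl hx
  have h2 := ff_lt hβ hx.le h
  rw [ff_zero hβ] at h1; rw [ff_half] at h2
  exact ⟨h1, h2⟩

lemma itg {β x : ℝ} (hβ : 2 ≤ β) (hx : x ∈ Ioo (0:ℝ) 1) (m : ℕ)
    (h : ∀ i < m, (T β)^[i] x < 1/2) :
    (T β)^[m] x ∈ Ioo (0:ℝ) 1 ∧ (g β)^[m] ((T β)^[m] x) = x := by
  induction m with
  | zero => exact ⟨hx, rfl⟩
  | succ m ih =>
    obtain ⟨h1, h2⟩ := ih (fun i hi => h i (by omega))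
    have h3 := h m (by omega)
    rw [Function.iterate_succ_apply' (T β), Function.iterate_succ_apply]
    refine ⟨T_lt_mem hβ h1.1 h3, ?_⟩
    rw [T_lt h3, g_ff hβ ⟨h1.1.le, h3.le⟩, h2]

lemma giter_mono {β y : ℝ} (hβ : 2 ≤ β) (m : ℕ) (h : 0 < y) (h1 : y ≤ 1) : (g β)^[m] y ≤ aa β m := by
  obtain ⟨e, he⟩ := Kg_iter hβ m
  have := (he.grad y 1 h h1 le_rfl).1
  have h3 := mul_nonneg (he.pos 1 one_pos le_rfl).1.le (show 0 ≤ 1 - y by linarith)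
  unfold aa; linarith

lemma tau_spec {β x : ℝ} (hβ : 2 ≤ β) (hx : x ∈ Ioo (0:ℝ) 1) :
    1/2 ≤ (T β)^[tau β x] x ∧ ∀ i < tau β x, (T β)^[i] x < 1/2 := by
  have hne : {m : ℕ | 1/2 ≤ (T β)^[m] x}.Nonempty := by
    by_contra hc
    rw [Set.not_nonempty_iff_eq_empty] at hc
    have h1 : ∀ m, (T β)^[m] x < 1/2 := by
      intro m
      by_contra h2
      have : m ∈ {m : ℕ | 1/2 ≤ (T β)^[m] x} := not_lt.1 h2
      rw [hc] at this; exact this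
    obtain ⟨m, hm⟩ := aa_small hβ hx.1
    obtain ⟨h3, h4⟩ := itg hβ hx m (fun i _ => h1 i)
    have := giter_mono hβ m h3.1 h3.2.le
    linarith
  refine ⟨Nat.sInf_mem hne, fun i hi => ?_⟩
  by_contra h2
  exact Nat.notMem_of_lt_sInf hi (not_lt.1 h2)

lemma rep {β x : ℝ} (hβ : 2 ≤ β) (hx : x ∈ Ioo (0:ℝ) 1) :
    br β (tau β x) (GG β x) = x ∧ 0 ≤ GG β x ∧ GG β x ≤ 1 := by
  obtain ⟨h1, h2⟩ := tau_spec hβ hx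
  obtain ⟨h3, h4⟩ := itg hβ hx _ h2
  have e : GG β x = 2 * (T β)^[tau β x] x - 1 := by
    unfold GG
    rw [Function.iterate_succ_apply', T_ge h1]
  refine ⟨?_, by rw [e]; linarith, by rw [e]; linarith [h3.2]⟩
  unfold br
  rw [e, show (1 + (2 * (T β)^[tau β x] x - 1)) / 2 = (T β)^[tau β x] x by ring, h4]

lemma tau_le {β x : ℝ} (hβ : 2 ≤ β) (hx : x ∈ Ioo (0:ℝ) 1) :
    (tau β x : ℝ) + 1 ≤ x ^ (-(β-1)) := by
  obtain ⟨h1, h2, h3⟩ := rep hβ hx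
  have h4 := br_mono hβ (tau β x) h2 h3 le_rfl
  rw [h1, br_one] at h4
  refine (uu_lower hβ _).trans ?_
  exact Real.rpow_le_rpow_of_nonpos hx.1 h4 (by linarith)

lemma Good_iter {β x : ℝ} (h : x ∈ Good β) (n : ℕ) : (T β)^[n] x ∈ Good β := by
  intro m
  rw [← Function.iterate_add_apply]; exact h _

lemma Good_GG {β x : ℝ} (h : x ∈ Good β) : GG β x ∈ Good β := Good_iter h _

lemma Good_GGi {β x : ℝ} (h : x ∈ Good β) (n : ℕ) : (GG β)^[n] x ∈ Good β := by
  induction n with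
  | zero => exact h
  | succ n ih => rw [Function.iterate_succ_apply']; exact Good_GG ih

lemma Good_mem {β x : ℝ} (h : x ∈ Good β) : x ∈ Ioo (0:ℝ) 1 := h 0

noncomputable def nn (β x : ℝ) (k : ℕ) : ℕ := ∑ i ∈ Finset.range k, (tau β ((GG β)^[i] x) + 1)

lemma T_nn (β x : ℝ) (k : ℕ) : (T β)^[nn β x k] x = (GG β)^[k] x := by
  induction k with
  | zero => rfl
  | succ k ih =>
    rw [nn, Finset.sum_range_succ, add_comm, Function.iterate_add_apply, ← nn, ih,
      Function.iterate_succ_apply' (GG β)]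
    rfl

lemma tau_zero {β x : ℝ} (h : 1/2 ≤ x) : tau β x = 0 := by
  unfold tau
  rw [Nat.sInf_eq_zero]; left; exact h

lemma tau_T {β x : ℝ} (hβ : 2 ≤ β) (hx : x ∈ Good β) (h : x < 1/2) :
    tau β x = tau β (T β x) + 1 := by
  obtain ⟨h1, h2⟩ := tau_spec hβ (Good_mem hx)
  obtain ⟨h3, h4⟩ := tau_spec hβ (x := T β x) (Good_mem (Good_iter hx 1))
  have h0 : tau β x ≠ 0 := by
    intro h0; rw [h0] at h1; simp only [Function.iterate_zero, id] at h1; linarith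
  obtain ⟨t, ht⟩ := Nat.exists_eq_succ_of_ne_zero h0
  rw [ht, Function.iterate_succ_apply] at h1
  rcases lt_trichotomy t (tau β (T β x)) with hh | hh | hh
  · have := h4 _ hh; linarith
  · omega
  · have := h2 (tau β (T β x) + 1) (by omega)
    rw [Function.iterate_succ_apply] at this
    linarith

lemma nn_cover {β x : ℝ} (hβ : 2 ≤ β) (hx : x ∈ Good β) (n : ℕ) :
    ∃ k, n + tau β ((T β)^[n] x) + 1 = nn β x (k+1) := by
  induction n with
  | zero => exact ⟨0, by simp [nn]⟩
  | succ n ih =>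
    obtain ⟨k, hk⟩ := ih
    rcases lt_or_ge ((T β)^[n] x) (1/2) with h | h
    · refine ⟨k, ?_⟩
      rw [← hk, Function.iterate_succ_apply', tau_T hβ (Good_iter hx n) h]
      omega
    · rw [tau_zero h] at hk
      refine ⟨k+1, ?_⟩
      rw [nn, Finset.sum_range_succ, ← nn, ← hk, ← T_nn, ← hk, add_zero]
      omega

lemma nn_ge (β x : ℝ) (k : ℕ) : k ≤ nn β x k := by
  unfold nn
  calc k = ∑ i ∈ Finset.range k, 1 := by simp
    _ ≤ _ := Finset.sum_le_sum (fun i _ => by omega)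

lemma T_meas (β : ℝ) : Measurable (T β) := by
  unfold T MannevillePomeau
  refine Measurable.ite measurableSet_Iio ?_ ?_ <;> fun_prop

lemma tau_meas (β : ℝ) : Measurable (tau β) := by
  have hT := T_meas β
  have hm : ∀ m : ℕ, MeasurableSet {x : ℝ | 1/2 ≤ (T β)^[m] x} := fun m =>
    measurableSet_le measurable_const (hT.iterate m)
  apply measurable_to_countable'
  intro n
  have : tau β ⁻¹' {n} = ({x | 1/2 ≤ (T β)^[n] x} ∩ ⋂ i ∈ Finset.range n, {x | 1/2 ≤ (T β)^[i] x}ᶜ) ∪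
      ({x : ℝ | n = 0} ∩ ⋂ i : ℕ, {x | 1/2 ≤ (T β)^[i] x}ᶜ) := by
    ext x
    simp only [mem_preimage, mem_singleton_iff, mem_union, mem_inter_iff, mem_ofPred_eq, mem_iInter,
      mem_compl_iff, Finset.mem_range]
    constructor
    · intro h
      by_cases hne : {m : ℕ | 1/2 ≤ (T β)^[m] x}.Nonempty
      · left
        rw [← h]
        exact ⟨Nat.sInf_mem hne, fun i hi => Nat.notMem_of_lt_sInf hi⟩
      · right
        rw [Set.not_nonempty_iff_eq_empty] at hne
        refine ⟨by rw [← h]; unfold tau; rw [hne]; simp, fun i hi => ?_⟩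
        have : i ∈ {m : ℕ | 1/2 ≤ (T β)^[m] x} := hi
        rw [hne] at this; exact this
    · rintro (⟨h1, h2⟩ | ⟨h1, h2⟩)
      · apply le_antisymm (Nat.sInf_le h1)
        by_contra hc
        push Not at hc
        have hmem : sInf {m : ℕ | 1/2 ≤ (T β)^[m] x} ∈ {m : ℕ | 1/2 ≤ (T β)^[m] x} :=
          Nat.sInf_mem ⟨n, h1⟩
        exact h2 _ hc hmem
      · rw [h1]; unfold tau
        rw [Nat.sInf_eq_zero]; right
        ext i; simpa using h2 i
  rw [this]
  refine MeasurableSet.union ((hm n).inter ?_) ((MeasurableSet.const _).inter ?_)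
  · exact Finset.measurableSet_biInter _ (fun i _ => (hm i).compl)
  · exact MeasurableSet.iInter (fun i => (hm i).compl)

lemma GG_meas (β : ℝ) : Measurable (GG β) := by
  have h1 : Measurable (fun p : ℕ × ℝ => (T β)^[p.1 + 1] p.2) :=
    measurable_from_prod_countable_right (fun n => (T_meas β).iterate (n+1))
  exact h1.comp ((tau_meas β).prodMk measurable_id)

lemma Good_meas (β : ℝ) : MeasurableSet (Good β) := by
  have : Good β = ⋂ n : ℕ, ((T β)^[n]) ⁻¹' (Ioo 0 1) := by
    ext x; simp [Good]
  rw [this]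
  exact MeasurableSet.iInter (fun n => (T_meas β).iterate n measurableSet_Ioo)

lemma T_maps {β x : ℝ} (hβ : 2 ≤ β) (hx : x ∈ Ico (0:ℝ) 1) : T β x ∈ Ico (0:ℝ) 1 := by
  rcases lt_or_ge x (1/2) with h | h
  · rw [T_lt h]
    have h2 := ff_lt hβ hx.1 h
    rw [ff_half] at h2
    exact ⟨ff_nonneg hβ hx.1, h2⟩
  · rw [T_ge h]
    exact ⟨by linarith, by linarith [hx.2]⟩

lemma zero_countable {β : ℝ} (hβ : 2 ≤ β) (n : ℕ) :
    {x : ℝ | x ∈ Ico (0:ℝ) 1 ∧ (T β)^[n] x = 0}.Countable := by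
  induction n with
  | zero => exact (countable_singleton (0:ℝ)).mono (fun x hx => hx.2)
  | succ n ih =>
    have h1 : {x : ℝ | x ∈ Ico (0:ℝ) 1 ∧ (T β)^[n+1] x = 0 ∧ x < 1/2}.Countable := by
      refine MapsTo.countable_of_injOn (f := T β) ?_ ?_ ih
      · rintro x ⟨h1, h2, h3⟩
        exact ⟨T_maps hβ h1, by rwa [Function.iterate_succ_apply] at h2⟩
      · rintro x ⟨h1, h2, h3⟩ y ⟨h1', h2', h3'⟩ hxy
        rw [T_lt h3, T_lt h3'] at hxy
        exact ff_inj hβ h1.1 h1'.1 hxy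
    have h2 : {x : ℝ | x ∈ Ico (0:ℝ) 1 ∧ (T β)^[n+1] x = 0 ∧ 1/2 ≤ x}.Countable := by
      refine MapsTo.countable_of_injOn (f := T β) ?_ ?_ ih
      · rintro x ⟨h1, h2, h3⟩
        exact ⟨T_maps hβ h1, by rwa [Function.iterate_succ_apply] at h2⟩
      · rintro x ⟨h1, h2, h3⟩ y ⟨h1', h2', h3'⟩ hxy
        rw [T_ge h3, T_ge h3'] at hxy
        linarith
    refine (h1.union h2).mono ?_
    rintro x ⟨h3, h4⟩
    rcases lt_or_ge x (1/2) with h | h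
    · left; exact ⟨h3, h4, h⟩
    · right; exact ⟨h3, h4, h⟩

lemma ae_Good {β : ℝ} (hβ : 2 ≤ β) : ∀ᵐ x ∂(volume : Measure ℝ), x ∈ Ico (0:ℝ) 1 → x ∈ Good β := by
  have : (⋃ n, {x : ℝ | x ∈ Ico (0:ℝ) 1 ∧ (T β)^[n] x = 0}).Countable :=
    countable_iUnion (zero_countable hβ)
  filter_upwards [this.ae_notMem volume] with x hx h0 n
  have h1 : (T β)^[n] x ∈ Ico (0:ℝ) 1 := by
    induction n with
    | zero => exact h0
    | succ n ih => rw [Function.iterate_succ_apply']; exact T_maps hβ ih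
  refine ⟨lt_of_le_of_ne h1.1 ?_, h1.2⟩
  intro h2
  exact hx (mem_iUnion.2 ⟨n, h0, h2.symm⟩)

end MP


namespace MP

lemma cover_step {β : ℝ} (hβ : 2 ≤ β) (h : ℝ → ℝ) {S S' : Set ℝ} (hS : S ⊆ Good β)
    (hG : ∀ x ∈ S, GG β x ∈ S') : h '' S ⊆ ⋃ m, (h ∘ br β m) '' S' := by
  rintro _ ⟨x, hx, rfl⟩
  refine mem_iUnion.2 ⟨tau β x, GG β x, hG x hx, ?_⟩
  simp only [Function.comp]
  rw [(rep hβ (Good_mem (hS hx))).1]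

lemma tele {β : ℝ} (hβ : 2 ≤ β) {h d : ℝ → ℝ} (H : K β h d) (j : ℕ) :
    ∑' m, ENNReal.ofReal ((h ∘ br β (m+j)) 1 - (h ∘ br β (m+j)) 0) ≤
      ENNReal.ofReal (h (aa β j) - h 0) := by
  apply ENNReal.tsum_le_of_sum_range_le
  intro n
  have e : ∀ m, (h ∘ br β (m+j)) 1 - (h ∘ br β (m+j)) 0 = h (aa β (m+j)) - h (aa β (m+j+1)) := by
    intro m; simp only [Function.comp]; rw [br_one, br_zero hβ]
  have nonneg : ∀ m, 0 ≤ h (aa β (m+j)) - h (aa β (m+j+1)) := by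
    intro m
    have := H.mono (aa_mem hβ (m+j+1)).1.le (aa_anti hβ (Nat.le_succ (m+j))) (aa_mem hβ _).2
    linarith
  simp only [e]
  rw [← ENNReal.ofReal_sum_of_nonneg (fun m _ => nonneg m)]
  apply ENNReal.ofReal_le_ofReal
  have : ∑ i ∈ Finset.range n, (h (aa β (i+j)) - h (aa β (i+j+1))) = h (aa β j) - h (aa β (n+j)) := by
    have := Finset.sum_range_sub' (fun i => h (aa β (i+j))) n
    simp only [zero_add] at this
    rw [← this]
    apply Finset.sum_congr rfl
    intro i _
    rw [show i + 1 + j = i + j + 1 by ring]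
  rw [this]
  have := H.mono le_rfl (aa_mem hβ (n+j)).1.le (aa_mem hβ _).2
  linarith

lemma tele' {β : ℝ} (hβ : 2 ≤ β) {h d : ℝ → ℝ} (H : K β h d) (n : ℕ) :
    ∑ m ∈ Finset.range n, ENNReal.ofReal ((h ∘ br β m) 1 - (h ∘ br β m) 0) =
      ENNReal.ofReal (h 1 - h (aa β n)) := by
  have e : ∀ m, (h ∘ br β m) 1 - (h ∘ br β m) 0 = h (aa β m) - h (aa β (m+1)) := by
    intro m; simp only [Function.comp]; rw [br_one, br_zero hβ]
  have nonneg : ∀ m, 0 ≤ h (aa β m) - h (aa β (m+1)) := by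
    intro m
    have := H.mono (aa_mem hβ (m+1)).1.le (aa_anti hβ (Nat.le_succ m)) (aa_mem hβ _).2
    linarith
  simp only [e]
  rw [← ENNReal.ofReal_sum_of_nonneg (fun m _ => nonneg m),
    Finset.sum_range_sub' (fun i => h (aa β i)) n, aa_zero]

lemma vol_step {β : ℝ} (hβ : 2 ≤ β) {h d : ℝ → ℝ} (H : K β h d) {S A : Set ℝ} (hS : S ⊆ Good β)
    (hG : ∀ x ∈ S, GG β x ∈ A) (ρ : ENNReal)
    (hA : ∀ h d, K β h d → volume (h '' A) ≤ ρ * ENNReal.ofReal (h 1 - h 0)) :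
    volume (h '' S) ≤ ρ * ENNReal.ofReal (h 1 - h 0) := by
  refine (measure_mono (cover_step hβ h hS hG)).trans ?_
  refine (measure_iUnion_le _).trans ?_
  calc ∑' m, volume ((h ∘ br β m) '' A)
      ≤ ∑' m, ρ * ENNReal.ofReal ((h ∘ br β m) 1 - (h ∘ br β m) 0) := by
        apply ENNReal.tsum_le_tsum
        intro m
        obtain ⟨d', hd', _⟩ := H.comp hβ m
        exact hA _ _ hd'
    _ = ρ * ∑' m, ENNReal.ofReal ((h ∘ br β (m+0)) 1 - (h ∘ br β (m+0)) 0) := by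
        rw [ENNReal.tsum_mul_left]; rfl
    _ ≤ _ := mul_le_mul_right (by simpa [aa_zero] using tele hβ H 0) _

lemma vol_img_Icc {β : ℝ} {h d : ℝ → ℝ} (H : K β h d) {S : Set ℝ} (hS : S ⊆ Icc 0 1) :
    volume (h '' S) ≤ ENNReal.ofReal (h 1 - h 0) := by
  rw [← Real.volume_Icc]
  apply measure_mono
  rintro _ ⟨x, hx, rfl⟩
  have := hS hx
  exact ⟨H.mono le_rfl this.1 this.2, H.mono this.1 this.2 le_rfl⟩

lemma Good_sub (β : ℝ) : Good β ⊆ Icc 0 1 := fun x hx => Ioo_subset_Icc_self (Good_mem hx)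

lemma vol_lip {β : ℝ} {h d : ℝ → ℝ} (H : K β h d) {S : Set ℝ} (hS : S ⊆ Icc 0 1) :
    volume (h '' S) ≤ ENNReal.ofReal (d 0) * volume S := by
  have hl : LipschitzOnWith (Real.toNNReal (d 0)) h S := by
    apply LipschitzOnWith.of_le_add_mul
    intro x hx y hy
    rw [Real.coe_toNNReal _ (H.pos 0 le_rfl zero_le_one).le, Real.dist_eq]
    have hx := hS hx
    have hy := hS hy
    have d0 := H.pos 0 le_rfl zero_le_one
    rcases le_total x y with hxy | hxy
    · have := H.mono hx.1 hxy hy.2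
      have := mul_nonneg d0.le (abs_nonneg (x - y))
      linarith
    · have h1 := (H.grad y x hy.1 hxy hx.2).2
      have h2 := H.anti le_rfl hy.1 hy.2
      rw [abs_of_nonneg (by linarith)]
      have := mul_le_mul_of_nonneg_right h2 (show 0 ≤ x - y by linarith)
      linarith
  have := hl.hausdorffMeasure_image_le (d := 1) zero_le_one
  rw [hausdorffMeasure_real] at this
  simpa [ENNReal.ofReal] using this

lemma push_aux {β : ℝ} (hβ : 2 ≤ β) (A : Set ℝ) (i : ℕ) : ∀ h d, K β h d →
    volume (h '' {x | x ∈ Good β ∧ (GG β)^[i] x ∈ A}) ≤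
      (ENNReal.ofReal (4^β) * volume A) * ENNReal.ofReal (h 1 - h 0) := by
  induction i with
  | zero =>
    intro h d H
    refine (vol_lip H (fun x hx => Good_sub β hx.1)).trans ?_
    have hs := H.size
    have : ENNReal.ofReal (d 0) ≤ ENNReal.ofReal (4^β) * ENNReal.ofReal (h 1 - h 0) := by
      rw [← ENNReal.ofReal_mul (by positivity)]
      apply ENNReal.ofReal_le_ofReal
      refine hs.2.2.1.trans (mul_le_mul_of_nonneg_left hs.1 (by positivity))
    calc _ ≤ (ENNReal.ofReal (4^β) * ENNReal.ofReal (h 1 - h 0)) * volume A :=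
          mul_le_mul' this (measure_mono (fun x hx => hx.2))
      _ = _ := by ring
  | succ i ih =>
    intro h d H
    exact vol_step (A := {x | x ∈ Good β ∧ (GG β)^[i] x ∈ A}) hβ H (fun x hx => hx.1)
      (fun x hx => ⟨Good_GG hx.1, by have := hx.2; rwa [Function.iterate_succ_apply] at this⟩) _ ih

lemma push {β : ℝ} (hβ : 2 ≤ β) (A : Set ℝ) (i : ℕ) :
    volume {x | x ∈ Good β ∧ (GG β)^[i] x ∈ A} ≤ ENNReal.ofReal (4^β) * volume A := by
  have := push_aux hβ A i id _ (K_id hβ)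
  simpa using this

lemma K.conc {β : ℝ} {h d : ℝ → ℝ} (H : K β h d) {a : ℝ} (h0 : 0 ≤ a) (h1 : a ≤ 1) :
    h 1 - h a ≤ (1 - a) * (h 1 - h 0) := by
  have g1 := (H.grad 0 a le_rfl h0 h1).1
  have g2 := (H.grad a 1 h0 h1 le_rfl).2
  nlinarith

lemma short_aux {β : ℝ} (hβ : 2 ≤ β) (N k : ℕ) : ∀ h d, K β h d →
    volume (h '' {x | x ∈ Good β ∧ ∀ i < k, tau β ((GG β)^[i] x) < N}) ≤
      ENNReal.ofReal (1 - aa β N) ^ k * ENNReal.ofReal (h 1 - h 0) := by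
  induction k with
  | zero =>
    intro h d H
    simpa using vol_img_Icc H (Good_sub β)
  | succ k ih =>
    intro h d H
    set A := {x | x ∈ Good β ∧ ∀ i < k, tau β ((GG β)^[i] x) < N}
    have sub : h '' {x | x ∈ Good β ∧ ∀ i < k+1, tau β ((GG β)^[i] x) < N} ⊆
        ⋃ m ∈ Finset.range N, (h ∘ br β m) '' A := by
      rintro _ ⟨x, ⟨hx, hx2⟩, rfl⟩
      refine mem_iUnion₂.2 ⟨tau β x, Finset.mem_range.2 (hx2 0 (by omega)), GG β x,
        ⟨Good_GG hx, fun i hi => ?_⟩, ?_⟩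
      · have := hx2 (i+1) (by omega)
        rwa [Function.iterate_succ_apply] at this
      · simp only [Function.comp]
        rw [(rep hβ (Good_mem hx)).1]
    refine (measure_mono sub).trans ((measure_biUnion_finset_le _ _).trans ?_)
    calc ∑ m ∈ Finset.range N, volume ((h ∘ br β m) '' A)
        ≤ ∑ m ∈ Finset.range N, ENNReal.ofReal (1 - aa β N) ^ k *
            ENNReal.ofReal ((h ∘ br β m) 1 - (h ∘ br β m) 0) := by
          apply Finset.sum_le_sum
          intro m _
          obtain ⟨d', hd', _⟩ := H.comp hβ m
          exact ih _ _ hd'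
      _ = ENNReal.ofReal (1 - aa β N) ^ k * ENNReal.ofReal (h 1 - h (aa β N)) := by
          rw [← Finset.mul_sum, tele' hβ H]
      _ ≤ ENNReal.ofReal (1 - aa β N) ^ k *
            (ENNReal.ofReal (1 - aa β N) * ENNReal.ofReal (h 1 - h 0)) := by
          gcongr
          have hm := aa_mem hβ N
          rw [← ENNReal.ofReal_mul (by linarith)]
          exact ENNReal.ofReal_le_ofReal (H.conc hm.1.le hm.2)
      _ = _ := by rw [pow_succ]; ring

lemma short {β : ℝ} (hβ : 2 ≤ β) (N k : ℕ) :
    volume {x | x ∈ Good β ∧ nn β x k ≤ N} ≤ ENNReal.ofReal (1 - aa β N) ^ k := by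
  have := short_aux hβ N k id _ (K_id hβ)
  rw [image_id] at this
  simp only [id, sub_zero, ENNReal.ofReal_one, mul_one] at this
  refine (measure_mono ?_).trans this
  rintro x ⟨hx, h⟩
  refine ⟨hx, fun i hi => ?_⟩
  have : tau β ((GG β)^[i] x) + 1 ≤ nn β x k :=
    Finset.single_le_sum (f := fun i => tau β ((GG β)^[i] x) + 1) (fun _ _ => Nat.zero_le _)
      (Finset.mem_range.2 hi)
  omega

lemma rep' {β u : ℝ} (hβ : 2 ≤ β) (h0 : 0 < u) (h1 : u ≤ 1) :
    ∃ m y, 0 ≤ y ∧ y ≤ 1 ∧ br β m y = u := by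
  rcases h1.eq_or_lt with h | h
  · exact ⟨0, 1, zero_le_one, le_rfl, by rw [br_one, aa_zero, h]⟩
  · obtain ⟨a, b, c⟩ := rep hβ ⟨h0, h⟩
    exact ⟨_, _, b, c, a⟩

lemma left_aux {β : ℝ} (hβ : 2 ≤ β) {A : Set ℝ} (ρ : ENNReal)
    (hA : ∀ h d, K β h d → volume (h '' A) ≤ ρ * ENNReal.ofReal (h 1 - h 0)) (L : ℕ) :
    ∀ u, 0 ≤ u → u ≤ 1 → ∀ h d, K β h d →
    volume (h '' {x | x ∈ Good β ∧ x < u ∧ ∀ i ≤ L, (GG β)^[i] x ∈ A}) ≤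
      ρ * ENNReal.ofReal (h u - h 0 + d 0 / 2^L) := by
  induction L with
  | zero =>
    intro u hu0 hu1 h d H
    refine (measure_mono (image_mono (fun x hx => hx.2.2 0 le_rfl))).trans ((hA h d H).trans ?_)
    gcongr
    have := H.size.2.1
    have := H.mono le_rfl hu0 hu1
    simp only [pow_zero, div_one]; linarith
  | succ L ih =>
    intro u hu0 hu1 h d H
    rcases hu0.eq_or_lt with hu | hu
    · have : {x | x ∈ Good β ∧ x < u ∧ ∀ i ≤ L+1, (GG β)^[i] x ∈ A} = ∅ := by
        ext x
        simp only [mem_ofPred_eq, mem_empty_iff_false, iff_false]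
        rintro ⟨h1, h2, _⟩
        have := (Good_mem h1).1
        linarith
      rw [this]; simp
    · obtain ⟨m, y, hy0, hy1, hy⟩ := rep' hβ hu hu1
      set X := {x | x ∈ Good β ∧ x < y ∧ ∀ i ≤ L, (GG β)^[i] x ∈ A}
      have sub : h '' {x | x ∈ Good β ∧ x < u ∧ ∀ i ≤ L+1, (GG β)^[i] x ∈ A} ⊆
          (⋃ j, (h ∘ br β (j + (m+1))) '' A) ∪ (h ∘ br β m) '' X := by
        rintro _ ⟨x, ⟨hx, hxu, hx2⟩, rfl⟩
        obtain ⟨r1, r2, r3⟩ := rep hβ (Good_mem hx)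
        rcases lt_trichotomy (tau β x) m with ht | ht | ht
        · exfalso
          have b1 := br_mono hβ (tau β x) le_rfl r2 r3
          rw [r1, br_zero hβ] at b1
          have b2 := aa_anti hβ (show tau β x + 1 ≤ m from ht)
          have b3 := br_mono hβ m hy0 hy1 le_rfl
          rw [br_one, hy] at b3
          linarith
        · right
          refine ⟨GG β x, ⟨Good_GG hx, ?_, fun i hi => ?_⟩, ?_⟩
          · apply br_strict hβ m r3 _ hy0
            rw [← ht, r1, ht, hy]; exact hxu
          · have := hx2 (i+1) (by omega)
            rwa [Function.iterate_succ_apply] at this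
          · simp only [Function.comp]; rw [← ht, r1]
        · left
          refine mem_iUnion.2 ⟨tau β x - (m+1), GG β x, hx2 1 (by omega), ?_⟩
          simp only [Function.comp]
          rw [Nat.sub_add_cancel ht, r1]
      obtain ⟨d', hd', hd0⟩ := H.comp hβ m
      have i1 := ih y hy0 hy1 _ _ hd'
      refine (measure_mono sub).trans ((measure_union_le _ _).trans ?_)
      have i2 : volume (⋃ j, (h ∘ br β (j + (m+1))) '' A) ≤
          ρ * ENNReal.ofReal (h (aa β (m+1)) - h 0) := by
        refine (measure_iUnion_le _).trans ?_
        calc _ ≤ ∑' j, ρ * ENNReal.ofReal ((h ∘ br β (j+(m+1))) 1 - (h ∘ br β (j+(m+1))) 0) := by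
              apply ENNReal.tsum_le_tsum
              intro j
              obtain ⟨d'', hd'', _⟩ := H.comp hβ (j+(m+1))
              exact hA _ _ hd''
          _ ≤ _ := by
              rw [ENNReal.tsum_mul_left]
              exact mul_le_mul_right (tele hβ H (m+1)) _
      refine (add_le_add i2 i1).trans ?_
      rw [← mul_add]
      simp only [Function.comp]
      rw [br_zero hβ, hy]
      have am := aa_mem hβ (m+1)
      have n1 := H.mono le_rfl am.1.le am.2
      have n2 : h (aa β (m+1)) ≤ h u := by
        apply H.mono am.1.le _ hu1
        rw [← br_zero hβ, ← hy]; exact br_mono hβ m le_rfl hy0 hy1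
      have n3 : 0 < d' 0 := hd'.pos 0 le_rfl zero_le_one
      rw [← ENNReal.ofReal_add (by linarith) (by have : 0 < d' 0 / 2^L := by positivity
                                                 linarith)]
      refine mul_le_mul_right (ENNReal.ofReal_le_ofReal ?_) _
      have : d' 0 / 2^L ≤ d 0 / 2^(L+1) := by
        rw [pow_succ, mul_comm, ← div_div]; gcongr
      linarith

lemma right_aux {β : ℝ} (hβ : 2 ≤ β) {A : Set ℝ} (ρ : ENNReal)
    (hA : ∀ h d, K β h d → volume (h '' A) ≤ ρ * ENNReal.ofReal (h 1 - h 0)) (L : ℕ) :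
    ∀ v, 0 ≤ v → v ≤ 1 → ∀ h d, K β h d →
    volume (h '' {x | x ∈ Good β ∧ v < x ∧ ∀ i ≤ L, (GG β)^[i] x ∈ A}) ≤
      ρ * ENNReal.ofReal (h 1 - h v + d 0 / 2^L) := by
  induction L with
  | zero =>
    intro u hu0 hu1 h d H
    refine (measure_mono (image_mono (fun x hx => hx.2.2 0 le_rfl))).trans ((hA h d H).trans ?_)
    gcongr
    have := H.size.2.1
    have := H.mono hu0 hu1 le_rfl
    simp only [pow_zero, div_one]; linarith
  | succ L ih =>
    intro u hu0 hu1 h d H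
    have hd0 := H.pos 0 le_rfl zero_le_one
    rcases hu0.eq_or_lt with hu | hu
    · refine (measure_mono (image_mono (fun x hx => hx.2.2 0 (by omega)))).trans ((hA h d H).trans ?_)
      gcongr
      rw [← hu]
      have : 0 < d 0 / 2^(L+1) := by positivity
      linarith
    · obtain ⟨m, y, hy0, hy1, hy⟩ := rep' hβ hu hu1
      set X := {x | x ∈ Good β ∧ y < x ∧ ∀ i ≤ L, (GG β)^[i] x ∈ A}
      have sub : h '' {x | x ∈ Good β ∧ u < x ∧ ∀ i ≤ L+1, (GG β)^[i] x ∈ A} ⊆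
          (⋃ j ∈ Finset.range m, (h ∘ br β j) '' A) ∪ (h ∘ br β m) '' X := by
        rintro _ ⟨x, ⟨hx, hxu, hx2⟩, rfl⟩
        obtain ⟨r1, r2, r3⟩ := rep hβ (Good_mem hx)
        rcases lt_trichotomy (tau β x) m with ht | ht | ht
        · left
          refine mem_iUnion₂.2 ⟨tau β x, Finset.mem_range.2 ht, GG β x, hx2 1 (by omega), ?_⟩
          simp only [Function.comp]
          rw [r1]
        · right
          refine ⟨GG β x, ⟨Good_GG hx, ?_, fun i hi => ?_⟩, ?_⟩
          · apply br_strict hβ m hy1 _ r2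
            rw [← ht, r1, ht, hy]; exact hxu
          · have := hx2 (i+1) (by omega)
            rwa [Function.iterate_succ_apply] at this
          · simp only [Function.comp]; rw [← ht, r1]
        · exfalso
          have b1 := br_mono hβ (tau β x) r2 r3 le_rfl
          rw [r1, br_one] at b1
          have b2 := aa_anti hβ (show m + 1 ≤ tau β x from ht)
          have b3 := br_mono hβ m le_rfl hy0 hy1
          rw [br_zero hβ, hy] at b3
          linarith
      obtain ⟨d', hd', hd0'⟩ := H.comp hβ m
      have i1 := ih y hy0 hy1 _ _ hd'
      refine (measure_mono sub).trans ((measure_union_le _ _).trans ?_)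
      have i2 : volume (⋃ j ∈ Finset.range m, (h ∘ br β j) '' A) ≤
          ρ * ENNReal.ofReal (h 1 - h (aa β m)) := by
        refine (measure_biUnion_finset_le _ _).trans ?_
        rw [← tele' hβ H, Finset.mul_sum]
        apply Finset.sum_le_sum
        intro j _
        obtain ⟨d'', hd'', _⟩ := H.comp hβ j
        exact hA _ _ hd''
      refine (add_le_add i2 i1).trans ?_
      rw [← mul_add]
      simp only [Function.comp]
      rw [br_one, hy]
      have am := aa_mem hβ m
      have n1 := H.mono am.1.le am.2 le_rfl
      have n2 : h u ≤ h (aa β m) := by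
        apply H.mono hu0 _ am.2
        rw [← br_one, ← hy]; exact br_mono hβ m hy0 hy1 le_rfl
      have n3 : 0 < d' 0 := hd'.pos 0 le_rfl zero_le_one
      rw [← ENNReal.ofReal_add (by linarith) (by have : 0 < d' 0 / 2^L := by positivity
                                                 linarith)]
      refine mul_le_mul_right (ENNReal.ofReal_le_ofReal ?_) _
      have : d' 0 / 2^L ≤ d 0 / 2^(L+1) := by
        rw [pow_succ, mul_comm, ← div_div]; gcongr
      linarith

lemma miss_aux {β : ℝ} (hβ : 2 ≤ β) {u v : ℝ} (hu : 0 ≤ u) (huv : u ≤ v) (hv : v ≤ 1) (L : ℕ)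
    (q : ℝ) (hq : 1 - (v - u) / 4^β + 2 * 4^β / 2^L ≤ q) (k : ℕ) : ∀ h d, K β h d →
    volume (h '' {x | x ∈ Good β ∧ ∀ i < k * (L+1), (GG β)^[i] x ∉ Icc u v}) ≤
      ENNReal.ofReal q ^ k * ENNReal.ofReal (h 1 - h 0) := by
  induction k with
  | zero =>
    intro h d H
    simpa using vol_img_Icc H (Good_sub β)
  | succ k ih =>
    intro h d H
    set A := {x | x ∈ Good β ∧ ∀ i < k * (L+1), (GG β)^[i] x ∉ Icc u v}
    have sub : h '' {x | x ∈ Good β ∧ ∀ i < (k+1) * (L+1), (GG β)^[i] x ∉ Icc u v} ⊆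
      h '' {x | x ∈ Good β ∧ x < u ∧ ∀ i ≤ L, (GG β)^[i] x ∈ A} ∪
      h '' {x | x ∈ Good β ∧ v < x ∧ ∀ i ≤ L, (GG β)^[i] x ∈ A} := by
      rw [← image_union]
      apply image_mono
      rintro x ⟨hx, hx2⟩
      have hA : ∀ i ≤ L, (GG β)^[i] x ∈ A := by
        intro i hi
        refine ⟨Good_GGi hx i, fun j hj => ?_⟩
        rw [← Function.iterate_add_apply]
        apply hx2
        rw [add_mul]; omega
      have h0 : x ∉ Icc u v := hx2 0 (by positivity)
      rcases lt_or_ge x u with h1 | h1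
      · left; exact ⟨hx, h1, hA⟩
      · right; refine ⟨hx, ?_, hA⟩
        by_contra hc
        exact h0 ⟨h1, not_lt.1 hc⟩
    have l := left_aux hβ _ ih L u hu (huv.trans hv) h d H
    have r := right_aux hβ _ ih L v (hu.trans huv) hv h d H
    refine (measure_mono sub).trans ((measure_union_le _ _).trans ((add_le_add l r).trans ?_))
    have d0 := H.pos 0 le_rfl zero_le_one
    have n1 := H.mono le_rfl hu (huv.trans hv)
    have n2 := H.mono (hu.trans huv) hv le_rfl
    have dL : 0 < d 0 / 2^L := by positivity
    rw [← mul_add, ← ENNReal.ofReal_add (by linarith) (by linarith), pow_succ, mul_assoc]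
    obtain ⟨s1, s2, s3, s4⟩ := H.size
    rw [← ENNReal.ofReal_mul' (by linarith)]
    gcongr
    have g1 := (H.grad u v hu huv hv).1
    have g2 := H.anti (hu.trans huv) hv le_rfl
    have g3 : d 1 * (v - u) ≤ h v - h u :=
      (mul_le_mul_of_nonneg_right g2 (by linarith)).trans g1
    set F : ℝ := 4^β
    have F0 : 0 < F := by positivity
    have g4 : (v - u) / F * (h 1 - h 0) ≤ d 1 * (v - u) := by
      rw [div_mul_eq_mul_div, div_le_iff₀ F0]
      nlinarith
    have g5 : d 0 / 2^L ≤ F / 2^L * (h 1 - h 0) := by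
      rw [div_mul_eq_mul_div]
      gcongr
      nlinarith
    have g6 := mul_le_mul_of_nonneg_right hq (show 0 ≤ h 1 - h 0 by linarith)
    have : 2 * F / 2^L = 2 * (F / 2^L) := by ring
    rw [this] at g6
    nlinarith

lemma miss {β : ℝ} (hβ : 2 ≤ β) {u v : ℝ} (hu : 0 ≤ u) (huv : u ≤ v) (hv : v ≤ 1) (L : ℕ)
    (q : ℝ) (hq : 1 - (v - u) / 4^β + 2 * 4^β / 2^L ≤ q) (k s : ℕ) :
    volume {x | x ∈ Good β ∧ ∀ i < k * (L+1), (GG β)^[i + s] x ∉ Icc u v} ≤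
      ENNReal.ofReal (4^β) * ENNReal.ofReal q ^ k := by
  have h1 := miss_aux hβ hu huv hv L q hq k id _ (K_id hβ)
  rw [image_id] at h1
  simp only [id, sub_zero, ENNReal.ofReal_one, mul_one] at h1
  refine le_trans ?_ (mul_le_mul_right h1 (ENNReal.ofReal (4^β)))
  refine le_trans (measure_mono ?_) (push hβ _ s)
  rintro x ⟨hx, h⟩
  refine ⟨hx, Good_GGi hx s, fun i hi => ?_⟩
  rw [← Function.iterate_add_apply]; exact h i hi

end MP


namespace MP

lemma sum_exp {c δ : ℝ} (hc : 0 < c) (hδ : 0 < δ) :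
    Summable (fun k : ℕ => Real.exp (-c * (k:ℝ)^δ)) := by
  have h1 := (isLittleO_exp_neg_mul_rpow_atTop hc (-2/δ)).comp_tendsto
    ((tendsto_rpow_atTop hδ).comp (tendsto_natCast_atTop_atTop (R := ℝ)))
  refine summable_of_isBigO_nat (g := fun k : ℕ => (k:ℝ)^(-2:ℝ))
    (Real.summable_nat_rpow.2 (by norm_num)) ?_
  refine h1.isBigO.congr (fun _ => rfl) (fun k => ?_)
  simp only [Function.comp]
  rw [← Real.rpow_mul (Nat.cast_nonneg k)]
  congr 1
  field_simp

lemma nn_lower {β : ℝ} (hβ : 2 ≤ β) {b : ℝ} (hb0 : 0 < b) (hb : b < β - 1) :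
    ∀ᵐ x ∂(volume : Measure ℝ), x ∈ Good β → ∀ᶠ k : ℕ in atTop, (k:ℝ)^b ≤ nn β x k := by
  have hβ1 : 0 < β - 1 := by linarith
  set C : ℝ := (β-1) * 2^(β-1) with hC
  have C0 : 0 < C := by positivity
  set γ : ℝ := 1/(β-1) with hγ
  have γ0 : 0 < γ := by positivity
  set c : ℝ := (1+C)^(-γ) with hc
  have c0 : 0 < c := by positivity
  have δ0 : 0 < 1 - b * γ := by
    rw [hγ, mul_one_div, sub_pos, div_lt_one hβ1]; exact hb
  have key : ∀ k : ℕ, volume {x | x ∈ Good β ∧ nn β x k ≤ ⌊(k:ℝ)^b⌋₊} ≤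
      ENNReal.ofReal (Real.exp (-c * (k:ℝ)^(1 - b*γ))) := by
    intro k
    refine (short hβ _ k).trans ?_
    rcases Nat.eq_zero_or_pos k with rfl | hk
    · rw [Nat.cast_zero, Real.zero_rpow δ0.ne']; simp
    have hk1 : (1:ℝ) ≤ k := by exact_mod_cast hk
    have hk0 : (0:ℝ) < k := by linarith
    obtain ⟨a0, a1⟩ := aa_mem hβ ⌊(k:ℝ)^b⌋₊
    set a := aa β ⌊(k:ℝ)^b⌋₊ with ha
    rw [← ENNReal.ofReal_pow (by linarith)]
    apply ENNReal.ofReal_le_ofReal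
    have u1 := uu_upper hβ ⌊(k:ℝ)^b⌋₊
    rw [← ha, ← hC] at u1
    have kb : (1:ℝ) ≤ (k:ℝ)^b := Real.one_le_rpow hk1 hb0.le
    have u2 : a ^ (-(β-1)) ≤ (1+C) * (k:ℝ)^b := by
      have := mul_le_mul_of_nonneg_left (Nat.floor_le (show (0:ℝ) ≤ (k:ℝ)^b by positivity)) C0.le
      linarith
    have u3 : c * (k:ℝ)^(-(b*γ)) ≤ a := by
      have := Real.rpow_le_rpow_of_nonpos (by positivity) u2 (show -γ ≤ 0 by linarith)
      rw [← Real.rpow_mul a0.le, show -(β-1) * -γ = 1 by rw [hγ]; field_simp, Real.rpow_one,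
        Real.mul_rpow (by positivity) (by positivity), ← Real.rpow_mul hk0.le] at this
      rwa [show -(b*γ) = b * -γ by ring]
    calc (1 - a)^k ≤ (Real.exp (-a))^k :=
          pow_le_pow_left₀ (by linarith) (Real.one_sub_le_exp_neg a) k
      _ = Real.exp (-(k * a)) := by rw [← Real.exp_nat_mul]; ring_nf
      _ ≤ _ := by
          apply Real.exp_le_exp.2
          have : (k:ℝ)^(1 - b*γ) = k * (k:ℝ)^(-(b*γ)) := by
            rw [sub_eq_add_neg, Real.rpow_add hk0, Real.rpow_one]
          rw [this]
          have := mul_le_mul_of_nonneg_left u3 hk0.le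
          linarith
  have hs : ∑' k : ℕ, volume {x | x ∈ Good β ∧ nn β x k ≤ ⌊(k:ℝ)^b⌋₊} ≠ ⊤ :=
    ne_top_of_le_ne_top (sum_exp c0 δ0).tsum_ofReal_ne_top (ENNReal.tsum_le_tsum key)
  filter_upwards [ae_eventually_notMem hs] with x hx hg
  filter_upwards [hx] with k hk
  have : ⌊(k:ℝ)^b⌋₊ < nn β x k := by
    by_contra h
    exact hk ⟨hg, not_lt.1 h⟩
  exact (Nat.lt_of_floor_lt this).le

lemma map_le {β : ℝ} (hβ : 2 ≤ β) (i : ℕ) :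
    Measure.map ((GG β)^[i]) (volume.restrict (Good β)) ≤
      ENNReal.ofReal (4^β) • volume.restrict (Ioo (0:ℝ) 1) := by
  rw [Measure.le_iff]
  intro A hA
  rw [Measure.map_apply ((GG_meas β).iterate i) hA,
    Measure.restrict_apply (((GG_meas β).iterate i) hA), Measure.smul_apply,
    Measure.restrict_apply hA]
  refine (measure_mono ?_).trans (push hβ (A ∩ Ioo 0 1) i)
  rintro x ⟨h1, h2⟩
  exact ⟨h2, h1, Good_mem (Good_GGi h2 i)⟩

lemma rpow_sum {q : ℝ} (h0 : 0 < q) (h1 : q ≤ 1) (f : ℕ → ℝ) (hf : ∀ i, 0 ≤ f i) (k : ℕ) :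
    (∑ i ∈ Finset.range k, f i)^q ≤ ∑ i ∈ Finset.range k, (f i)^q := by
  induction k with
  | zero => simp [Real.zero_rpow h0.ne']
  | succ k ih =>
    rw [Finset.sum_range_succ, Finset.sum_range_succ]
    have := Real.rpow_add_le_add_rpow (Finset.sum_nonneg (s := Finset.range k) (fun i _ => hf i))
      (hf k) h0.le h1
    linarith

lemma nn_upper {β : ℝ} (hβ : 2 ≤ β) {c : ℝ} (hc : β - 1 < c) :
    ∀ᵐ x ∂(volume : Measure ℝ), x ∈ Good β → ∃ C : ℝ, 0 < C ∧ ∀ k : ℕ,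
      (nn β x k : ℝ) ≤ C * (k:ℝ)^c := by
  have hβ1 : 0 < β - 1 := by linarith
  have c0 : 0 < c := by linarith
  set s : ℝ := Real.sqrt ((β-1)/c) with hs
  have s0 : 0 < s := Real.sqrt_pos.2 (by positivity)
  have ss : s * s = (β-1)/c := Real.mul_self_sqrt (by positivity)
  have s1 : s < 1 := by
    rw [hs, Real.sqrt_lt' one_pos, one_pow, div_lt_one c0]; exact hc
  have s1' : 1 < 1/s := by rw [lt_div_iff₀ s0]; linarith
  set q : ℝ := s/(β-1) with hq
  have q0 : 0 < q := by positivity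
  have q1 : q ≤ 1 := by rw [hq, div_le_one hβ1]; linarith
  set F : ℕ → ℝ → ENNReal := fun i x =>
    ENNReal.ofReal (((i:ℝ)+1)^(-(1/s))) * ENNReal.ofReal (((GG β)^[i] x)^(-s)) with hF
  have fm : ∀ i, Measurable (F i) := by
    intro i
    apply Measurable.const_mul
    apply Measurable.ennreal_ofReal
    exact ((GG_meas β).iterate i).pow_const _
  have I0 : ∫⁻ x in Ioo (0:ℝ) 1, ENNReal.ofReal (x^(-s)) ≠ ⊤ := by
    have : IntegrableOn (fun x : ℝ => x^(-s)) (Ioo 0 1) volume :=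
      (intervalIntegral.integrableOn_Ioo_rpow_iff one_pos).2 (by linarith)
    exact this.lintegral_lt_top.ne
  have I1 : ∀ i, ∫⁻ x in Good β, ENNReal.ofReal (((GG β)^[i] x)^(-s)) ≤
      ENNReal.ofReal (4^β) * ∫⁻ x in Ioo (0:ℝ) 1, ENNReal.ofReal (x^(-s)) := by
    intro i
    have hm : Measurable (fun x : ℝ => ENNReal.ofReal (x^(-s))) :=
      (measurable_id.pow_const _).ennreal_ofReal
    rw [← lintegral_map hm ((GG_meas β).iterate i), ← smul_eq_mul, ← lintegral_smul_measure]
    exact lintegral_mono' (map_le hβ i) le_rfl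
  have I2 : ∫⁻ x in Good β, ∑' i, F i x ≠ ⊤ := by
    rw [lintegral_tsum (fun i => (fm i).aemeasurable)]
    refine ne_top_of_le_ne_top ?_ (ENNReal.tsum_le_tsum (g := fun i : ℕ => 
      ENNReal.ofReal (((i:ℝ)+1)^(-(1/s))) * (ENNReal.ofReal (4^β) * ∫⁻ x in Ioo (0:ℝ) 1, ENNReal.ofReal (x^(-s)))) ?_)
    · rw [ENNReal.tsum_mul_right]
      apply ENNReal.mul_ne_top
      · apply Summable.tsum_ofReal_ne_top
        have := (summable_nat_add_iff 1).2 (Real.summable_nat_rpow.2 (show -(1/s) < -1 by linarith))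
        simpa using this
      · exact ENNReal.mul_ne_top ENNReal.ofReal_ne_top I0
    · intro i
      simp only [hF]
      rw [lintegral_const_mul' _ _ ENNReal.ofReal_ne_top]
      exact mul_le_mul_right (I1 i) _
  have I3 := ae_lt_top (Measurable.tsum fm) I2
  rw [ae_restrict_iff' (Good_meas β)] at I3
  filter_upwards [I3] with x hx hg
  have hx := hx hg
  set M : ℝ := (∑' i, F i x).toReal with hM
  have M0 : 0 ≤ M := ENNReal.toReal_nonneg
  have key : ∀ k, ∑ i ∈ Finset.range k, ((i:ℝ)+1)^(-(1/s)) * ((GG β)^[i] x)^(-s) ≤ M := by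
    intro k
    have nonneg : ∀ i : ℕ, 0 ≤ ((i:ℝ)+1)^(-(1/s)) * ((GG β)^[i] x)^(-s) := by
      intro i
      have := (Good_mem (Good_GGi hg i)).1
      positivity
    rw [hM, ← ENNReal.ofReal_le_iff_le_toReal hx.ne, ENNReal.ofReal_sum_of_nonneg (fun i _ => nonneg i)]
    refine le_trans (le_of_eq ?_) (ENNReal.sum_le_tsum (Finset.range k))
    apply Finset.sum_congr rfl
    intro i _
    rw [ENNReal.ofReal_mul (by positivity)]
  refine ⟨(M+1)^(1/q), by positivity, fun k => ?_⟩
  have e1 : (nn β x k : ℝ)^q ≤ (M+1) * (k:ℝ)^(1/s) := by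
    calc (nn β x k : ℝ)^q = (∑ i ∈ Finset.range k, ((tau β ((GG β)^[i] x) : ℝ) + 1))^q := by
          simp [nn]
      _ ≤ ∑ i ∈ Finset.range k, ((tau β ((GG β)^[i] x) : ℝ) + 1)^q :=
          rpow_sum q0 q1 _ (fun i => by positivity) k
      _ ≤ ∑ i ∈ Finset.range k, (k:ℝ)^(1/s) * (((i:ℝ)+1)^(-(1/s)) * ((GG β)^[i] x)^(-s)) := by
          apply Finset.sum_le_sum
          intro i hi
          have hi : (i:ℝ) + 1 ≤ k := by exact_mod_cast Finset.mem_range.1 hi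
          have g0 := Good_mem (Good_GGi hg i)
          have t1 := tau_le hβ g0
          have t2 := Real.rpow_le_rpow (by positivity) t1 q0.le
          rw [← Real.rpow_mul g0.1.le, show -(β-1)*q = -s by rw [hq]; field_simp] at t2
          refine t2.trans ?_
          rw [← mul_assoc]
          refine le_mul_of_one_le_left (Real.rpow_nonneg g0.1.le _) ?_
          rw [Real.rpow_neg (by positivity), ← div_eq_mul_inv, one_le_div (by positivity)]
          exact Real.rpow_le_rpow (by positivity) hi (by positivity)
      _ = (k:ℝ)^(1/s) * ∑ i ∈ Finset.range k, (((i:ℝ)+1)^(-(1/s)) * ((GG β)^[i] x)^(-s)) := by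
          rw [Finset.mul_sum]
      _ ≤ _ := by
          have := mul_le_mul_of_nonneg_left (key k) (show 0 ≤ (k:ℝ)^(1/s) by positivity)
          have : 0 ≤ (k:ℝ)^(1/s) := by positivity
          linarith
  have e2 := Real.rpow_le_rpow (by positivity) e1 (show 0 ≤ 1/q by positivity)
  rw [← Real.rpow_mul (Nat.cast_nonneg _), mul_one_div_cancel q0.ne', Real.rpow_one,
    Real.mul_rpow (by positivity) (by positivity), ← Real.rpow_mul (Nat.cast_nonneg _)] at e2
  have : 1/s * (1/q) = c := by
    rw [hq]
    have : c = (β-1)/(s*s) := by rw [ss]; field_simp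
    rw [this]; field_simp
  rwa [this] at e2

end MP


namespace MP

lemma hits {β : ℝ} (hβ : 2 ≤ β) : ∃ K0 c0 : ℕ, ∀ᵐ x ∂(volume : Measure ℝ), x ∈ Good β →
    ∀ᶠ p : ℕ in atTop, ∀ c : ℕ, c < 2^p → ∃ i, p ≤ i ∧ i ≤ p + 2^p * p * K0 * (p + c0 + 1) ∧
      (GG β)^[i] x ∈ Icc ((c:ℝ)/2^p) (((c:ℝ)+1)/2^p) := by
  set F : ℝ := 4^β with hF
  have F0 : 0 < F := by positivity
  obtain ⟨c0, hc0⟩ := pow_unbounded_of_one_lt (4 * F * F) (one_lt_two : (1:ℝ) < 2)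
  obtain ⟨K0, hK0⟩ := exists_nat_ge (4 * F)
  refine ⟨K0, c0, ?_⟩
  set B : ℕ → ℕ → Set ℝ := fun p c => {x | x ∈ Good β ∧ ∀ i < 2^p * p * K0 * ((p + c0) + 1),
    (GG β)^[i + p] x ∉ Icc ((c:ℝ)/2^p) (((c:ℝ)+1)/2^p)} with hB
  have key : ∀ p, ∀ c < 2^p, volume (B p c) ≤ ENNReal.ofReal (F * (1/4)^p) := by
    intro p c hc
    have hc' : (c:ℝ) + 1 ≤ 2^p := by exact_mod_cast hc
    set P : ℝ := 2^p with hP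
    have P0 : 0 < P := by positivity
    set q : ℝ := 1 - 1/(2*F*P) with hq
    have F1 : 1 ≤ F := Real.one_le_rpow (by norm_num) (by linarith)
    have P1 : 1 ≤ P := one_le_pow₀ (by norm_num)
    have q0 : 0 ≤ q := by
      rw [hq, sub_nonneg, div_le_one (by positivity)]
      nlinarith
    refine (miss hβ (u := (c:ℝ)/P) (v := ((c:ℝ)+1)/P) (by positivity) (by gcongr; linarith)
      (by rw [div_le_one P0]; exact hc') (p + c0) q ?_ (2^p * p * K0) p).trans ?_
    · rw [← hF, pow_add, ← hP]
      have e1 : (((c:ℝ)+1)/P - c/P)/F = 1/(F*P) := by field_simp; ring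
      have e2 : 2 * F / (P * 2^c0) ≤ 1/(2*F*P) := by
        rw [div_le_div_iff₀ (by positivity) (by positivity)]
        nlinarith
      have e3 : 1/(F*P) = 2 * (1/(2*F*P)) := by field_simp
      rw [e1, hq, e3]; linarith
    · rw [← hF, ← ENNReal.ofReal_pow q0, ← ENNReal.ofReal_mul F0.le]
      apply ENNReal.ofReal_le_ofReal
      apply mul_le_mul_of_nonneg_left _ F0.le
      have q1 : q ≤ Real.exp (-(1/(2*F*P))) := Real.one_sub_le_exp_neg _
      calc q ^ (2^p * p * K0) ≤ (Real.exp (-(1/(2*F*P)))) ^ (2^p * p * K0) :=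
            pow_le_pow_left₀ q0 q1 _
        _ = Real.exp (-(K0/(2*F)))^p := by
            rw [← Real.exp_nat_mul, ← Real.exp_nat_mul]
            congr 1
            push_cast
            rw [← hP]; field_simp
        _ ≤ _ := by
            apply pow_le_pow_left₀ (Real.exp_pos _).le
            have : (2:ℝ) ≤ K0/(2*F) := by rw [le_div_iff₀ (by positivity)]; linarith
            have h2 : Real.exp (-(K0/(2*F))) ≤ Real.exp (-2) := Real.exp_le_exp.2 (by linarith)
            refine h2.trans ?_
            rw [Real.exp_neg, one_div]
            apply inv_anti₀ (by norm_num)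
            have : Real.exp 2 = Real.exp 1 * Real.exp 1 := by rw [← Real.exp_add]; norm_num
            have := Real.add_one_le_exp (1:ℝ)
            nlinarith
  have hs : ∑' p : ℕ, volume (⋃ c ∈ Finset.range (2^p), B p c) ≠ ⊤ := by
    refine ne_top_of_le_ne_top (b := ∑' p : ℕ, ENNReal.ofReal (F * (1/2)^p)) ?_ 
      (ENNReal.tsum_le_tsum fun p => ?_)
    · apply Summable.tsum_ofReal_ne_top
      exact (summable_geometric_of_lt_one (by norm_num) (by norm_num)).mul_left F
    · refine (measure_biUnion_finset_le _ _).trans ?_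
      refine (Finset.sum_le_sum (fun c hc => key p c (Finset.mem_range.1 hc))).trans ?_
      rw [Finset.sum_const, Finset.card_range, nsmul_eq_mul]
      have : ((2^p : ℕ) : ENNReal) = ENNReal.ofReal (2^p) := by
        rw [ENNReal.ofReal_pow (by norm_num)]; norm_num
      rw [this, ← ENNReal.ofReal_mul (by positivity)]
      apply ENNReal.ofReal_le_ofReal
      apply le_of_eq
      rw [show (1/2:ℝ) = 2 * (1/4) by norm_num, mul_pow]; ring
  filter_upwards [ae_eventually_notMem hs] with x hx hg
  filter_upwards [hx] with p hp c hc
  by_contra hcon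
  push Not at hcon
  apply hp
  refine mem_iUnion₂.2 ⟨c, Finset.mem_range.2 hc, hg, fun i hi => ?_⟩
  exact hcon (i+p) (by omega) (by omega)

lemma T_hits {β : ℝ} (hβ : 2 ≤ β) {b : ℝ} (hb : β - 1 < b) :
    ∀ᵐ x ∂(volume : Measure ℝ), x ∈ Good β →
    ∀ᶠ p : ℕ in atTop, ∀ c : ℕ, c < 2^p → ∃ n : ℕ, p ≤ n ∧ (n:ℝ) ≤ (2:ℝ)^((p:ℝ)*b) ∧
      (T β)^[n] x ∈ Icc ((c:ℝ)/2^p) (((c:ℝ)+1)/2^p) := by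
  obtain ⟨K0, c0, hH⟩ := hits hβ
  set e : ℝ := (β - 1 + b)/2 with he
  have e0 : 0 < e := by rw [he]; linarith
  have eb : e < b := by rw [he]; linarith
  filter_upwards [hH, nn_upper hβ (show β - 1 < e by rw [he]; linarith)] with x h1 h2 hg
  obtain ⟨C, C0, hC⟩ := h2 hg
  have lim : Tendsto (fun p : ℕ => (C^(1/e)) * ((1 + K0 * (c0 + 2)) * ((p:ℝ)^2 * ((2:ℝ)^(1 - b/e))^p)))
      atTop (nhds 0) := by
    have := tendsto_pow_const_mul_const_pow_of_abs_lt_one 2 (r := (2:ℝ)^(1 - b/e)) (by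
      rw [abs_of_pos (by positivity)]
      apply Real.rpow_lt_one_of_one_lt_of_neg (by norm_num)
      rw [sub_neg, one_lt_div e0]; exact eb)
    simpa using (this.const_mul (1 + K0 * (c0 + 2) : ℝ)).const_mul (C^(1/e))
  filter_upwards [h1 hg, lim.eventually (Iio_mem_nhds one_pos), eventually_ge_atTop 1] with
    p hp hl hp1 c hc
  obtain ⟨i, i1, i2, i3⟩ := hp c hc
  refine ⟨nn β x i, i1.trans (nn_ge β x i), ?_, by rw [T_nn]; exact i3⟩
  refine (hC i).trans ?_
  have i4 : (i:ℝ) ≤ (1 + K0 * (c0 + 2)) * ((p:ℝ)^2 * 2^p) := by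
    have : i ≤ (1 + K0 * (c0 + 2)) * (p^2 * 2^p) := by
      refine i2.trans ?_
      have q1 : p ≤ p^2 * 2^p := by
        calc p = p * 1 * 1 := by ring
          _ ≤ p * p * 2^p := Nat.mul_le_mul (Nat.mul_le_mul le_rfl hp1) Nat.one_le_two_pow
          _ = _ := by ring
      have q2 : p + c0 + 1 ≤ p * (c0 + 2) := by nlinarith
      calc _ ≤ p^2 * 2^p + 2^p * p * K0 * (p * (c0+2)) := by gcongr
        _ = _ := by ring
    exact_mod_cast this
  have l1 : C^(1/e) * (i:ℝ) ≤ 2^((p:ℝ)*(b/e)) := by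
    have : (2:ℝ)^((p:ℝ)*(b/e)) * ((2:ℝ)^(1 - b/e))^p = 2^p := by
      rw [← Real.rpow_natCast, ← Real.rpow_natCast, ← Real.rpow_mul (by norm_num), ← Real.rpow_add (by norm_num)]
      congr 1; ring
    calc C^(1/e) * (i:ℝ) ≤ C^(1/e) * ((1 + K0 * (c0 + 2)) * ((p:ℝ)^2 * 2^p)) := by gcongr
      _ = 2^((p:ℝ)*(b/e)) * ((C^(1/e)) * ((1 + K0 * (c0 + 2)) * ((p:ℝ)^2 * ((2:ℝ)^(1 - b/e))^p))) := by
          rw [← this]; ring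
      _ ≤ 2^((p:ℝ)*(b/e)) * 1 := mul_le_mul_of_nonneg_left hl.le (by positivity)
      _ = _ := mul_one _
  have l2 := Real.rpow_le_rpow (by positivity) l1 e0.le
  rw [Real.mul_rpow (by positivity) (by positivity), ← Real.rpow_mul C0.le, one_div_mul_cancel e0.ne',
    Real.rpow_one, ← Real.rpow_mul (by norm_num)] at l2
  refine l2.trans (le_of_eq ?_)
  congr 1; field_simp

end MP


namespace MP

lemma dim_limsup {z ρ : ℕ → ℝ} (hρ : ∀ k, 0 ≤ ρ k) {t : ℝ} (t0 : 0 < t)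
    (hs : Summable (fun k => (ρ k)^t)) :
    dimH {y : ℝ | ∃ᶠ k in atTop, |z k - y| < ρ k} ≤ ENNReal.ofReal t := by
  have e : ENNReal.ofReal t = ((Real.toNNReal t : NNReal) : ENNReal) := rfl
  rw [e]
  apply dimH_le_of_hausdorffMeasure_ne_top
  rw [Real.coe_toNNReal _ t0.le]
  have hS : ∑' k, (ENNReal.ofReal (2 * ρ k))^t ≠ ⊤ := by
    have := (hs.mul_left (2^t)).tsum_ofReal_ne_top
    convert this using 3 with k
    rw [ENNReal.ofReal_rpow_of_nonneg (by have := hρ k; positivity) t0.le, Real.mul_rpow (by norm_num) (hρ k)]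
  have h0 := ENNReal.tendsto_sum_nat_add _ hS
  have h1 : Tendsto (fun n => (∑' k, (ENNReal.ofReal (2 * ρ (k+n)))^t)^(1/t)) atTop (nhds 0) := by
    have := ((ENNReal.continuous_rpow_const (y := 1/t)).tendsto 0).comp h0
    rwa [ENNReal.zero_rpow_of_pos (by positivity)] at this
  have dm : ∀ k, Metric.ediam (Ioo (z k - ρ k) (z k + ρ k)) = ENNReal.ofReal (2 * ρ k) := by
    intro k; rw [Real.ediam_Ioo]; congr 1; ring
  have := Measure.hausdorffMeasure_le_liminf_tsum (ι := fun _ => ℕ) t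
    {y : ℝ | ∃ᶠ k in atTop, |z k - y| < ρ k} _ h1
    (fun n i => Ioo (z (i+n) - ρ (i+n)) (z (i+n) + ρ (i+n))) (Eventually.of_forall fun n i => by
      rw [dm]
      rw [one_div, ENNReal.le_rpow_inv_iff t0]
      exact ENNReal.le_tsum (f := fun k => (ENNReal.ofReal (2 * ρ (k+n)))^t) i)
    (Eventually.of_forall fun n y hy => by
      obtain ⟨k, hk, hk2⟩ := frequently_atTop.1 hy n
      refine mem_iUnion.2 ⟨k - n, ?_⟩
      rw [Nat.sub_add_cancel hk]
      rw [abs_lt] at hk2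
      constructor <;> linarith)
  simp only [dm] at this
  rw [h0.liminf_eq] at this
  exact ne_top_of_le_ne_top ENNReal.zero_ne_top this

lemma nn_mono (β x : ℝ) : Monotone (nn β x) := by
  intro a b h
  apply Finset.sum_le_sum_of_subset
  exact Finset.range_mono h

lemma dim_upper {β : ℝ} (hβ : 2 ≤ β) {α : ℝ} (hα : 1 ≤ α) {r : ℕ → ℝ}
    (hr : ∀ j : ℕ, r j = (j:ℝ)^(-α)) {x b t : ℝ} (hx : x ∈ Good β) (b0 : 0 < b)
    (hb : ∀ᶠ k : ℕ in atTop, (k:ℝ)^b ≤ nn β x k) (t0 : 0 < t) (ht : 1 < α * b * t) :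
    dimH (hitSet (MannevillePomeau β) x r) ≤ ENNReal.ofReal t := by
  set Λ : ℕ → Set ℝ := fun j => {y : ℝ | ∃ᶠ k in atTop,
    |(T β)^[nn β x (k+1) - 1 - j] x - y| < ((nn β x (k+1) - 1 - j : ℕ) : ℝ)^(-α)} with hΛ
  have sub : hitSet (MannevillePomeau β) x r ⊆ {0} ∪ ⋃ j, Λ j := by
    rintro y ⟨hy, hf⟩
    rcases hy.1.eq_or_lt with h | y0
    · left; exact h.symm
    right
    obtain ⟨J, hJ⟩ := exists_nat_ge ((y/2)^(-(β-1)))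
    have ev : ∀ᶠ n : ℕ in atTop, r n < y/2 := by
      have := (tendsto_rpow_neg_atTop (show 0 < α by linarith)).comp (tendsto_natCast_atTop_atTop (R := ℝ))
      filter_upwards [this.eventually (Iio_mem_nhds (half_pos y0))] with n hn
      rw [hr]; exact hn
    have f2 : ∃ᶠ n in atTop, ∃ j ∈ Finset.range (J+1), tau β ((T β)^[n] x) = j ∧
        |(T β)^[n] x - y| < r n := by
      refine (hf.and_eventually ev).mono ?_
      rintro n ⟨h1, h2⟩
      refine ⟨_, Finset.mem_range.2 ?_, rfl, h1⟩
      have h3 : y/2 ≤ (T β)^[n] x := by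
        rw [abs_lt] at h1; linarith [h1.1]
      have h4 := tau_le hβ (Good_mem (Good_iter hx n))
      have h5 := Real.rpow_le_rpow_of_nonpos (half_pos y0) h3 (show -(β-1) ≤ 0 by linarith)
      have : ((tau β ((T β)^[n] x) : ℕ) : ℝ) < ((J+1 : ℕ) : ℝ) := by push_cast; linarith
      exact_mod_cast this
    rw [frequently_exists_finset] at f2
    obtain ⟨j, _, fj⟩ := f2
    refine mem_iUnion.2 ⟨j, ?_⟩
    refine frequently_atTop.2 fun K0 => ?_
    obtain ⟨n, hn, hn1, hn2⟩ := frequently_atTop.1 fj (nn β x (K0+1))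
    obtain ⟨k, hk⟩ := nn_cover hβ hx n
    rw [hn1] at hk
    have e : nn β x (k+1) - 1 - j = n := by omega
    refine ⟨k, ?_, ?_⟩
    · by_contra hc
      have := nn_mono β x (show k + 1 ≤ K0 + 1 by omega)
      omega
    · rw [e, ← hr]; exact hn2
  refine (dimH_mono sub).trans ?_
  rw [dimH_union, dimH_iUnion, dimH_singleton, max_le_iff]
  refine ⟨zero_le, iSup_le fun j => ?_⟩
  apply dim_limsup (z := fun k => (T β)^[nn β x (k+1) - 1 - j] x)
    (ρ := fun k => ((nn β x (k+1) - 1 - j : ℕ) : ℝ)^(-α)) (fun k => by positivity) t0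
  have hsum : Summable (fun k : ℕ => 2^(α*t) * (k:ℝ)^(-(α*b*t))) :=
    (Real.summable_nat_rpow.2 (by linarith)).mul_left _
  refine Summable.of_norm_bounded_eventually_nat hsum ?_
  have l1 := ((tendsto_rpow_atTop b0).comp (tendsto_natCast_atTop_atTop (R := ℝ))).eventually_ge_atTop (2 * (1 + j))
  have l2 := (tendsto_add_atTop_nat 1).eventually hb
  filter_upwards [l1, l2, eventually_ge_atTop 1] with k h1 h2 hk
  simp only [Function.comp] at h1
  have k0 : (0:ℝ) < k := by exact_mod_cast hk
  rw [Real.norm_of_nonneg (by positivity)]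
  have h3 : (k:ℝ)^b ≤ nn β x (k+1) := by
    refine le_trans (Real.rpow_le_rpow k0.le ?_ b0.le) h2
    push_cast; linarith
  have h4 : (k:ℝ)^b/2 ≤ ((nn β x (k+1) - 1 - j : ℕ) : ℝ) := by
    have : (nn β x (k+1) : ℝ) ≤ ((nn β x (k+1) - 1 - j : ℕ) : ℝ) + 1 + j := by
      have : nn β x (k+1) ≤ (nn β x (k+1) - 1 - j) + 1 + j := by omega
      exact_mod_cast this
    linarith
  have k1 : (0:ℝ) < (k:ℝ)^b/2 := by positivity
  rw [← Real.rpow_mul (by positivity)]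
  refine (Real.rpow_le_rpow_of_nonpos k1 h4 (by nlinarith)).trans (le_of_eq ?_)
  rw [Real.div_rpow (by positivity) (by norm_num), ← Real.rpow_mul k0.le, neg_mul, 
    Real.rpow_neg (by norm_num : (0:ℝ) ≤ 2), div_inv_eq_mul, mul_comm]
  congr 2; ring

end MP


namespace MP

lemma dim_holder {s : Set ℝ} {φ : ℝ → ℝ} {r : ℝ} (r0 : 0 < r)
    (hm : ∀ t ∈ Ico (0:ℝ) 1, φ t ∈ s)
    (hh : ∀ t ∈ Ico (0:ℝ) 1, ∀ t' ∈ Ico (0:ℝ) 1, |t - t'| ≤ 3 * |φ t - φ t'|^r) :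
    ENNReal.ofReal r ≤ dimH s := by
  have inj : InjOn φ (Ico 0 1) := by
    intro t ht t' ht' h
    have := hh t ht t' ht'
    rw [h, sub_self, abs_zero, Real.zero_rpow r0.ne', mul_zero] at this
    have := abs_nonpos_iff.1 this
    linarith
  set ψ := Function.invFunOn φ (Ico 0 1) with hψ
  have hinv : ∀ t ∈ Ico (0:ℝ) 1, ψ (φ t) = t := fun t ht => inj.leftInvOn_invFunOn ht
  have H : HolderOnWith 3 (Real.toNNReal r) ψ (φ '' Ico 0 1) := by
    rintro _ ⟨t, ht, rfl⟩ _ ⟨t', ht', rfl⟩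
    rw [hinv t ht, hinv t' ht', edist_dist, edist_dist, Real.coe_toNNReal _ r0.le,
      ENNReal.ofReal_rpow_of_nonneg dist_nonneg r0.le]
    have : ((3 : NNReal) : ENNReal) = ENNReal.ofReal 3 := by norm_num
    rw [this, ← ENNReal.ofReal_mul (by norm_num)]
    exact ENNReal.ofReal_le_ofReal (hh t ht t' ht')
  have h1 := H.dimH_image_le (Real.toNNReal_pos.2 r0)
  have h2 : ψ '' (φ '' Ico 0 1) = Ico 0 1 := by
    rw [← image_comp]
    ext t; constructor
    · rintro ⟨u, hu, rfl⟩
      simp only [Function.comp]; rw [hinv u hu]; exact hu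
    · intro ht; exact ⟨t, ht, hinv t ht⟩
  have h3 : dimH (Ico (0:ℝ) 1) = 1 := by
    have := Real.dimH_of_mem_nhds (E := ℝ) (x := 1/2) (s := Ico (0:ℝ) 1)
      (Ico_mem_nhds (by norm_num) (by norm_num))
    simpa using this
  rw [h2, h3] at h1
  have r1 : ((Real.toNNReal r : NNReal) : ENNReal) ≠ 0 := by
    simpa using r0
  rw [ENNReal.le_div_iff_mul_le (Or.inl r1) (Or.inl ENNReal.coe_ne_top), one_mul] at h1
  refine le_trans h1 (dimH_mono ?_)
  rintro _ ⟨t, ht, rfl⟩; exact hm t ht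

lemma cantor_seq {r : ℝ} (r0 : 0 < r) (r1 : r ≤ 1) (U : ℕ → Set ℝ) (ℓ : ℕ → ℝ) (M : ℕ → ℕ)
    (A : ℕ → ℝ → ℕ → ℝ) (ℓ0 : ℓ 0 = 1) (ℓp : ∀ i, 0 < ℓ i) (ℓ1 : ∀ i, ℓ i ≤ 1)
    (M2 : ∀ i, 2 ≤ M i) (hM : ∀ i, 1 ≤ (M i : ℝ) * (ℓ (i+1))^r)
    (hA : ∀ i a, 0 ≤ a → a + ℓ i ≤ 1 → ∀ c < M i,
      a + (c + 1/3) * ℓ i / M i ≤ A i a c ∧ A i a c + ℓ (i+1) ≤ a + (c + 2/3) * ℓ i / M i ∧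
      Icc (A i a c) (A i a c + ℓ (i+1)) ⊆ U i) :
    ENNReal.ofReal r ≤ dimH (Icc (0:ℝ) 1 ∩ ⋂ i, U i) := by
  let p : ℝ → ℕ → ℝ × ℝ := fun t i => Nat.rec (0, t) (fun i s =>
    (A i s.1 ⌊(M i : ℝ) * s.2⌋₊, Int.fract ((M i : ℝ) * s.2))) i
  have p0 : ∀ t, p t 0 = (0, t) := fun t => rfl
  have ps : ∀ t i, p t (i+1) = (A i (p t i).1 ⌊(M i : ℝ) * (p t i).2⌋₊,
    Int.fract ((M i : ℝ) * (p t i).2)) := fun t i => rfl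
  have Mp : ∀ i, (0:ℝ) < M i := fun i => by have := M2 i; positivity
  have dig : ∀ i (u : ℝ), 0 ≤ u → u < 1 → ⌊(M i : ℝ) * u⌋₊ < M i := by
    intro i u h0 h1
    rw [Nat.floor_lt (by have := Mp i; positivity)]
    have := Mp i; nlinarith
  have inv : ∀ t ∈ Ico (0:ℝ) 1, ∀ i, 0 ≤ (p t i).1 ∧ (p t i).1 + ℓ i ≤ 1 ∧ 0 ≤ (p t i).2 ∧
      (p t i).2 < 1 := by
    intro t ht i
    induction i with
    | zero => rw [p0, ℓ0]; exact ⟨le_rfl, by norm_num, ht.1, ht.2⟩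
    | succ i ih =>
      obtain ⟨i1, i2, i3, i4⟩ := ih
      have d := dig i _ i3 i4
      obtain ⟨a1, a2, _⟩ := hA i _ i1 i2 _ d
      have hM := Mp i
      have hl := ℓp i
      rw [ps]
      refine ⟨?_, ?_, Int.fract_nonneg _, Int.fract_lt_one _⟩
      · refine le_trans ?_ a1
        positivity
      · refine a2.trans (le_trans ?_ i2)
        have d' : ((⌊(M i : ℝ) * (p t i).2⌋₊ : ℕ) : ℝ) + 1 ≤ M i := by exact_mod_cast d
        have : ((⌊(M i : ℝ) * (p t i).2⌋₊ : ℕ) + 2/3) * ℓ i / M i ≤ ℓ i := by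
          rw [div_le_iff₀ hM]; nlinarith
        linarith
  -- explicit step bounds
  have stp : ∀ t ∈ Ico (0:ℝ) 1, ∀ i,
      (p t i).1 + ((⌊(M i : ℝ) * (p t i).2⌋₊ : ℕ) + 1/3) * ℓ i / M i ≤ (p t (i+1)).1 ∧
      (p t (i+1)).1 + ℓ (i+1) ≤ (p t i).1 + ((⌊(M i : ℝ) * (p t i).2⌋₊ : ℕ) + 2/3) * ℓ i / M i ∧
      Icc (p t (i+1)).1 ((p t (i+1)).1 + ℓ (i+1)) ⊆ U i := by
    intro t ht i
    obtain ⟨i1, i2, i3, i4⟩ := inv t ht i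
    exact hA i _ i1 i2 _ (dig i _ i3 i4)
  let φ : ℝ → ℝ := fun t => ⨆ i, (p t i).1
  have hφ : ∀ t ∈ Ico (0:ℝ) 1, ∀ i, φ t ∈ Icc (p t i).1 ((p t i).1 + ℓ i) := by
    intro t ht
    have m1 : Monotone (fun i => (p t i).1) := by
      apply monotone_nat_of_le_succ
      intro i
      refine le_trans ?_ (stp t ht i).1
      have := Mp i
      have hl := ℓp i
      have : 0 ≤ ((⌊(M i : ℝ) * (p t i).2⌋₊ : ℕ) + 1/3) * ℓ i / M i := by positivity
      linarith
    have m2 : Antitone (fun i => (p t i).1 + ℓ i) := by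
      apply antitone_nat_of_succ_le
      intro i
      refine (stp t ht i).2.1.trans ?_
      obtain ⟨i1, i2, i3, i4⟩ := inv t ht i
      have d' : ((⌊(M i : ℝ) * (p t i).2⌋₊ : ℕ) : ℝ) + 1 ≤ M i := by exact_mod_cast dig i _ i3 i4
      have hM := Mp i
      have hl := ℓp i
      have : ((⌊(M i : ℝ) * (p t i).2⌋₊ : ℕ) + 2/3) * ℓ i / M i ≤ ℓ i := by
        rw [div_le_iff₀ hM]; nlinarith
      linarith
    have := Monotone.ciSup_mem_iInter_Icc_of_antitone m1 m2 (fun i => by have := ℓp i; simp only; linarith)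
    exact fun i => mem_iInter.1 this i
  have hI : ∀ t ∈ Ico (0:ℝ) 1, φ t ∈ Icc (0:ℝ) 1 := by
    intro t ht
    have := hφ t ht 0
    rw [p0, ℓ0] at this; simpa using this
  have asym : ∀ t ∈ Ico (0:ℝ) 1, ∀ t' ∈ Ico (0:ℝ) 1, ∀ i, (p t i).1 = (p t' i).1 →
      ⌊(M i : ℝ) * (p t i).2⌋₊ < ⌊(M i : ℝ) * (p t' i).2⌋₊ →
      |(p t i).2 - (p t' i).2| ≤ 3 * (|φ t - φ t'|/ℓ i) := by
    intro t ht t' ht' i ha hlt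
    obtain ⟨i1, i2, i3, i4⟩ := inv t ht i
    obtain ⟨j1, j2, j3, j4⟩ := inv t' ht' i
    have s1 := (stp t ht i).2.1
    have s2 := (stp t' ht' i).1
    have f1 := (hφ t ht (i+1)).2
    have f2 := (hφ t' ht' (i+1)).1
    have hM := Mp i
    have hl := ℓp i
    have q1 := Nat.floor_le (show 0 ≤ (M i : ℝ) * (p t i).2 by positivity)
    have q2 := Nat.lt_floor_add_one ((M i : ℝ) * (p t' i).2)
    have q3 := Nat.lt_floor_add_one ((M i : ℝ) * (p t i).2)
    have q4 := Nat.floor_le (show 0 ≤ (M i : ℝ) * (p t' i).2 by positivity)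
    have hlt' : ((⌊(M i : ℝ) * (p t i).2⌋₊ : ℕ) : ℝ) + 1 ≤ (⌊(M i : ℝ) * (p t' i).2⌋₊ : ℕ) := by
      exact_mod_cast hlt
    generalize ((⌊(M i : ℝ) * (p t i).2⌋₊ : ℕ) : ℝ) = c at *
    generalize ((⌊(M i : ℝ) * (p t' i).2⌋₊ : ℕ) : ℝ) = c' at *
    have g1 : (c' - c - 1/3) * ℓ i / M i ≤ |φ t - φ t'| := by
      rw [abs_sub_comm]
      refine le_trans ?_ (le_abs_self _)
      have : (c' - c - 1/3) * ℓ i / M i = (c' + 1/3) * ℓ i / M i - (c + 2/3) * ℓ i / M i := by ring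
      rw [this]; linarith
    have g2 : (p t i).2 ≤ (p t' i).2 := by
      by_contra h
      push Not at h
      nlinarith
    have g3 : (c' - c - 1/3) / M i ≤ |φ t - φ t'| / ℓ i := by
      rw [le_div_iff₀ hl]
      refine le_trans (le_of_eq ?_) g1; ring
    have g4 : (p t' i).2 - (p t i).2 ≤ 3 * ((c' - c - 1/3) / M i) := by
      rw [← mul_div_assoc, le_div_iff₀ hM]; nlinarith
    rw [abs_sub_comm, abs_of_nonneg (by linarith)]
    linarith
  have main : ∀ t ∈ Ico (0:ℝ) 1, ∀ t' ∈ Ico (0:ℝ) 1, ∀ N i, (p t i).1 = (p t' i).1 →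
      |(p t i).2 - (p t' i).2| ≤ 3 * (|φ t - φ t'|/ℓ i)^r + (1/2)^N := by
    intro t ht t' ht' N
    induction N with
    | zero =>
      intro i _
      obtain ⟨i1, i2, i3, i4⟩ := inv t ht i
      obtain ⟨j1, j2, j3, j4⟩ := inv t' ht' i
      have hl := ℓp i
      have : 0 ≤ 3 * (|φ t - φ t'|/ℓ i)^r := by positivity
      rw [pow_zero]
      have : |(p t i).2 - (p t' i).2| ≤ 1 := by rw [abs_le]; constructor <;> linarith
      linarith
    | succ N ih =>
      intro i ha
      have hl := ℓp i
      have hl' := ℓp (i+1)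
      have hMi := Mp i
      obtain ⟨i1, i2, i3, i4⟩ := inv t ht i
      obtain ⟨j1, j2, j3, j4⟩ := inv t' ht' i
      have D1 : |φ t - φ t'|/ℓ i ≤ 1 := by
        rw [div_le_one hl]
        have f1 := hφ t ht i
        have f2 := hφ t' ht' i
        rw [← ha] at f2
        rw [abs_le]; constructor <;> linarith [f1.1, f1.2, f2.1, f2.2]
      have D0 : 0 ≤ |φ t - φ t'|/ℓ i := by positivity
      have D2 : |φ t - φ t'|/ℓ i ≤ (|φ t - φ t'|/ℓ i)^r := by
        conv_lhs => rw [← Real.rpow_one (|φ t - φ t'|/ℓ i)]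
        rcases D0.eq_or_lt with h | h
        · rw [← h, Real.zero_rpow r0.ne', Real.zero_rpow one_ne_zero]
        · exact Real.rpow_le_rpow_of_exponent_ge h D1 r1
      have hN : (0:ℝ) < (1/2)^(N+1) := by positivity
      rcases lt_trichotomy ⌊(M i : ℝ) * (p t i).2⌋₊ ⌊(M i : ℝ) * (p t' i).2⌋₊ with h | h | h
      · have := asym t ht t' ht' i ha h; linarith
      · have e1 : (p t (i+1)).1 = (p t' (i+1)).1 := by rw [ps, ps, ha, h]
        have e2 := ih (i+1) e1
        have e3 : (p t (i+1)).2 - (p t' (i+1)).2 = M i * ((p t i).2 - (p t' i).2) := by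
          rw [ps, ps]
          simp only
          have z1 := natCast_floor_eq_intCast_floor (R := ℝ) (show 0 ≤ (M i : ℝ) * (p t i).2 by positivity)
          have z2 := natCast_floor_eq_intCast_floor (R := ℝ) (show 0 ≤ (M i : ℝ) * (p t' i).2 by positivity)
          rw [h, z2] at z1
          rw [Int.fract, Int.fract, z1]; ring
        rw [e3, abs_mul, abs_of_pos hMi] at e2
        have e4 : (|φ t - φ t'|/ℓ (i+1))^r ≤ M i * (|φ t - φ t'|/ℓ i)^r := by
          rw [Real.div_rpow (abs_nonneg _) hl'.le, Real.div_rpow (abs_nonneg _) hl.le,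
            div_le_iff₀ (by positivity)]
          have w1 : (ℓ i)^r ≤ 1 := Real.rpow_le_one hl.le (ℓ1 i) r0.le
          have w2 : |φ t - φ t'|^r ≤ |φ t - φ t'|^r / (ℓ i)^r := by
            rw [le_div_iff₀ (by positivity)]
            exact mul_le_of_le_one_right (by positivity) w1
          have w3 : 0 ≤ |φ t - φ t'|^r / (ℓ i)^r := by positivity
          calc _ ≤ |φ t - φ t'|^r / (ℓ i)^r * 1 := by linarith
            _ ≤ |φ t - φ t'|^r / (ℓ i)^r * (M i * (ℓ (i+1))^r) := mul_le_mul_of_nonneg_left (hM i) w3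
            _ = _ := by ring
        have M2' : (2:ℝ) ≤ M i := by exact_mod_cast M2 i
        have e5 : ((1:ℝ)/2)^N ≤ M i * (1/2)^(N+1) := by
          rw [pow_succ]; have : (0:ℝ) < (1/2)^N := by positivity
          nlinarith
        have e6 : (M i:ℝ) * |(p t i).2 - (p t' i).2| ≤ M i * (3 * (|φ t - φ t'|/ℓ i)^r + (1/2)^(N+1)) := by
          linarith
        exact le_of_mul_le_mul_left e6 hMi
      · have := asym t' ht' t ht i ha.symm h
        rw [abs_sub_comm, abs_sub_comm (φ t') (φ t)] at this; linarith
  apply dim_holder (φ := φ) r0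
  · intro t ht
    exact ⟨hI t ht, mem_iInter.2 fun i => (stp t ht i).2.2 (hφ t ht (i+1))⟩
  · intro t ht t' ht'
    have h1 : ∀ N : ℕ, |t - t'| ≤ 3 * |φ t - φ t'|^r + (1/2)^N := by
      intro N
      have := main t ht t' ht' N 0 rfl
      rwa [p0, p0, ℓ0, div_one] at this
    have h2 : Tendsto (fun N : ℕ => 3 * |φ t - φ t'|^r + (1/2:ℝ)^N) atTop (nhds (3 * |φ t - φ t'|^r + 0)) :=
      (tendsto_pow_atTop_nhds_zero_of_lt_one (by norm_num) (by norm_num)).const_add _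
    rw [add_zero] at h2
    exact ge_of_tendsto' h2 h1

lemma cantor {r : ℝ} (r0 : 0 < r) (r1 : r ≤ 1) (U : ℕ → Set ℝ)
    (H : ∀ ℓ : ℝ, 0 < ℓ → ℓ ≤ 1 → ∀ i, ∃ m : ℕ, ∃ ℓ' : ℝ, 2 ≤ m ∧ 0 < ℓ' ∧ ℓ' ≤ 1 ∧
      1 ≤ (m:ℝ) * ℓ'^r ∧ ∀ a, 0 ≤ a → a + ℓ ≤ 1 → ∀ c < m, ∃ a',
        a + (c + 1/3) * ℓ / m ≤ a' ∧ a' + ℓ' ≤ a + (c + 2/3) * ℓ / m ∧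
        Icc a' (a' + ℓ') ⊆ U i) :
    ENNReal.ofReal r ≤ dimH (Icc (0:ℝ) 1 ∩ ⋂ i, U i) := by
  let S := {ℓ : ℝ // 0 < ℓ ∧ ℓ ≤ 1}
  have H' : ∀ ℓ : S, ∀ i, ∃ m : ℕ, ∃ ℓ' : S, 2 ≤ m ∧ 
      1 ≤ (m:ℝ) * (ℓ' : ℝ)^r ∧ ∀ (a : ℝ) (c : ℕ), ∃ a', 0 ≤ a → a + ℓ ≤ 1 → c < m → 
        a + (c + 1/3) * ℓ / m ≤ a' ∧ a' + ℓ' ≤ a + (c + 2/3) * ℓ / m ∧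
        Icc a' (a' + ℓ') ⊆ U i := by
    rintro ⟨ℓ, h0, h1⟩ i
    obtain ⟨m, ℓ', g1, g2, g3, g4, g5⟩ := H ℓ h0 h1 i
    refine ⟨m, ⟨ℓ', g2, g3⟩, g1, g4, fun a c => ?_⟩
    by_cases h : 0 ≤ a ∧ a + ℓ ≤ 1 ∧ c < m
    · obtain ⟨a', ha'⟩ := g5 a h.1 h.2.1 c h.2.2
      exact ⟨a', fun _ _ _ => ha'⟩
    · exact ⟨0, fun x y z => absurd ⟨x, y, z⟩ h⟩
  choose m l' g1 g2 A gA using H'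
  let ℓs : ℕ → S := fun i => Nat.rec ⟨1, one_pos, le_rfl⟩ (fun i s => l' s i) i
  have e : ∀ i, ℓs (i+1) = l' (ℓs i) i := fun i => rfl
  exact cantor_seq r0 r1 U (fun i => (ℓs i).1) (fun i => m (ℓs i) i) (fun i a c => A (ℓs i) i a c) rfl
    (fun i => (ℓs i).2.1) (fun i => (ℓs i).2.2) (fun i => g1 _ _) (fun i => g2 _ _)
    (fun i a h0 h1 c hc => gA (ℓs i) i a c h0 h1 hc)

end MP


namespace MP

lemma dim_lower {β α : ℝ} (hα : 1 ≤ α) {r : ℕ → ℝ}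
    (hr : ∀ j : ℕ, r j = (j:ℝ)^(-α)) {x b t : ℝ} (b1 : 1 ≤ b)
    (hb : ∀ᶠ p : ℕ in atTop, ∀ c : ℕ, c < 2^p → ∃ n : ℕ, p ≤ n ∧ (n:ℝ) ≤ (2:ℝ)^((p:ℝ)*b) ∧
      (T β)^[n] x ∈ Icc ((c:ℝ)/2^p) (((c:ℝ)+1)/2^p)) (t0 : 0 < t) (ht : α * b * t < 1) :
    ENNReal.ofReal t ≤ dimH (hitSet (MannevillePomeau β) x r) := by
  have ab : 1 ≤ α * b := by nlinarith
  have t1 : t ≤ 1 := by nlinarith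
  set U : ℕ → Set ℝ := fun i => {y | ∃ n, i ≤ n ∧ |(T β)^[n] x - y| < r n} with hU
  have sub : Icc (0:ℝ) 1 ∩ ⋂ i, U i ⊆ hitSet (MannevillePomeau β) x r := by
    rintro y ⟨h1, h2⟩
    exact ⟨h1, frequently_atTop.2 fun i => mem_iInter.1 h2 i⟩
  refine le_trans (cantor t0 t1 U ?_) (dimH_mono sub)
  intro ℓ ℓ0 ℓ1 i
  have two : Tendsto (fun p : ℕ => (2:ℝ)^p) atTop atTop :=
    tendsto_pow_atTop_atTop_of_one_lt (by norm_num)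
  have l1 := two.eventually_ge_atTop (18/ℓ)
  have l2 : ∀ᶠ p : ℕ in atTop, 36/ℓ ≤ ((2:ℝ)^(1 - α*b*t))^p :=
    (tendsto_pow_atTop_atTop_of_one_lt
      (Real.one_lt_rpow (by norm_num) (by linarith))).eventually_ge_atTop _
  obtain ⟨p, hp, h18, h36, hpi, hp1⟩ := 
    (hb.and (l1.and (l2.and ((eventually_ge_atTop i).and (eventually_ge_atTop 1))))).exists
  set P : ℝ := 2^p with hP
  have P0 : 0 < P := by positivity
  have hR : (2:ℝ)^(p:ℝ) = P := by rw [hP, Real.rpow_natCast]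
  set Q : ℝ := P^(-(α*b)) with hQ
  have Q0 : 0 < Q := by positivity
  have P1 : 1 ≤ P := one_le_pow₀ (by norm_num)
  have QP : Q ≤ 1/P := by
    rw [one_div, ← Real.rpow_neg_one]
    exact Real.rpow_le_rpow_of_exponent_le P1 (by linarith)
  have h18' : 18 ≤ ℓ * P := by rw [div_le_iff₀ ℓ0] at h18; linarith
  set m := ⌊ℓ * P / 9⌋₊ with hm
  have m1 : (m:ℝ) ≤ ℓ * P / 9 := Nat.floor_le (by positivity)
  have m2 : ℓ * P / 9 < m + 1 := Nat.lt_floor_add_one _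
  have m3 : 2 ≤ m := Nat.le_floor (by push_cast; linarith)
  have m0 : (0:ℝ) < m := by positivity
  have QP1 : 1/P ≤ 1 := by rw [div_le_one P0]; exact P1
  refine ⟨m, Q/2, m3, by positivity, by linarith, ?_, ?_⟩
  · have e1 : ((2:ℝ)^(1 - α*b*t))^p = P * Q^t := by
      rw [hQ, ← Real.rpow_mul P0.le, ← hR, ← Real.rpow_mul (by norm_num), ← Real.rpow_add (by norm_num),
        ← Real.rpow_natCast, ← Real.rpow_mul (by norm_num)]
      congr 1; ring
    rw [e1, div_le_iff₀ ℓ0] at h36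
    have e2 : Q^t/2 ≤ (Q/2)^t := by
      rw [Real.div_rpow Q0.le (by norm_num)]
      have : (2:ℝ)^t ≤ 2 := by
        conv_rhs => rw [← Real.rpow_one 2]
        exact Real.rpow_le_rpow_of_exponent_le (by norm_num) t1
      gcongr
    have e3 : ℓ * P / 18 ≤ m := by linarith
    have e4 : 0 < Q^t := by positivity
    calc (1:ℝ) ≤ ℓ * P / 18 * (Q^t/2) := by nlinarith
      _ ≤ _ := mul_le_mul e3 e2 (by positivity) m0.le
  · intro a a0 a1 c hc
    set X : ℝ := a + (c + 1/3) * ℓ / m with hX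
    have X0 : 0 ≤ X := by positivity
    have XR : X + 3/P ≤ a + (c + 2/3) * ℓ / m := by
      have : 3/P ≤ (1/3) * ℓ / m := by
        rw [div_le_div_iff₀ P0 m0]; linarith
      have e : (c + 2/3) * ℓ / m = (c + 1/3) * ℓ / m + (1/3) * ℓ / m := by ring
      rw [e]; linarith
    have XR1 : a + (c + 2/3) * ℓ / m ≤ 1 := by
      have hc' : (c:ℝ) + 1 ≤ m := by exact_mod_cast hc
      have : (c + 2/3) * ℓ / m ≤ ℓ := by rw [div_le_iff₀ m0]; nlinarith
      linarith
    set g := ⌈X * P⌉₊ with hg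
    have g1 : X * P ≤ g := Nat.le_ceil _
    have g2 : (g:ℝ) < X * P + 1 := Nat.ceil_lt_add_one (by positivity)
    have g3 : g < 2^p := by
      have h3 : (X + 3/P) * P ≤ 1 * P := mul_le_mul_of_nonneg_right (XR.trans XR1) P0.le
      have h4 : (X + 3/P) * P = X * P + 3 := by field_simp
      have : (g:ℝ) < P := by linarith
      rw [hP] at this
      exact_mod_cast this
    obtain ⟨n, n1, n2, n3, n4⟩ := hp g g3
    have z1 : X ≤ (T β)^[n] x := by
      refine le_trans ?_ n3
      rw [le_div_iff₀ P0]; exact g1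
    have z2 : (T β)^[n] x ≤ X + 2/P := by
      refine n4.trans ?_
      rw [div_le_iff₀ P0]
      have : (X + 2/P) * P = X * P + 2 := by field_simp
      linarith
    refine ⟨(T β)^[n] x, z1, ?_, ?_⟩
    · have : (3:ℝ)/P = 2/P + 1/P := by ring
      linarith
    · intro y hy
      refine ⟨n, hpi.trans n1, ?_⟩
      have n0 : (0:ℝ) < n := by exact_mod_cast (hp1.trans n1)
      have : Q ≤ r n := by
        rw [hr]
        refine le_trans (le_of_eq ?_) (Real.rpow_le_rpow_of_nonpos n0 n2 (show -α ≤ 0 by linarith))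
        rw [hQ, ← hR, ← Real.rpow_mul (by norm_num), ← Real.rpow_mul (by norm_num)]
        congr 1; ring
      rw [abs_lt]
      constructor <;> linarith [hy.1, hy.2]

end MP

theorem stmt_6
    (β : ℝ) (hβ : 2 ≤ β)
    (α : ℝ) (hα : 1 ≤ α)
    (r : ℕ → ℝ) (hr : ∀ j : ℕ, r j = (j : ℝ) ^ (-α)) :
    ∀ᵐ x ∂(volume : Measure ℝ), x ∈ Set.Ico (0:ℝ) 1 →
      dimH (hitSet (MannevillePomeau β) x r) = ENNReal.ofReal (1 / (α * (β - 1))) := by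
  have hβ1 : 1 ≤ β - 1 := by linarith
  have hβ0 : 0 < β - 1 := by linarith
  have α0 : 0 < α := by linarith
  have hL : ∀ᵐ x ∂(volume : Measure ℝ), ∀ k : ℕ, x ∈ MP.Good β →
      ∀ᶠ j : ℕ in atTop, (j:ℝ)^((β-1) * (1 - 1/((k:ℝ)+2))) ≤ MP.nn β x j := by
    rw [ae_all_iff]
    intro k
    have h1 : (0:ℝ) < 1/((k:ℝ)+2) := by positivity
    have h2 : 1/((k:ℝ)+2) < 1 := by
      rw [div_lt_one (by positivity)]; have : (0:ℝ) ≤ k := by positivity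
      linarith
    exact MP.nn_lower hβ (by apply mul_pos hβ0; linarith) (by nlinarith)
  have hU : ∀ᵐ x ∂(volume : Measure ℝ), ∀ k : ℕ, x ∈ MP.Good β →
      ∀ᶠ p : ℕ in atTop, ∀ c : ℕ, c < 2^p → ∃ n : ℕ, p ≤ n ∧
        (n:ℝ) ≤ (2:ℝ)^((p:ℝ)*((β-1) * (1 + 1/((k:ℝ)+1)))) ∧
        (MP.T β)^[n] x ∈ Icc ((c:ℝ)/2^p) (((c:ℝ)+1)/2^p) := by
    rw [ae_all_iff]
    intro k
    have h1 : (0:ℝ) < 1/((k:ℝ)+1) := by positivity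
    exact MP.T_hits hβ (by nlinarith)
  filter_upwards [hL, hU, MP.ae_Good hβ] with x h1 h2 h3 hx
  have hg := h3 hx
  set D : ℝ := 1/(α*(β-1)) with hD
  have D0 : 0 < D := by positivity
  have hDe : α * (β-1) * D = 1 := by rw [hD]; field_simp
  apply le_antisymm
  · have lim : Tendsto (fun s : ℝ => ENNReal.ofReal (D * s)) (nhdsWithin 1 (Ioi 1)) (nhds (ENNReal.ofReal (D * 1))) :=
      ((ENNReal.continuous_ofReal.comp (continuous_const.mul continuous_id)).tendsto 1).mono_left
        nhdsWithin_le_nhds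
    rw [mul_one] at lim
    refine ge_of_tendsto lim ?_
    filter_upwards [self_mem_nhdsWithin] with s hs
    have hs : 1 < s := hs
    obtain ⟨k, hk⟩ := exists_nat_gt (s/(s-1))
    have sp : 0 < s - 1 := by linarith
    rw [div_lt_iff₀ sp] at hk
    have q0 : (0:ℝ) < (k:ℝ)+2 := by positivity
    have q2 : 1/((k:ℝ)+2) < 1 := by
      rw [div_lt_one (by positivity)]; have : (0:ℝ) ≤ k := by positivity
      linarith
    refine MP.dim_upper hβ hα hr hg (by apply mul_pos hβ0; linarith) (h1 k hg) (by positivity) ?_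
    have e : α * ((β-1) * (1 - 1/((k:ℝ)+2))) * (D * s) = (α * (β-1) * D) * ((1 - 1/((k:ℝ)+2)) * s) := by ring
    rw [e, hDe, one_mul]
    have e2 : (1 - 1/((k:ℝ)+2)) * s = s - s/((k:ℝ)+2) := by ring
    rw [e2]
    have : s/((k:ℝ)+2) < s - 1 := by rw [div_lt_iff₀ q0]; nlinarith
    linarith
  · have lim : Tendsto (fun s : ℝ => ENNReal.ofReal (D * s)) (nhdsWithin 1 (Iio 1)) (nhds (ENNReal.ofReal (D * 1))) :=
      ((ENNReal.continuous_ofReal.comp (continuous_const.mul continuous_id)).tendsto 1).mono_left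
        nhdsWithin_le_nhds
    rw [mul_one] at lim
    refine le_of_tendsto lim ?_
    filter_upwards [Ioo_mem_nhdsLT (show (0:ℝ) < 1 by norm_num)] with s hs
    obtain ⟨s0, s1⟩ := hs
    obtain ⟨k, hk⟩ := exists_nat_gt (s/(1-s))
    have sp : 0 < 1 - s := by linarith
    rw [div_lt_iff₀ sp] at hk
    have q0 : (0:ℝ) < (k:ℝ)+1 := by positivity
    have q1 : 0 < 1/((k:ℝ)+1) := by positivity
    refine MP.dim_lower hα hr (by nlinarith) (h2 k hg) (by positivity) ?_
    have e : α * ((β-1) * (1 + 1/((k:ℝ)+1))) * (D * s) = (α * (β-1) * D) * ((1 + 1/((k:ℝ)+1)) * s) := by ring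
    rw [e, hDe, one_mul]
    have e2 : (1 + 1/((k:ℝ)+1)) * s = s + s/((k:ℝ)+1) := by ring
    rw [e2]
    have : s/((k:ℝ)+1) < 1 - s := by rw [div_lt_iff₀ q0]; nlinarith
    linarith
end

section
/- Let E_n be open subsets of [0,1] and let μ_n be Borel probability measures with support contained in E_n which converge weakly to a measure μ that is absolutely continuous with respect to Lebesgue measure with density bounded and bounded away from zero. Let 0 < s and suppose there exists a constant C such that ∬ |x−y|^{−s} dμ_n(x) dμ_n(y) < C for all n. Then the set limsup_{n→∞} E_n has Hausdorff dimension at least s. -/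
open MeasureTheory Filter Set

noncomputable def ker8 (t x y : ℝ) : ENNReal := (ENNReal.ofReal |x - y|) ^ (-t)

noncomputable def pot8 (t : ℝ) (a : Measure ℝ) (x : ℝ) : ENNReal := ∫⁻ y, ker8 t x y ∂a

lemma ker8_comm (t x y : ℝ) : ker8 t x y = ker8 t y x := by
  unfold ker8; rw [abs_sub_comm]

lemma ker8_cont (t : ℝ) : Continuous (fun p : ℝ × ℝ => ker8 t p.1 p.2) := by
  unfold ker8
  exact ENNReal.continuous_rpow_const.comp (ENNReal.continuous_ofReal.comp (by fun_prop))

lemma ker8_meas (t x : ℝ) : Measurable (fun y => ker8 t x y) :=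
  ((ker8_cont t).comp (by fun_prop : Continuous fun y : ℝ => (x, y))).measurable

lemma pot8_meas (t : ℝ) (a : Measure ℝ) [SFinite a] : Measurable (pot8 t a) :=
  Measurable.lintegral_prod_right' (f := fun p : ℝ × ℝ => ker8 t p.1 p.2) (ker8_cont t).measurable

lemma ker8_le {t : ℝ} (ht : 0 < t) {x y x' y' c : ℝ} (hc : 0 < c) (h : |x - y| ≤ c * |x' - y'|) :
    ker8 t x' y' ≤ ENNReal.ofReal (c ^ t) * ker8 t x y := by
  unfold ker8
  have h1 : ENNReal.ofReal |x - y| ≤ ENNReal.ofReal c * ENNReal.ofReal |x' - y'| := by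
    rw [← ENNReal.ofReal_mul hc.le]; exact ENNReal.ofReal_le_ofReal h
  have h2 : (ENNReal.ofReal c * ENNReal.ofReal |x' - y'|) ^ (-t) ≤ (ENNReal.ofReal |x - y|) ^ (-t) := by
    rw [ENNReal.rpow_neg, ENNReal.rpow_neg]
    exact ENNReal.inv_le_inv.2 (ENNReal.rpow_le_rpow h1 ht.le)
  have h3 : ENNReal.ofReal (c ^ t) * (ENNReal.ofReal c * ENNReal.ofReal |x' - y'|) ^ (-t)
      = (ENNReal.ofReal |x' - y'|) ^ (-t) := by
    rw [← ENNReal.ofReal_rpow_of_pos hc]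
    have hc0 : ENNReal.ofReal c ≠ 0 := by simpa using hc
    rw [ENNReal.mul_rpow_of_ne_top ENNReal.ofReal_ne_top ENNReal.ofReal_ne_top, ← mul_assoc,
      ← ENNReal.rpow_add _ _ hc0 ENNReal.ofReal_ne_top]
    simp
  rw [← h3]
  gcongr

lemma pot8_closed (t : ℝ) (a : Measure ℝ) (c : ENNReal) : IsClosed {x | pot8 t a x ≤ c} := by
  apply IsSeqClosed.isClosed
  intro u x hu hx
  have h1 : ∀ y, liminf (fun n => ker8 t (u n) y) atTop = ker8 t x y := fun y => by
    apply Tendsto.liminf_eq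
    exact (((ker8_cont t).comp (by fun_prop : Continuous fun z : ℝ => (z, y))).tendsto x).comp hx
  show pot8 t a x ≤ c
  calc pot8 t a x = ∫⁻ y, liminf (fun n => ker8 t (u n) y) atTop ∂a := by
        unfold pot8; simp_rw [h1]
    _ ≤ liminf (fun n => pot8 t a (u n)) atTop := lintegral_liminf_le (fun n => ker8_meas t (u n))
    _ ≤ c := liminf_le_of_le (by isBoundedDefault) (fun b hb => by
        obtain ⟨n, hn⟩ := hb.exists
        exact hn.trans (hu n))

lemma pot8_max {t : ℝ} (ht : 0 < t) (ν : Measure ℝ) (G : Set ℝ) (hG : ν Gᶜ = 0) (hne : G.Nonempty)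
    (M : ENNReal) (hM : ∀ z ∈ G, pot8 t ν z ≤ M) (y : ℝ) :
    pot8 t ν y ≤ ENNReal.ofReal (3 ^ t) * M := by
  by_cases hy : y ∈ closure G
  · have : y ∈ {x | pot8 t ν x ≤ M} :=
      closure_minimal (fun z hz => hM z hz) (pot8_closed t ν M) hy
    refine le_trans this ?_
    have : (1 : ENNReal) ≤ ENNReal.ofReal (3 ^ t) := by
      rw [ENNReal.one_le_ofReal]; exact Real.one_le_rpow (by norm_num) ht.le
    calc M = 1 * M := by simp
      _ ≤ _ := by gcongr
  · have hd : 0 < Metric.infDist y G := by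
      exact (Metric.infDist_pos_iff_notMem_closure hne).1 hy
    obtain ⟨z, hz, hzd⟩ := (Metric.infDist_lt_iff (r := 2 * Metric.infDist y G) hne).1 (by linarith)
    have hae : ∀ᵐ w ∂ν, w ∈ G := by
      rw [ae_iff]; exact hG
    calc pot8 t ν y ≤ ∫⁻ w, ENNReal.ofReal (3 ^ t) * ker8 t z w ∂ν := by
          apply lintegral_mono_ae
          filter_upwards [hae] with w hw
          apply ker8_le ht (by norm_num)
          have h1 := Metric.infDist_le_dist_of_mem (x := y) hw
          have h2 : |z - w| ≤ |z - y| + |y - w| := abs_sub_le z y w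
          rw [Real.dist_eq] at hzd h1
          rw [abs_sub_comm z y] at h2
          linarith
      _ = ENNReal.ofReal (3 ^ t) * pot8 t ν z := lintegral_const_mul _ (ker8_meas t z)
      _ ≤ _ := by gcongr; exact hM z hz

/-- Lebesgue potential bound -/
lemma leb8 {t : ℝ} (ht1 : t < 1) (x R : ℝ) (hR : 0 < R) :
    ∫⁻ y in Metric.ball x R, ker8 t x y = ENNReal.ofReal (2 * R ^ (1 - t) / (1 - t)) := by
  have hI : ∫⁻ y in Ioo 0 R, ENNReal.ofReal (y ^ (-t)) = ENNReal.ofReal (R ^ (1 - t) / (1 - t)) := by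
    rw [← ofReal_integral_eq_lintegral_ofReal]
    · rw [← integral_Ioc_eq_integral_Ioo, ← intervalIntegral.integral_of_le hR.le, integral_rpow]
      · congr 1
        rw [Real.zero_rpow (by linarith)]
        rw [show -t + 1 = 1 - t by ring]; simp
      · left; linarith
    · exact (intervalIntegral.integrableOn_Ioo_rpow_iff hR).2 (by linarith)
    · filter_upwards [ae_restrict_mem measurableSet_Ioo] with y hy
      exact Real.rpow_nonneg hy.1.le _
  have hpos : ∫⁻ y in Ioo x (x + R), ker8 t x y = ENNReal.ofReal (R ^ (1 - t) / (1 - t)) := by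
    rw [← hI]
    have := (measurePreserving_add_left (volume : Measure ℝ) x).setLIntegral_comp_preimage
      (measurableSet_Ioo (a := x) (b := x + R)) (ker8_meas t x)
    rw [← this]
    simp only [preimage_const_add_Ioo, sub_self, add_sub_cancel_left]
    apply setLIntegral_congr_fun measurableSet_Ioo
    intro y hy
    simp only [ker8]
    rw [show |x - (x + y)| = y by rw [show x - (x+y) = -y by ring, abs_neg, abs_of_pos hy.1],
      ENNReal.ofReal_rpow_of_pos hy.1]
  have hneg : ∫⁻ y in Ioo (x - R) x, ker8 t x y = ENNReal.ofReal (R ^ (1 - t) / (1 - t)) := by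
    rw [← hI]
    have := (Measure.measurePreserving_sub_left (volume : Measure ℝ) x).setLIntegral_comp_preimage
      (measurableSet_Ioo (a := x - R) (b := x)) (ker8_meas t x)
    rw [← this]
    simp only [preimage_const_sub_Ioo, sub_self, sub_sub_cancel]
    apply setLIntegral_congr_fun measurableSet_Ioo
    intro y hy
    simp only [ker8]
    rw [show |x - (x - y)| = y by rw [show x - (x-y) = y by ring, abs_of_pos hy.1],
      ENNReal.ofReal_rpow_of_pos hy.1]
  rw [Real.ball_eq_Ioo, ← Ioc_union_Ioo_eq_Ioo (b := x) (by linarith) (by linarith),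
    lintegral_union measurableSet_Ioo, setLIntegral_congr Ioo_ae_eq_Ioc.symm, hpos, hneg,
    ← ENNReal.ofReal_add]
  · congr 1; ring
  · exact div_nonneg (Real.rpow_nonneg hR.le _) (by linarith)
  · exact div_nonneg (Real.rpow_nonneg hR.le _) (by linarith)
  · rw [Set.disjoint_left]; intro y hy hy'; exact absurd hy.2 (not_le.2 hy'.1)

lemma pick8 {t : ℝ} (ht : 0 < t) (m : Measure ℝ) [IsFiniteMeasure m] (B E : Set ℝ)
    (hB : MeasurableSet B) (hEm : MeasurableSet E) (hE : m Eᶜ = 0) (α β : ℝ) (hα : 0 < α)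
    (hβ : 0 < β) (hmass : ENNReal.ofReal α ≤ m B)
    (hen : ∫⁻ u in B, ∫⁻ v in B, ker8 t u v ∂m ∂m ≤ ENNReal.ofReal β)
    (b : Measure ℝ) [IsFiniteMeasure b] :
    ∃ x ∈ E ∩ B, pot8 t b x ≤ ENNReal.ofReal (3 ^ t * (4 * β / α ^ 2)) * b univ := by
  set V : ℝ → ENNReal := pot8 t (m.restrict B) with hV
  have hVm : Measurable V := pot8_meas t _
  set M : ℝ := 2 * β / α with hM
  have hMpos : 0 < M := by positivity
  set G : Set ℝ := {z | V z < ENNReal.ofReal M} ∩ (E ∩ B) with hG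
  have hGm : MeasurableSet G := (measurableSet_lt hVm measurable_const).inter (hEm.inter hB)
  have hmark : m ({z | ENNReal.ofReal M ≤ V z} ∩ B) ≤ ENNReal.ofReal (α / 2) := by
    have h1 := mul_meas_ge_le_lintegral (μ := m.restrict B) hVm (ENNReal.ofReal M)
    rw [Measure.restrict_apply (measurableSet_le measurable_const hVm)] at h1
    have h2 := h1.trans hen
    have h3 : ENNReal.ofReal (α / 2) = ENNReal.ofReal β / ENNReal.ofReal M := by
      rw [← ENNReal.ofReal_div_of_pos hMpos]; congr 1; rw [hM]; field_simp
    rw [h3, ENNReal.le_div_iff_mul_le (by left; simpa using hMpos) (by left; exact ENNReal.ofReal_ne_top),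
      mul_comm]
    exact h2
  have hGmass : ENNReal.ofReal (α / 2) ≤ m G := by
    have h1 : m B ≤ m G + ENNReal.ofReal (α / 2) := by
      calc m B ≤ m (G ∪ (({z | ENNReal.ofReal M ≤ V z} ∩ B) ∪ Eᶜ)) := by
            apply measure_mono
            intro z hz
            by_cases h1 : z ∈ E
            · by_cases h2 : V z < ENNReal.ofReal M
              · left; exact ⟨h2, h1, hz⟩
              · right; left; exact ⟨not_lt.1 h2, hz⟩
            · right; right; exact h1
        _ ≤ m G + (m ({z | ENNReal.ofReal M ≤ V z} ∩ B) + m Eᶜ) :=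
            (measure_union_le _ _).trans (by gcongr; exact measure_union_le _ _)
        _ ≤ _ := by rw [hE, add_zero]; gcongr
    have h2 : ENNReal.ofReal (α / 2) + ENNReal.ofReal (α / 2) ≤ m G + ENNReal.ofReal (α / 2) := by
      rw [← ENNReal.ofReal_add (by positivity) (by positivity)]
      simpa using hmass.trans h1
    exact (ENNReal.add_le_add_iff_right ENNReal.ofReal_ne_top).1 h2
  have hG0 : m G ≠ 0 := by
    intro h; rw [h] at hGmass; simp at hGmass; linarith
  have hGne : G.Nonempty := nonempty_of_measure_ne_zero hG0
  have hpot : ∀ y, pot8 t (m.restrict G) y ≤ ENNReal.ofReal (3 ^ t) * ENNReal.ofReal M := by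
    apply pot8_max ht _ G _ hGne
    · intro z hz
      refine le_trans ?_ hz.1.le
      exact lintegral_mono' (Measure.restrict_mono (fun w hw => hw.2.2) le_rfl) le_rfl
    · rw [Measure.restrict_apply hGm.compl]; simp
  have hswap : ∫⁻ x in G, pot8 t b x ∂m ≤ ENNReal.ofReal (3 ^ t) * ENNReal.ofReal M * b univ := by
    unfold pot8
    rw [lintegral_lintegral_swap (ker8_cont t).measurable.aemeasurable]
    calc ∫⁻ y, ∫⁻ x, ker8 t x y ∂(m.restrict G) ∂b = ∫⁻ y, pot8 t (m.restrict G) y ∂b := by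
          unfold pot8
          apply lintegral_congr; intro y; apply lintegral_congr; intro x; exact ker8_comm _ _ _
      _ ≤ ∫⁻ y, ENNReal.ofReal (3 ^ t) * ENNReal.ofReal M ∂b := lintegral_mono hpot
      _ = _ := by rw [lintegral_const]
  obtain ⟨x, hxG, hx⟩ := exists_le_setLAverage (μ := m) (s := G) (f := pot8 t b) hG0
    (measure_ne_top _ _) (pot8_meas t b).aemeasurable
  refine ⟨x, hxG.2, hx.trans ?_⟩
  rw [setLAverage_eq]
  apply ENNReal.div_le_of_le_mul
  refine hswap.trans ?_
  calc _ = ENNReal.ofReal (3 ^ t * (4 * β / α ^ 2)) * b univ * ENNReal.ofReal (α / 2) := by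
        rw [mul_right_comm _ (b univ), ← ENNReal.ofReal_mul (by positivity), ← ENNReal.ofReal_mul (by positivity)]
        congr 2; rw [hM]; field_simp; ring
    _ ≤ _ := by gcongr

lemma split8 {s t ρ : ℝ} (ht : 0 < t) (hts : t < s) (hρ : 0 < ρ) (u v : ℝ) :
    ker8 t u v ≤ min (ker8 t u v) (ENNReal.ofReal (ρ ^ (-t))) +
      ENNReal.ofReal (ρ ^ (s - t)) * ker8 s u v := by
  rcases le_or_gt ρ |u - v| with h | h
  · have : ker8 t u v ≤ ENNReal.ofReal (ρ ^ (-t)) := by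
      unfold ker8
      rw [ENNReal.ofReal_rpow_of_pos (hρ.trans_le h)]
      exact ENNReal.ofReal_le_ofReal (Real.rpow_le_rpow_of_nonpos hρ h (by linarith))
    rw [min_eq_left this]; exact le_self_add
  · refine le_trans ?_ le_add_self
    unfold ker8
    rcases eq_or_ne (ENNReal.ofReal |u - v|) 0 with h0 | h0
    · rw [h0, ENNReal.zero_rpow_of_neg (by linarith), ENNReal.zero_rpow_of_neg (by linarith),
        ENNReal.mul_top]
      have := Real.rpow_pos_of_pos hρ (s - t)
      simpa using this
    · rw [show -t = (s - t) + (-s) by ring, ENNReal.rpow_add _ _ h0 ENNReal.ofReal_ne_top,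
        ← ENNReal.ofReal_rpow_of_pos hρ]
      gcongr

lemma energy8 {s t : ℝ} (ht : 0 < t) (hts : t < s) (ht1 : t < 1) (P : ℕ → ProbabilityMeasure ℝ)
    (Q : ProbabilityMeasure ℝ) (hPQ : Tendsto P atTop (nhds Q)) (c₂ : ℝ) (hc₂ : 0 < c₂)
    (hup : (Q : Measure ℝ) ≤ ENNReal.ofReal c₂ • volume) (C : ℝ)
    (hen : ∀ n, ∫⁻ x, ∫⁻ y, ker8 s x y ∂(P n : Measure ℝ) ∂(P n : Measure ℝ) ≤ ENNReal.ofReal C) :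
    ∃ A : ℝ, 0 < A ∧ ∀ x r : ℝ, 0 < r → ∀ᶠ n in atTop,
      ∫⁻ u in Metric.ball x r, ∫⁻ v in Metric.ball x r, ker8 t u v ∂(P n : Measure ℝ)
        ∂(P n : Measure ℝ) ≤ ENNReal.ofReal (A * r ^ (2 - t)) := by
  set A₀ : ℝ := c₂ * (2 * 4 ^ (1 - t) / (1 - t)) * c₂ * 4 with hA₀
  have h1t : 0 < 1 - t := by linarith
  have hA₀p : 0 < A₀ := by positivity
  refine ⟨A₀ + 1 + 1, by positivity, fun x r hr => ?_⟩
  have hr2 : 0 < r ^ (2 - t) := Real.rpow_pos_of_pos hr _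
  obtain ⟨ρ, hρ, hρC⟩ : ∃ ρ : ℝ, 0 < ρ ∧ ρ ^ (s - t) * C ≤ r ^ (2 - t) := by
    have hq : 0 < r ^ (2 - t) / max C 1 := by positivity
    refine ⟨(r ^ (2 - t) / max C 1) ^ (1 / (s - t)), by positivity, ?_⟩
    rw [← Real.rpow_mul hq.le, one_div_mul_cancel (by linarith), Real.rpow_one, div_mul_eq_mul_div,
      div_le_iff₀ (by positivity)]
    gcongr
    exact le_max_left _ _
  set κ : ENNReal := ENNReal.ofReal (ρ ^ (-t)) with hκ
  have hκt : κ ≠ ⊤ := ENNReal.ofReal_ne_top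
  set φ : ℝ → NNReal := fun y => Real.toNNReal (min 1 (2 - |y - x| / r)) with hφ
  have hφc : Continuous φ := by
    apply continuous_real_toNNReal.comp
    fun_prop
  have hφ1 : ∀ y, φ y ≤ 1 := fun y => by
    simp only [hφ, Real.toNNReal_le_one]; exact min_le_left _ _
  have hφB : ∀ y ∈ Metric.ball x r, φ y = 1 := fun y hy => by
    rw [Metric.mem_ball, Real.dist_eq] at hy
    have : |y - x| / r ≤ 1 := by rw [div_le_one hr]; exact hy.le
    simp only [hφ]; rw [min_eq_left (by linarith)]; simp
  have hφ0 : ∀ y, y ∉ Metric.ball x (2 * r) → φ y = 0 := fun y hy => by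
    rw [Metric.mem_ball, Real.dist_eq, not_lt] at hy
    have : 2 ≤ |y - x| / r := by rw [le_div_iff₀ hr]; exact hy
    simp only [hφ]; rw [Real.toNNReal_eq_zero]; exact (min_le_right _ _).trans (by linarith)
  set km : ℝ × ℝ → ENNReal := fun p => min (ker8 t p.1 p.2) κ with hkm
  have hkmt : ∀ p, km p ≠ ⊤ := fun p => ne_top_of_le_ne_top hκt (min_le_right _ _)
  have hkmc : Continuous km := (ker8_cont t).min continuous_const
  set f : ℝ × ℝ → NNReal := fun p => φ p.1 * φ p.2 * (km p).toNNReal with hf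
  have hfc : Continuous f := by
    refine ((hφc.comp continuous_fst).mul (hφc.comp continuous_snd)).mul ?_
    exact ENNReal.continuousOn_toNNReal.comp_continuous hkmc hkmt
  have hfb : ∀ p, f p ≤ κ.toNNReal := fun p => by
    have h3 : (km p).toNNReal ≤ κ.toNNReal := ENNReal.toNNReal_mono hκt (min_le_right _ _)
    calc f p ≤ 1 * 1 * κ.toNNReal := by
          simp only [hf]; gcongr <;> apply hφ1
      _ = _ := by simp
  let F : BoundedContinuousFunction (ℝ × ℝ) NNReal :=
    BoundedContinuousFunction.mkOfBound ⟨f, hfc⟩ κ.toNNReal (fun p q => by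
      rw [NNReal.dist_eq]
      have h1 : ((f p : NNReal) : ℝ) ≤ κ.toNNReal := by exact_mod_cast hfb p
      have h2 : ((f q : NNReal) : ℝ) ≤ κ.toNNReal := by exact_mod_cast hfb q
      have h3 := (f p).coe_nonneg
      have h4 := (f q).coe_nonneg
      exact abs_sub_le_iff.2 ⟨by simp only [ContinuousMap.coe_mk]; linarith, by simp only [ContinuousMap.coe_mk]; linarith⟩)
  have hlim : Tendsto (fun n => (P n).prod (P n)) atTop (nhds (Q.prod Q)) :=
    (ProbabilityMeasure.continuous_prod.tendsto (Q, Q)).comp (hPQ.prodMk_nhds hPQ)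
  have hlimF := (ProbabilityMeasure.tendsto_iff_forall_lintegral_tendsto.1 hlim) F
  have hfcoe : ∀ p, ((f p : NNReal) : ENNReal) = φ p.1 * φ p.2 * km p := fun p => by
    simp only [hf, ENNReal.coe_mul, ENNReal.coe_toNNReal (hkmt p)]
  have hQF : ∫⁻ p, (F p : ENNReal) ∂((Q.prod Q : ProbabilityMeasure (ℝ × ℝ)) : Measure (ℝ × ℝ))
      < ENNReal.ofReal ((A₀ + 1) * r ^ (2 - t)) := by
    have h1 : ∫⁻ p, (F p : ENNReal) ∂((Q.prod Q : ProbabilityMeasure (ℝ × ℝ)) : Measure (ℝ × ℝ))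
        ≤ ENNReal.ofReal (A₀ * r ^ (2 - t)) := by
      rw [ProbabilityMeasure.toMeasure_prod, lintegral_prod _ (by
        exact (ENNReal.continuous_coe.comp hfc).measurable.aemeasurable)]
      set D : ENNReal := ENNReal.ofReal (2 * (4 * r) ^ (1 - t) / (1 - t)) with hD
      calc ∫⁻ u, ∫⁻ v, (F (u, v) : ENNReal) ∂(Q : Measure ℝ) ∂(Q : Measure ℝ)
          ≤ ∫⁻ u, (Metric.ball x (2 * r)).indicator (fun _ => ENNReal.ofReal c₂ * D) u ∂(Q : Measure ℝ) := by
            apply lintegral_mono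
            intro u
            by_cases hu : u ∈ Metric.ball x (2 * r)
            · rw [indicator_of_mem hu]
              calc ∫⁻ v, (F (u, v) : ENNReal) ∂(Q : Measure ℝ)
                  ≤ ∫⁻ v, (Metric.ball u (4 * r)).indicator (fun v => ker8 t u v) v ∂(Q : Measure ℝ) := by
                    apply lintegral_mono
                    intro v
                    show ((f (u, v) : NNReal) : ENNReal) ≤ _
                    rw [hfcoe]
                    by_cases hv : v ∈ Metric.ball x (2 * r)
                    · have hv' : v ∈ Metric.ball u (4 * r) := by
                        rw [Metric.mem_ball] at *
                        have := dist_triangle_right v u x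
                        linarith
                      rw [indicator_of_mem hv']
                      calc (φ u : ENNReal) * φ v * km (u, v) ≤ 1 * 1 * ker8 t u v := by
                            gcongr
                            · exact_mod_cast hφ1 u
                            · exact_mod_cast hφ1 v
                            · exact min_le_left _ _
                        _ = _ := by simp
                    · simp [hφ0 v hv]
                _ = ∫⁻ v in Metric.ball u (4 * r), ker8 t u v ∂(Q : Measure ℝ) :=
                    lintegral_indicator Metric.isOpen_ball.measurableSet _
                _ ≤ ∫⁻ v in Metric.ball u (4 * r), ker8 t u v ∂(ENNReal.ofReal c₂ • volume) :=
                    lintegral_mono' (Measure.restrict_mono le_rfl hup) le_rfl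
                _ = ENNReal.ofReal c₂ * D := by
                    rw [Measure.restrict_smul, lintegral_smul_measure, leb8 ht1 u _ (by positivity)]
                    rfl
            · have : ∀ v, (F (u, v) : ENNReal) = 0 := fun v => by
                show ((f (u, v) : NNReal) : ENNReal) = 0
                rw [hfcoe]; simp [hφ0 u hu]
              simp [this]
        _ = ENNReal.ofReal c₂ * D * (Q : Measure ℝ) (Metric.ball x (2 * r)) := by
            rw [lintegral_indicator Metric.isOpen_ball.measurableSet, lintegral_const]; simp
        _ ≤ ENNReal.ofReal c₂ * D * (ENNReal.ofReal c₂ * ENNReal.ofReal (2 * (2 * r))) := by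
            gcongr
            refine (hup _).trans ?_
            simp [Real.volume_ball]
        _ = ENNReal.ofReal (A₀ * r ^ (2 - t)) := by
            rw [hD, ← ENNReal.ofReal_mul (by positivity), ← ENNReal.ofReal_mul (by positivity),
              ← ENNReal.ofReal_mul (by positivity)]
            congr 1
            rw [Real.mul_rpow (by norm_num) hr.le, show (2 - t) = (1 - t) + 1 by ring,
              Real.rpow_add_one hr.ne', hA₀]
            ring
    refine h1.trans_lt ?_
    rw [ENNReal.ofReal_lt_ofReal_iff (by positivity)]
    nlinarith
  filter_upwards [hlimF.eventually_lt_const hQF] with n hn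
  rw [ProbabilityMeasure.toMeasure_prod, lintegral_prod _ (by
        exact (ENNReal.continuous_coe.comp hfc).measurable.aemeasurable)] at hn
  have hB : MeasurableSet (Metric.ball x r) := Metric.isOpen_ball.measurableSet
  calc ∫⁻ u in Metric.ball x r, ∫⁻ v in Metric.ball x r, ker8 t u v ∂(P n : Measure ℝ)
        ∂(P n : Measure ℝ)
      ≤ ∫⁻ u in Metric.ball x r, ∫⁻ v in Metric.ball x r, ((F (u, v) : ENNReal) +
          ENNReal.ofReal (ρ ^ (s - t)) * ker8 s u v) ∂(P n : Measure ℝ)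
        ∂(P n : Measure ℝ) := by
        apply setLIntegral_mono' hB
        intro u hu
        apply setLIntegral_mono' hB
        intro v hv
        have : (F (u, v) : ENNReal) = min (ker8 t u v) κ := by
          show ((f (u, v) : NNReal) : ENNReal) = _
          rw [hfcoe]; simp [hφB u hu, hφB v hv, hkm]
        rw [this]
        exact split8 ht hts hρ u v
    _ ≤ ∫⁻ u, ∫⁻ v, ((F (u, v) : ENNReal) +
          ENNReal.ofReal (ρ ^ (s - t)) * ker8 s u v) ∂(P n : Measure ℝ) ∂(P n : Measure ℝ) :=
        lintegral_mono' Measure.restrict_le_self (fun u =>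
          lintegral_mono' Measure.restrict_le_self le_rfl)
    _ = ∫⁻ u, (∫⁻ v, (F (u, v) : ENNReal) ∂(P n : Measure ℝ)) +
          ENNReal.ofReal (ρ ^ (s - t)) * (∫⁻ v, ker8 s u v ∂(P n : Measure ℝ)) ∂(P n : Measure ℝ) := by
        apply lintegral_congr; intro u
        rw [lintegral_add_right _ ((ker8_meas s u).const_mul _), lintegral_const_mul _ (ker8_meas s u)]
    _ = (∫⁻ u, ∫⁻ v, (F (u, v) : ENNReal) ∂(P n : Measure ℝ) ∂(P n : Measure ℝ)) +
          ENNReal.ofReal (ρ ^ (s - t)) * ∫⁻ u, (∫⁻ v, ker8 s u v ∂(P n : Measure ℝ)) ∂(P n : Measure ℝ) := by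
        have := pot8_meas s (P n : Measure ℝ)
        unfold pot8 at this
        rw [lintegral_add_right _ (this.const_mul _), lintegral_const_mul _ this]
    _ ≤ ENNReal.ofReal ((A₀ + 1) * r ^ (2 - t)) + ENNReal.ofReal (r ^ (2 - t)) := by
        gcongr
        refine (mul_le_mul_right (hen n) _).trans ?_
        rw [← ENNReal.ofReal_mul (by positivity)]
        exact ENNReal.ofReal_le_ofReal hρC
    _ = _ := by
        rw [← ENNReal.ofReal_add (by positivity) (by positivity)]; congr 1; ring

lemma dens8 {t : ℝ} (ht : 0 < t) (K : ℝ) (hK : 0 ≤ K) (a : Measure ℝ) [IsFiniteMeasure a] (U : Set ℝ)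
    (hloc : ∀ x r : ℝ, 0 < r → Metric.ball x r ⊆ Icc 0 1 → ∀ b : Measure ℝ, IsFiniteMeasure b →
      ∃ x' ∈ U ∩ Metric.ball x r, pot8 t b x' ≤ ENNReal.ofReal (K * r ^ (-t)) * b univ)
    (x : ℝ) (hx : x ∈ Ioo (0:ℝ) 1) (hpx : pot8 t a x < 1) (ε : ℝ) (hε : 0 < ε) :
    ∃ x' ∈ U, dist x' x < ε ∧ x' ∈ Ioo (0:ℝ) 1 ∧ pot8 t a x' < 1 := by
  have hpt : pot8 t a x ≠ ⊤ := hpx.ne_top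
  -- choose the ratio
  obtain ⟨q, hq1, hq⟩ : ∃ q : ℝ, 1 < q ∧ ENNReal.ofReal (q ^ t) * pot8 t a x < 1 := by
    have h1 : Tendsto (fun q : ℝ => ENNReal.ofReal (q ^ t) * pot8 t a x) (nhds 1)
        (nhds (ENNReal.ofReal (1 ^ t) * pot8 t a x)) := by
      apply ENNReal.Tendsto.mul_const _ (Or.inr hpt)
      exact (ENNReal.continuous_ofReal.tendsto _).comp
        ((Real.continuousAt_rpow_const 1 t (Or.inl one_ne_zero)).tendsto)
    have h2 := h1.eventually_lt_const (u := 1) (by simpa using hpx)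
    obtain ⟨q, h3, h4⟩ := ((h2.filter_mono nhdsWithin_le_nhds).and
      (self_mem_nhdsWithin (s := Ioi (1:ℝ)))).exists
    exact ⟨q, h4, h3⟩
  -- R with R/(R-1) ≤ q
  set R : ℝ := q / (q - 1) with hR
  have hq0 : 0 < q - 1 := by linarith
  have hRp : 0 < R := by positivity
  -- the near part tends to zero
  set κ : Measure ℝ := a.withDensity (fun y => ker8 t x y) with hκ
  have hκfin : IsFiniteMeasure κ := isFiniteMeasure_withDensity hpt
  have hκx : κ {x} = 0 := by
    rw [hκ, withDensity_apply _ (measurableSet_singleton x), Measure.restrict_singleton,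
      lintegral_smul_measure, lintegral_dirac]
    have hk : ker8 t x x = ⊤ := by
      unfold ker8; simp [ht]
    have ha : a {x} = 0 := by
      by_contra hne
      apply hpt
      rw [eq_top_iff]
      calc ⊤ = a {x} * ker8 t x x := by rw [hk, ENNReal.mul_top hne]
        _ = ∫⁻ y in {x}, ker8 t x y ∂a := by
          rw [Measure.restrict_singleton, lintegral_smul_measure, lintegral_dirac]; rfl
        _ ≤ _ := setLIntegral_le_lintegral _ _
    rw [ha]; simp
  have hκ0 : Tendsto (fun r : ℝ => ENNReal.ofReal (K * R ^ t) * κ (Metric.closedBall x (R * r)))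
      (nhdsWithin 0 (Ioi 0)) (nhds 0) := by
    have h1 := tendsto_measure_cthickening_of_isClosed (μ := κ) (s := {x})
      ⟨1, one_pos, measure_ne_top _ _⟩ isClosed_singleton
    rw [hκx] at h1
    have h2 : Tendsto (fun r : ℝ => R * r) (nhdsWithin 0 (Ioi 0)) (nhds 0) := by
      have : Tendsto (fun r : ℝ => R * r) (nhds 0) (nhds (R * 0)) :=
        (continuous_const.mul continuous_id).tendsto 0
      rw [mul_zero] at this
      exact this.mono_left nhdsWithin_le_nhds
    have h3 := ENNReal.Tendsto.const_mul (a := ENNReal.ofReal (K * R ^ t)) (h1.comp h2)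
      (Or.inr ENNReal.ofReal_ne_top)
    rw [mul_zero] at h3
    refine h3.congr' ?_
    filter_upwards [self_mem_nhdsWithin] with r hr
    have hr' : (0:ℝ) < r := hr
    simp only [Function.comp]
    rw [Metric.cthickening_singleton _ (by positivity)]
  obtain ⟨r, ⟨⟨hr1, hrε⟩, hrx⟩, hr0⟩ : ∃ r : ℝ, (((ENNReal.ofReal (K * R ^ t) * κ (Metric.closedBall x (R * r)) <
      1 - ENNReal.ofReal (q ^ t) * pot8 t a x) ∧ r < ε) ∧ r < min x (1 - x)) ∧ r ∈ Ioi (0:ℝ) := by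
    have h1 := hκ0.eventually_lt_const (u := 1 - ENNReal.ofReal (q ^ t) * pot8 t a x)
      (tsub_pos_of_lt hq)
    have h2 : ∀ᶠ r : ℝ in nhdsWithin 0 (Ioi 0), r < ε :=
      (eventually_lt_nhds hε).filter_mono nhdsWithin_le_nhds
    have h3 : ∀ᶠ r : ℝ in nhdsWithin 0 (Ioi 0), r < min x (1 - x) :=
      (eventually_lt_nhds (lt_min hx.1 (by linarith [hx.2]))).filter_mono nhdsWithin_le_nhds
    exact (((h1.and h2).and h3).and self_mem_nhdsWithin).exists
  have hr : 0 < r := hr0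
  have hrx1 := hrx.trans_le (min_le_left _ _)
  have hrx2 := hrx.trans_le (min_le_right _ _)
  set N : Set ℝ := Metric.closedBall x (R * r) with hN
  have hNm : MeasurableSet N := Metric.isClosed_closedBall.measurableSet
  have hsub : Metric.ball x r ⊆ Ioo 0 1 := by
    rw [Real.ball_eq_Ioo]; intro y hy; exact ⟨by linarith [hy.1], by linarith [hy.2]⟩
  obtain ⟨x', ⟨hxU, hxb⟩, hx'⟩ := hloc x r hr (hsub.trans Ioo_subset_Icc_self) (a.restrict N) inferInstance
  refine ⟨x', hxU, (Metric.mem_ball.1 hxb).trans hrε, hsub hxb, ?_⟩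
  have hnear : pot8 t (a.restrict N) x' ≤ ENNReal.ofReal (K * R ^ t) * κ N := by
    refine hx'.trans ?_
    rw [Measure.restrict_apply_univ]
    have h1 : ENNReal.ofReal ((R * r) ^ (-t)) * a N ≤ κ N := by
      rw [hκ, withDensity_apply _ hNm, ← setLIntegral_const]
      apply setLIntegral_mono' hNm
      intro y hy
      rw [hN, Metric.mem_closedBall, dist_comm, Real.dist_eq] at hy
      unfold ker8
      rw [← ENNReal.ofReal_rpow_of_pos (by positivity), ENNReal.rpow_neg, ENNReal.rpow_neg]
      exact ENNReal.inv_le_inv.2 (ENNReal.rpow_le_rpow (ENNReal.ofReal_le_ofReal hy) ht.le)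
    calc ENNReal.ofReal (K * r ^ (-t)) * a N
        = ENNReal.ofReal (K * R ^ t) * (ENNReal.ofReal ((R * r) ^ (-t)) * a N) := by
          rw [← mul_assoc, ← ENNReal.ofReal_mul (by positivity)]
          congr 2
          rw [Real.mul_rpow hRp.le hr.le, Real.rpow_neg hRp.le]
          have := (Real.rpow_pos_of_pos hRp t).ne'
          field_simp
      _ ≤ _ := by gcongr
  have hfar : ∫⁻ y in Nᶜ, ker8 t x' y ∂a ≤ ENNReal.ofReal (q ^ t) * pot8 t a x := by
    calc ∫⁻ y in Nᶜ, ker8 t x' y ∂a ≤ ∫⁻ y in Nᶜ, ENNReal.ofReal (q ^ t) * ker8 t x y ∂a := by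
          apply setLIntegral_mono' hNm.compl
          intro y hy
          apply ker8_le ht (by linarith)
          rw [hN, mem_compl_iff, Metric.mem_closedBall, dist_comm, Real.dist_eq, not_le] at hy
          rw [Metric.mem_ball, dist_comm, Real.dist_eq] at hxb
          have h1 : |x - y| ≤ |x - x'| + |x' - y| := abs_sub_le _ _ _
          have h2 : q * r < (q - 1) * |x - y| := by
            calc q * r = (q - 1) * (R * r) := by rw [hR]; field_simp
              _ < _ := by gcongr
          nlinarith
      _ = ENNReal.ofReal (q ^ t) * ∫⁻ y in Nᶜ, ker8 t x y ∂a := lintegral_const_mul _ (ker8_meas t x)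
      _ ≤ _ := by gcongr; exact setLIntegral_le_lintegral _ _
  calc pot8 t a x' = pot8 t (a.restrict N) x' + ∫⁻ y in Nᶜ, ker8 t x' y ∂a :=
        (lintegral_add_compl _ hNm).symm
    _ ≤ ENNReal.ofReal (K * R ^ t) * κ N + ENNReal.ofReal (q ^ t) * pot8 t a x := add_le_add hnear hfar
    _ < (1 - ENNReal.ofReal (q ^ t) * pot8 t a x) + ENNReal.ofReal (q ^ t) * pot8 t a x := by
        exact ENNReal.add_lt_add_right hq.ne_top hr1
    _ = 1 := tsub_add_cancel_of_le hq.le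

lemma start8 {t : ℝ} (ht : 0 < t) (ht1 : t < 1) :
    ∃ δ : ENNReal, 0 < δ ∧ ∀ a : Measure ℝ, IsFiniteMeasure a → a univ < δ →
      ∃ x ∈ Ioo (0:ℝ) 1, pot8 t a x < 1 := by
  set D : ENNReal := ENNReal.ofReal (3 ^ t) * ENNReal.ofReal (2 * 1 ^ (1 - t) / (1 - t)) with hD
  have hDt : D ≠ ⊤ := ENNReal.mul_ne_top ENNReal.ofReal_ne_top ENNReal.ofReal_ne_top
  refine ⟨D⁻¹, ENNReal.inv_pos.2 hDt, fun a ha hlt => ?_⟩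
  have hpot : ∀ y, pot8 t (volume.restrict (Ioo (0:ℝ) 1)) y ≤ D := by
    apply pot8_max ht _ (Ioo (0:ℝ) 1) _ ⟨1/2, by norm_num, by norm_num⟩
    · intro z hz
      rw [← leb8 ht1 z 1 one_pos]
      refine lintegral_mono' (Measure.restrict_mono ?_ le_rfl) le_rfl
      intro y hy
      rw [Real.ball_eq_Ioo]
      exact ⟨by linarith [hy.1, hz.2], by linarith [hy.2, hz.1]⟩
    · rw [Measure.restrict_apply measurableSet_Ioo.compl]; simp
  have hswap : ∫⁻ x in Ioo (0:ℝ) 1, pot8 t a x ≤ D * a univ := by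
    unfold pot8
    rw [lintegral_lintegral_swap (ker8_cont t).measurable.aemeasurable]
    calc ∫⁻ y, (∫⁻ x in Ioo (0:ℝ) 1, ker8 t x y) ∂a
        = ∫⁻ y, pot8 t (volume.restrict (Ioo (0:ℝ) 1)) y ∂a := by
          unfold pot8
          apply lintegral_congr; intro y; apply lintegral_congr; intro x; exact ker8_comm _ _ _
      _ ≤ ∫⁻ y, D ∂a := lintegral_mono hpot
      _ = _ := by rw [lintegral_const]
  obtain ⟨x, hx, hxp⟩ := exists_le_setLAverage (μ := volume) (s := Ioo (0:ℝ) 1) (f := pot8 t a)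
    (by simp) (by simp) (pot8_meas t a).aemeasurable
  refine ⟨x, hx, hxp.trans_lt ?_⟩
  rw [setLAverage_eq]
  simp only [Real.volume_Ioo, sub_zero, ENNReal.ofReal_one, div_one]
  refine hswap.trans_lt ?_
  rw [mul_comm]
  exact ENNReal.mul_lt_of_lt_div (by simpa using hlt)

lemma cover8 {t : ℝ} (ht : 0 < t) (S : Set ℝ) (hS : Measure.hausdorffMeasure t S = 0)
    (δ : ENNReal) (hδ : 0 < δ) :
    ∃ a : Measure ℝ, IsFiniteMeasure a ∧ a univ < δ ∧ ∀ x ∈ S, 2 ≤ pot8 t a x := by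
  classical
  wlog hδt : δ ≠ ⊤ generalizing δ
  · obtain ⟨a, h1, h2, h3⟩ := this 1 one_pos ENNReal.one_ne_top
    exact ⟨a, h1, h2.trans_le (by rw [not_not.1 hδt]; exact le_top), h3⟩
  rw [Measure.hausdorffMeasure_apply] at hS
  have h1 := hS.le
  rw [iSup₂_le_iff] at h1
  have h2 := (h1 1 one_pos).trans_lt (ENNReal.div_pos hδ.ne' (by norm_num : (4:ENNReal) ≠ ⊤))
  simp only [iInf_lt_iff] at h2
  obtain ⟨T, hT, hT1, hsum⟩ := h2
  obtain ⟨e, he0, hesum⟩ := ENNReal.exists_pos_sum_of_countable' (ε := δ / 4)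
    (ENNReal.div_pos hδ.ne' (by norm_num)).ne' ℕ
  set d : ℕ → ENNReal := fun n => ⨆ _ : (T n).Nonempty, Metric.ediam (T n) ^ t with hd
  set p : ℕ → ℝ := fun n => if h : (T n).Nonempty then h.some else 0 with hp
  set a : Measure ℝ := Measure.sum (fun n => (2 * (d n + e n)) • Measure.dirac (p n)) with ha
  have hau : a univ < δ := by
    rw [ha, Measure.sum_apply _ MeasurableSet.univ]
    simp only [Measure.smul_apply, measure_univ, smul_eq_mul, mul_one]
    rw [ENNReal.tsum_mul_left, ENNReal.tsum_add]
    calc 2 * (∑' n, d n + ∑' n, e n) < 2 * (δ / 4 + δ / 4) := by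
          apply (ENNReal.mul_lt_mul_iff_right (by norm_num) (by norm_num)).2
          exact ENNReal.add_lt_add hsum hesum
      _ = δ := by
        rw [← two_mul, ← mul_assoc]; norm_num
        exact ENNReal.mul_div_cancel (by norm_num) (by norm_num)
  refine ⟨a, ⟨hau.trans_le le_top⟩, hau, fun x hx => ?_⟩
  obtain ⟨n, hn⟩ := mem_iUnion.1 (hT hx)
  have hne : (T n).Nonempty := ⟨x, hn⟩
  have hpn : p n ∈ T n := by simp only [hp, hne, dif_pos]; exact hne.some_mem
  have hdn : d n = Metric.ediam (T n) ^ t := by simp only [hd, hne, iSup_pos]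
  have hdist : ENNReal.ofReal |x - p n| ^ t ≤ d n := by
    rw [hdn]
    apply ENNReal.rpow_le_rpow _ ht.le
    have := Metric.edist_le_ediam_of_mem hn hpn
    rwa [edist_dist, Real.dist_eq] at this
  have hle : pot8 t a x ≥ (2 * (d n + e n)) * ker8 t x (p n) := by
    unfold pot8
    rw [ha, lintegral_sum_measure]
    refine le_trans (le_of_eq ?_) (ENNReal.le_tsum n)
    rw [lintegral_smul_measure, lintegral_dirac]; rfl
  refine le_trans ?_ hle
  unfold ker8
  rw [ENNReal.rpow_neg, mul_assoc]
  set z := ENNReal.ofReal |x - p n| ^ t with hz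
  have hzt : z ≠ ⊤ := ENNReal.rpow_ne_top_of_nonneg ht.le ENNReal.ofReal_ne_top
  have : 1 ≤ (d n + e n) * z⁻¹ := by
    rcases eq_or_ne z 0 with h0 | h0
    · rw [h0, ENNReal.inv_zero, ENNReal.mul_top]
      · exact le_top
      · exact (lt_of_lt_of_le (he0 n) le_add_self).ne'
    · calc 1 = z * z⁻¹ := (ENNReal.mul_inv_cancel h0 hzt).symm
        _ ≤ _ := by gcongr; exact hdist.trans le_self_add
  calc (2:ENNReal) = 2 * 1 := by simp
    _ ≤ _ := by gcongr

lemma sle8 {s : ℝ} (hs : 0 < s) (m : Measure ℝ) [IsProbabilityMeasure m]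
    (hen : ∫⁻ x, ∫⁻ y, ker8 s x y ∂m ∂m ≠ ⊤) : s ≤ 1 := by
  by_contra hs1
  push Not at hs1
  have hfin : ∀ᵐ x ∂m, pot8 s m x < ⊤ := ae_lt_top (pot8_meas s m) hen
  obtain ⟨k, hk⟩ : ∃ k : ℕ, m {x | pot8 s m x ≤ k} ≠ 0 := by
    by_contra hcon
    push Not at hcon
    have h1 : m (⋃ k : ℕ, {x | pot8 s m x ≤ k}) = 0 := measure_iUnion_null hcon
    have h2 : ∀ᵐ x ∂m, False := by
      filter_upwards [hfin, measure_eq_zero_iff_ae_notMem.1 h1] with x hx hx'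
      apply hx'
      obtain ⟨k, hk⟩ := ENNReal.exists_nat_gt hx.ne
      exact mem_iUnion.2 ⟨k, hk.le⟩
    exact h2.exists.elim (fun _ h => h)
  set F := {x | pot8 s m x ≤ k} with hF
  have hFm : MeasurableSet F := measurableSet_le (pot8_meas s m) measurable_const
  have hle : ((k : ENNReal) + 1)⁻¹ • m.restrict F ≤ Measure.hausdorffMeasure s := by
    apply Measure.le_hausdorffMeasure s _ 1 one_pos
    intro A hA
    have hkey : ∀ x ∈ A ∩ F, m A ≤ Metric.ediam A ^ s * k := by
      intro x hx
      have hdt : Metric.ediam A ≠ ⊤ := ne_top_of_le_ne_top ENNReal.one_ne_top hA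
      have h1 : (Metric.ediam A ^ s)⁻¹ * m A ≤ k := by
        refine le_trans ?_ hx.2
        rw [← setLIntegral_const]
        unfold pot8
        refine le_trans ?_ (setLIntegral_le_lintegral A _)
        apply setLIntegral_mono (ker8_meas s x)
        intro y hy
        unfold ker8
        rw [ENNReal.rpow_neg]
        apply ENNReal.inv_le_inv.2 (ENNReal.rpow_le_rpow _ hs.le)
        have := Metric.edist_le_ediam_of_mem hx.1 hy
        rwa [edist_dist, Real.dist_eq] at this
      rcases eq_or_ne (Metric.ediam A ^ s) 0 with h0 | h0
      · rw [h0, ENNReal.inv_zero] at h1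
        by_cases hmA : m A = 0
        · rw [hmA]; exact zero_le
        · rw [ENNReal.top_mul hmA] at h1
          simp at h1
      · rw [mul_comm (Metric.ediam A ^ s)]
        have hne : Metric.ediam A ^ s ≠ ⊤ := ENNReal.rpow_ne_top_of_nonneg hs.le hdt
        rw [mul_comm, ← div_eq_mul_inv] at h1
        exact (ENNReal.div_le_iff h0 hne).1 h1
    rw [Measure.smul_apply, Measure.restrict_apply' hFm, smul_eq_mul]
    rcases (A ∩ F).eq_empty_or_nonempty with he | ⟨x, hx⟩
    · simp [he]
    · calc ((k : ENNReal) + 1)⁻¹ * m (A ∩ F) ≤ ((k : ENNReal) + 1)⁻¹ * (Metric.ediam A ^ s * (k + 1)) := by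
            gcongr
            refine (measure_mono inter_subset_left).trans ((hkey x hx).trans ?_)
            gcongr
            exact le_self_add
        _ = Metric.ediam A ^ s := by
            rw [mul_left_comm, ENNReal.inv_mul_cancel (by simp) (by simp), mul_one]
  have h0 : Measure.hausdorffMeasure s (univ : Set ℝ) = 0 := by
    have := hausdorffMeasure_of_dimH_lt (s := (univ : Set ℝ)) (d := s.toNNReal) (by
      rw [Real.dimH_univ]
      have : (1:NNReal) < s.toNNReal := by rw [Real.lt_toNNReal_iff_coe_lt]; simpa using hs1
      exact_mod_cast this)
    rwa [Real.coe_toNNReal s hs.le] at this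
  have h1 := hle univ
  rw [h0, Measure.smul_apply, Measure.restrict_apply_univ, smul_eq_mul, nonpos_iff_eq_zero,
    mul_eq_zero] at h1
  rcases h1 with h1 | h1
  · simp at h1
  · exact hk h1


theorem stmt_8
    (E : ℕ → Set ℝ) (hEopen : ∀ n, IsOpen (E n)) (hEsub : ∀ n, E n ⊆ Set.Icc (0:ℝ) 1)
    (μn : ℕ → Measure ℝ) [∀ n, IsProbabilityMeasure (μn n)]
    (hsupp : ∀ n, μn n (E n)ᶜ = 0)
    (μ : Measure ℝ)
    -- weak convergence: ∫ f dμ_n → ∫ f dμ for every continuous f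
    (hweak : ∀ f : ℝ → ℝ, Continuous f →
      Tendsto (fun n => ∫ x, f x ∂(μn n)) atTop (nhds (∫ x, f x ∂μ)))
    -- μ is absolutely continuous w.r.t. Lebesgue with density bounded and bounded away from 0
    (h : ℝ → ℝ) (c₁ c₂ : ℝ) (hc₁ : 0 < c₁)
    (hdens : μ = (volume.restrict (Set.Icc (0:ℝ) 1)).withDensity
      (fun x => ENNReal.ofReal (h x)))
    (hhbd : ∀ᵐ x ∂(volume.restrict (Set.Icc (0:ℝ) 1)), c₁ ≤ h x ∧ h x ≤ c₂)
    -- uniformly bounded s-energies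
    (s : ℝ) (hs : 0 < s) (C : ℝ)
    (henergy : ∀ n, (∫⁻ x, ∫⁻ y, (ENNReal.ofReal |x - y|) ^ (-s) ∂(μn n) ∂(μn n)) <
      ENNReal.ofReal C) :
    ENNReal.ofReal s ≤ dimH (Filter.limsup E Filter.atTop) := by
  have hker : ∀ n, ∫⁻ x, ∫⁻ y, ker8 s x y ∂(μn n) ∂(μn n) ≤ ENNReal.ofReal C :=
    fun n => (henergy n).le
  have hs1 : s ≤ 1 := sle8 hs (μn 0) (ne_top_of_le_ne_top ENNReal.ofReal_ne_top (hker 0))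
  by_contra hcon
  push Not at hcon
  obtain ⟨t', ht'1, ht'2⟩ := ENNReal.lt_iff_exists_nnreal_btwn.1 hcon
  set t : ℝ := (t' : ℝ) with htdef
  have ht : 0 < t := by
    have : (0 : ENNReal) < t' := lt_of_le_of_lt zero_le ht'1
    exact_mod_cast this
  have hts : t < s := by
    rw [← ENNReal.ofReal_coe_nnreal, ENNReal.ofReal_lt_ofReal_iff hs] at ht'2
    exact ht'2
  have ht1 : t < 1 := hts.trans_le hs1
  have hH := hausdorffMeasure_of_dimH_lt ht'1
  -- the limit measure
  have hμ1 : μ univ = 1 := by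
    have h1 := hweak (fun _ => 1) continuous_const
    simp only [integral_const, smul_eq_mul, mul_one, probReal_univ] at h1
    have h2 := tendsto_nhds_unique h1 tendsto_const_nhds
    rw [measureReal_def] at h2
    exact (ENNReal.toReal_eq_one_iff _).1 h2
  haveI : IsProbabilityMeasure μ := ⟨hμ1⟩
  let P : ℕ → ProbabilityMeasure ℝ := fun n => ⟨μn n, inferInstance⟩
  let Q : ProbabilityMeasure ℝ := ⟨μ, inferInstance⟩
  have hPQ : Tendsto P atTop (nhds Q) := by
    rw [ProbabilityMeasure.tendsto_iff_forall_integral_tendsto]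
    intro f
    exact hweak f f.continuous
  have hc₂ : 0 < max c₂ 1 := by positivity
  have hup : (Q : Measure ℝ) ≤ ENNReal.ofReal (max c₂ 1) • volume := by
    show μ ≤ _
    rw [Measure.le_iff]
    intro A hA
    rw [hdens, withDensity_apply _ hA, Measure.smul_apply, smul_eq_mul]
    calc ∫⁻ x in A, ENNReal.ofReal (h x) ∂(volume.restrict (Icc (0:ℝ) 1))
        ≤ ∫⁻ x in A, ENNReal.ofReal (max c₂ 1) ∂(volume.restrict (Icc (0:ℝ) 1)) := by
          apply lintegral_mono_ae
          filter_upwards [ae_restrict_of_ae hhbd] with x hx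
          exact ENNReal.ofReal_le_ofReal (hx.2.trans (le_max_left _ _))
      _ = ENNReal.ofReal (max c₂ 1) * (volume.restrict (Icc (0:ℝ) 1)) A := setLIntegral_const _ _
      _ ≤ _ := by gcongr; exact Measure.restrict_le_self
  have hlow : ∀ A : Set ℝ, MeasurableSet A → A ⊆ Icc 0 1 → ENNReal.ofReal c₁ * volume A ≤ μ A := by
    intro A hA hsub
    rw [hdens, withDensity_apply _ hA]
    calc ENNReal.ofReal c₁ * volume A = ENNReal.ofReal c₁ * (volume.restrict (Icc (0:ℝ) 1)) A := by
          rw [Measure.restrict_apply hA, inter_eq_left.2 hsub]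
      _ = ∫⁻ x in A, ENNReal.ofReal c₁ ∂(volume.restrict (Icc (0:ℝ) 1)) := (setLIntegral_const _ _).symm
      _ ≤ _ := by
          apply lintegral_mono_ae
          filter_upwards [ae_restrict_of_ae hhbd] with x hx
          exact ENNReal.ofReal_le_ofReal hx.1
  obtain ⟨A, hA, hAen⟩ := energy8 ht hts ht1 P Q hPQ (max c₂ 1) hc₂ hup C hker
  set K : ℝ := 3 ^ t * (4 * A / c₁ ^ 2) with hK
  have hKpos : 0 ≤ K := by positivity
  set U : ℕ → Set ℝ := fun N => ⋃ n ≥ N, E n with hU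
  have hUo : ∀ N, IsOpen (U N) := fun N => isOpen_biUnion fun n _ => hEopen n
  have hloc : ∀ N, ∀ x r : ℝ, 0 < r → Metric.ball x r ⊆ Icc 0 1 → ∀ b : Measure ℝ, IsFiniteMeasure b →
      ∃ x' ∈ U N ∩ Metric.ball x r, pot8 t b x' ≤ ENNReal.ofReal (K * r ^ (-t)) * b univ := by
    intro N x r hr hsub b hb
    have hmass : ∀ᶠ n in atTop, ENNReal.ofReal (c₁ * r) < (P n : Measure ℝ) (Metric.ball x r) := by
      have h1 := ProbabilityMeasure.le_liminf_measure_open_of_tendsto hPQ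
        (G := Metric.ball x r) Metric.isOpen_ball
      have h2 : ENNReal.ofReal (c₁ * r) < (Q : Measure ℝ) (Metric.ball x r) := by
        refine lt_of_lt_of_le ?_ (hlow _ Metric.isOpen_ball.measurableSet hsub)
        rw [Real.volume_ball, ← ENNReal.ofReal_mul hc₁.le, ENNReal.ofReal_lt_ofReal_iff (by positivity)]
        nlinarith [mul_pos hc₁ hr]
      exact eventually_lt_of_lt_liminf (h2.trans_le h1)
    obtain ⟨n, ⟨hn1, hn2⟩, hnN⟩ := ((hmass.and (hAen x r hr)).and (eventually_ge_atTop N)).exists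
    obtain ⟨x', hx', hp⟩ := pick8 ht (μn n) (Metric.ball x r) (E n) Metric.isOpen_ball.measurableSet
      (hEopen n).measurableSet (hsupp n) (c₁ * r) (A * r ^ (2 - t)) (by positivity) (by positivity)
      hn1.le hn2 b
    refine ⟨x', ⟨mem_biUnion (show n ∈ {n | n ≥ N} from hnN) hx'.1, hx'.2⟩, hp.trans (le_of_eq ?_)⟩
    congr 2
    rw [hK, show (2 - t) = -t + 2 by ring, Real.rpow_add hr, Real.rpow_two]
    field_simp
  obtain ⟨δ, hδ, hstart⟩ := start8 ht ht1
  obtain ⟨a, hafin, haδ, hcov⟩ := cover8 ht _ hH δ hδ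
  obtain ⟨x₀, hx₀, hpx₀⟩ := hstart a hafin haδ
  set Y : Set ℝ := {x | x ∈ Ioo (0:ℝ) 1 ∧ pot8 t a x < 1} with hY
  have hX1 : ∀ x ∈ closure Y, pot8 t a x ≤ 1 := fun x hx =>
    closure_minimal (fun z hz => hz.2.le) (pot8_closed t a 1) hx
  haveI : CompleteSpace (closure Y) := isClosed_closure.completeSpace_coe
  have hdense : Dense (⋂ N, (Subtype.val ⁻¹' (U N) : Set (closure Y))) := by
    apply dense_iInter_of_isOpen_nat
    · intro N; exact (hUo N).preimage continuous_subtype_val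
    · intro N
      rw [Metric.dense_iff]
      intro x r hr
      obtain ⟨y, hy, hxy⟩ := Metric.mem_closure_iff.1 x.2 (r / 2) (by positivity)
      obtain ⟨z, hzU, hzy, hz1, hz2⟩ := dens8 ht K hKpos a (U N) (hloc N) y hy.1 hy.2 (r / 2)
        (by positivity)
      refine ⟨⟨z, subset_closure ⟨hz1, hz2⟩⟩, ?_, hzU⟩
      rw [Metric.mem_ball, Subtype.dist_eq]
      show dist z (x : ℝ) < r
      have := dist_triangle z y (x : ℝ)
      rw [dist_comm y] at this
      linarith
  haveI : Nonempty (closure Y) := ⟨⟨x₀, subset_closure ⟨hx₀, hpx₀⟩⟩⟩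
  obtain ⟨w, hw⟩ := hdense.nonempty
  have hwS : (w : ℝ) ∈ Filter.limsup E Filter.atTop := by
    rw [limsup_eq_iInf_iSup_of_nat]
    simp only [iInf_eq_iInter, iSup_eq_iUnion]
    exact mem_iInter.2 fun N => mem_iInter.1 hw N
  have h2 := (hcov w hwS).trans (hX1 w w.2)
  norm_num at h2
end

section
/- Let 0 < s < 1. There is a constant c_s > 0 such that for any two balls B₁ = B(x₁, r₁) and B₂ = B(x₂, r₂) with x₁, x₂ ∈ [0,1] and r₁, r₂ > 0, one has (1/(r₁ r₂)) ∫_{B₁} ∫_{B₂} |x − y|^{−s} dx dy ≤ c_s · min{ |x₁ − x₂|^{−s}, r₁^{−s}, r₂^{−s} }. -/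
open MeasureTheory Filter Set

lemma aux_G (s : ℝ) (hs₀ : 0 < s) (hs₁ : s < 1) (r : ℝ) (hr : 0 < r) :
    ∫⁻ t in Ioc 0 r, ENNReal.ofReal (t ^ (-s)) = ENNReal.ofReal (r ^ (1 - s) / (1 - s)) := by
  have hi : IntervalIntegrable (fun t : ℝ => t ^ (-s)) volume 0 r :=
    intervalIntegral.intervalIntegrable_rpow' (by linarith)
  rw [intervalIntegrable_iff_integrableOn_Ioc_of_le hr.le] at hi
  rw [← ofReal_integral_eq_lintegral_ofReal hi]
  · rw [← intervalIntegral.integral_of_le hr.le, integral_rpow (Or.inl (by linarith))]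
    rw [Real.zero_rpow (by linarith)]
    congr 1
    rw [sub_zero]; congr 1 <;> ring_nf
  · filter_upwards [ae_restrict_mem measurableSet_Ioc] with t ht
    exact Real.rpow_nonneg ht.1.le _

lemma aux_A (s : ℝ) (hs₀ : 0 < s) (hs₁ : s < 1) (x a r : ℝ) (hr : 0 < r) :
    ∫⁻ y in Ioo (a - r) (a + r), ENNReal.ofReal (|x - y| ^ (-s)) ≤
      ENNReal.ofReal ((2 / (1 - s) + 2) * r ^ (1 - s)) := by
  set G : ℝ → ENNReal := (Ioc 0 r).indicator (fun t => ENNReal.ofReal (t ^ (-s))) with hG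
  have hGm : Measurable G := by
    apply Measurable.indicator _ measurableSet_Ioc
    fun_prop
  have hGi : ∫⁻ t, G t = ENNReal.ofReal (r ^ (1 - s) / (1 - s)) := by
    rw [hG, lintegral_indicator measurableSet_Ioc, aux_G s hs₀ hs₁ r hr]
  have key : ∀ y, ENNReal.ofReal (|x - y| ^ (-s)) ≤
      (G (x - y) + G (-(x - y))) + ENNReal.ofReal (r ^ (-s)) := by
    intro y
    generalize x - y = t
    rcases le_or_gt |t| r with h | h
    · refine le_trans ?_ le_self_add
      rcases lt_trichotomy t 0 with h0 | h0 | h0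
      · have : G (-t) = ENNReal.ofReal (|t| ^ (-s)) := by
          rw [abs_of_neg h0] at h ⊢
          rw [hG, indicator_of_mem (show -t ∈ Ioc 0 r from ⟨by linarith, h⟩)]
        rw [this]; exact le_add_self
      · subst h0
        rw [abs_zero, Real.zero_rpow (by linarith)]; simp
      · have : G t = ENNReal.ofReal (|t| ^ (-s)) := by
          rw [abs_of_pos h0] at h ⊢
          rw [hG, indicator_of_mem (show t ∈ Ioc 0 r from ⟨by linarith, h⟩)]
        rw [this]; exact le_self_add
    · refine le_trans ?_ le_add_self
      exact ENNReal.ofReal_le_ofReal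
        (Real.rpow_le_rpow_of_nonpos hr h.le (by linarith))
  have h1 : ∫⁻ y, (G (x - y) + G (-(x - y))) =
      ENNReal.ofReal (r ^ (1 - s) / (1 - s)) + ENNReal.ofReal (r ^ (1 - s) / (1 - s)) := by
    rw [lintegral_sub_left_eq_self (fun t => G t + G (-t)) x, lintegral_add_left hGm,
      lintegral_neg_eq_self, hGi]
  have hp : 0 < r ^ (1 - s) := Real.rpow_pos_of_pos hr _
  have hq : 0 < r ^ (-s) := Real.rpow_pos_of_pos hr _
  have hpq : r ^ (1 - s) = r ^ (-s) * r := by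
    rw [sub_eq_neg_add, Real.rpow_add hr, Real.rpow_one]
  have h1s : 0 < 1 - s := by linarith
  calc _ ≤ ∫⁻ y in Ioo (a - r) (a + r),
        ((G (x - y) + G (-(x - y))) + ENNReal.ofReal (r ^ (-s))) := lintegral_mono key
    _ = (∫⁻ y in Ioo (a - r) (a + r), (G (x - y) + G (-(x - y)))) +
        ENNReal.ofReal (r ^ (-s)) * ENNReal.ofReal (2 * r) := by
      rw [lintegral_add_right _ measurable_const, setLIntegral_const, Real.volume_Ioo]
      congr 3; ring
    _ ≤ (ENNReal.ofReal (r ^ (1 - s) / (1 - s)) + ENNReal.ofReal (r ^ (1 - s) / (1 - s))) +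
        ENNReal.ofReal (r ^ (-s)) * ENNReal.ofReal (2 * r) := by
      gcongr
      rw [← h1]
      exact setLIntegral_le_lintegral _ _
    _ = _ := by
      rw [← ENNReal.ofReal_mul hq.le, ← ENNReal.ofReal_add (by positivity) (by positivity),
        ← ENNReal.ofReal_add (by positivity) (by positivity)]
      congr 1
      rw [hpq]; ring

lemma aux_le {α : Type*} [MeasurableSpace α] (μ : Measure α) (f : α → ℝ) (hf : ∀ x, 0 ≤ f x) :
    ENNReal.ofReal (∫ x, f x ∂μ) ≤ ∫⁻ x, ENNReal.ofReal (f x) ∂μ := by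
  by_cases h : Integrable f μ
  · rw [ofReal_integral_eq_lintegral_ofReal h (ae_of_all _ hf)]
  · rw [integral_undef h]; simp

lemma aux_I (s : ℝ) (x₁ x₂ r₁ r₂ : ℝ) :
    ENNReal.ofReal (∫ x in Ioo (x₁ - r₁) (x₁ + r₁),
              ∫ y in Ioo (x₂ - r₂) (x₂ + r₂), |x - y| ^ (-s)) ≤
    ∫⁻ x in Ioo (x₁ - r₁) (x₁ + r₁), ∫⁻ y in Ioo (x₂ - r₂) (x₂ + r₂),
      ENNReal.ofReal (|x - y| ^ (-s)) := by
  have h0 : ∀ x y : ℝ, 0 ≤ |x - y| ^ (-s) := fun x y => Real.rpow_nonneg (abs_nonneg _) _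
  refine (aux_le _ _ fun x => integral_nonneg (h0 x)).trans ?_
  exact lintegral_mono fun x => aux_le _ _ (h0 x)

lemma aux_const (F : ℝ → ENNReal) (a r M : ℝ) (hr : 0 < r) (hM : 0 ≤ M)
    (h : ∀ x ∈ Ioo (a - r) (a + r), F x ≤ ENNReal.ofReal M) :
    ∫⁻ x in Ioo (a - r) (a + r), F x ≤ ENNReal.ofReal (2 * r * M) := by
  calc _ ≤ ∫⁻ x in Ioo (a - r) (a + r), ENNReal.ofReal M :=
        setLIntegral_mono measurable_const h
    _ = _ := by
      rw [setLIntegral_const, Real.volume_Ioo, ← ENNReal.ofReal_mul hM]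
      congr 1; ring

lemma aux_swap (s : ℝ) (x₁ x₂ r₁ r₂ : ℝ) :
    ∫⁻ x in Ioo (x₁ - r₁) (x₁ + r₁), ∫⁻ y in Ioo (x₂ - r₂) (x₂ + r₂),
      ENNReal.ofReal (|x - y| ^ (-s)) =
    ∫⁻ x in Ioo (x₂ - r₂) (x₂ + r₂), ∫⁻ y in Ioo (x₁ - r₁) (x₁ + r₁),
      ENNReal.ofReal (|x - y| ^ (-s)) := by
  rw [lintegral_lintegral_swap]
  · simp_rw [abs_sub_comm]
  · apply Measurable.aemeasurable
    unfold Function.uncurry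
    fun_prop

lemma aux_fin (s : ℝ) (hs₀ : 0 < s) (C c J a b A : ℝ) (ha : 0 < a) (hb : 0 < b) (hA : 0 < A)
    (hc : C ≤ c) (h : J ≤ a * b * (C * A ^ (-s))) :
    ENNReal.ofReal (1 / (a * b) * J) ≤ ENNReal.ofReal c * (ENNReal.ofReal A) ^ (-s) := by
  have hp : 0 < A ^ (-s) := Real.rpow_pos_of_pos hA _
  rw [ENNReal.ofReal_rpow_of_pos hA, ← ENNReal.ofReal_mul' hp.le]
  apply ENNReal.ofReal_le_ofReal
  calc 1 / (a * b) * J ≤ 1 / (a * b) * (a * b * (C * A ^ (-s))) := by gcongr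
    _ = C * A ^ (-s) := by field_simp
    _ ≤ _ := by gcongr

theorem stmt_9
    (s : ℝ) (hs₀ : 0 < s) (hs₁ : s < 1) :
    ∃ c_s : ℝ, 0 < c_s ∧
      ∀ x₁ x₂ r₁ r₂ : ℝ, x₁ ∈ Set.Icc (0:ℝ) 1 → x₂ ∈ Set.Icc (0:ℝ) 1 →
        0 < r₁ → 0 < r₂ →
        ENNReal.ofReal (1 / (r₁ * r₂) *
            ∫ x in Set.Ioo (x₁ - r₁) (x₁ + r₁),
              ∫ y in Set.Ioo (x₂ - r₂) (x₂ + r₂), |x - y| ^ (-s)) ≤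
          ENNReal.ofReal c_s *
            min ((ENNReal.ofReal |x₁ - x₂|) ^ (-s))
              (min ((ENNReal.ofReal r₁) ^ (-s)) ((ENNReal.ofReal r₂) ^ (-s))) := by
  have h1s : 0 < 1 - s := by linarith
  set K : ℝ := 2 / (1 - s) + 2 with hK
  have hK2 : 2 ≤ K := by
    have : 0 < 2 / (1 - s) := by positivity
    linarith
  have h4 : (1:ℝ) ≤ 4 ^ s := Real.one_le_rpow (by norm_num) hs₀.le
  refine ⟨2 * K * 4 ^ s, by positivity, ?_⟩
  intro x₁ x₂ r₁ r₂ _ _ hr₁ hr₂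
  have hI := aux_I s x₁ x₂ r₁ r₂
  have hsw := aux_swap s x₁ x₂ r₁ r₂
  set J := ∫ x in Set.Ioo (x₁ - r₁) (x₁ + r₁),
              ∫ y in Set.Ioo (x₂ - r₂) (x₂ + r₂), |x - y| ^ (-s) with hJ
  have hpow : ∀ r : ℝ, 0 < r → r ^ (1 - s) = r ^ (-s) * r := by
    intro r hr
    rw [sub_eq_neg_add, Real.rpow_add hr, Real.rpow_one]
  have hB2 : J ≤ r₁ * r₂ * (2 * K * r₂ ^ (-s)) := by
    have := hI.trans (aux_const _ x₁ r₁ (K * r₂ ^ (1 - s)) hr₁ (by positivity)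
      fun x _ => aux_A s hs₀ hs₁ x x₂ r₂ hr₂)
    rw [ENNReal.ofReal_le_ofReal_iff (by positivity), hpow r₂ hr₂] at this
    linarith
  have hB1 : J ≤ r₁ * r₂ * (2 * K * r₁ ^ (-s)) := by
    have := hI.trans (hsw.le.trans (aux_const _ x₂ r₂ (K * r₁ ^ (1 - s)) hr₂ (by positivity)
      fun x _ => aux_A s hs₀ hs₁ x x₁ r₁ hr₁))
    rw [ENNReal.ofReal_le_ofReal_iff (by positivity), hpow r₁ hr₁] at this
    linarith
  have hcc : 2 * K ≤ 2 * K * 4 ^ s := le_mul_of_one_le_right (by linarith) h4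
  rw [mul_min, mul_min]
  refine le_min ?_ (le_min ?_ ?_)
  · rcases (abs_nonneg (x₁ - x₂)).eq_or_lt with hd | hd
    · rw [← hd, ENNReal.ofReal_zero, ENNReal.zero_rpow_of_neg (by linarith), ENNReal.mul_top]
      · exact le_top
      · exact (ENNReal.ofReal_pos.2 (by positivity)).ne'
    · refine aux_fin s hs₀ (2 * K * 4 ^ s) _ J r₁ r₂ _ hr₁ hr₂ hd le_rfl ?_
      have h4d : (|x₁ - x₂| / 4) ^ (-s) = 4 ^ s * |x₁ - x₂| ^ (-s) := by
        rw [Real.div_rpow hd.le (by norm_num), Real.rpow_neg (by norm_num : (0:ℝ) ≤ 4)]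
        field_simp
      rw [mul_assoc (2 * K), ← h4d]
      have hd4 : 0 < |x₁ - x₂| / 4 := by linarith
      rcases le_or_gt (|x₁ - x₂| / 4) r₁ with h | h
      · refine hB1.trans ?_
        have := Real.rpow_le_rpow_of_nonpos hd4 h (by linarith : -s ≤ 0)
        gcongr
      rcases le_or_gt (|x₁ - x₂| / 4) r₂ with h' | h'
      · refine hB2.trans ?_
        have := Real.rpow_le_rpow_of_nonpos hd4 h' (by linarith : -s ≤ 0)
        gcongr
      have hp := Real.rpow_pos_of_pos hd4 (-s)
      have := hI.trans (aux_const _ x₁ r₁ (2 * r₂ * (|x₁ - x₂| / 4) ^ (-s)) hr₁ (by positivity)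
        fun x hx => aux_const _ x₂ r₂ ((|x₁ - x₂| / 4) ^ (-s)) hr₂ hp.le fun y hy => by
          apply ENNReal.ofReal_le_ofReal
          apply Real.rpow_le_rpow_of_nonpos hd4 _ (by linarith)
          have e1 : |x₁ - x| < r₁ := abs_lt.2 ⟨by linarith [hx.2], by linarith [hx.1]⟩
          have e2 : |y - x₂| < r₂ := abs_lt.2 ⟨by linarith [hy.1], by linarith [hy.2]⟩
          have e3 := abs_sub_le x₁ x x₂
          have e4 := abs_sub_le x y x₂
          linarith)
      rw [ENNReal.ofReal_le_ofReal_iff (by positivity)] at this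
      calc J ≤ r₁ * r₂ * (2 * 2 * (|x₁ - x₂| / 4) ^ (-s)) := by linarith
        _ ≤ _ := by gcongr
  · exact aux_fin s hs₀ (2 * K) _ J r₁ r₂ r₁ hr₁ hr₂ hr₁ hcc hB1
  · exact aux_fin s hs₀ (2 * K) _ J r₁ r₂ r₂ hr₁ hr₂ hr₂ hcc hB2
end
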